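/- arXiv:2603.03847 — 2 statements merged into one kernel-verified Lean document; each statement's English description precedes it below -/
import Mathlib

section
/- Let k, m ∈ ℕ, let α ∈ (k−1, k) be a non-integer real, and let ω ∈ 𝒰^{α,m}_{−1+}((−1,1)). Then for every integer n with n > α + m, the n-th Legendre coefficient ω̂_n of ω satisfies |ω̂_n| ≤ { (2n+1)Γ((n−α−m+1)/2) / (2^{α+m+1} √π Γ((n+α+m)/2 + 1)) + |sin(απ)| · ((n+α+m)/(n−α−m+2)) · Ĉ_{n,α} } · U^{α,m}_{−1+}(ω;(−1,1)), where Ĉ_{n,α} := 2^α Γ(α+1) ((2n+1)/π) Γ(n−α)/Γ(n+α+2). -/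
open MeasureTheory Set Filter

/-- The left Caputo fractional derivative of order `α ∈ (k−1,k)` based at `a`:
`(^C D^α_{a+} u)(x) = (1/Γ(k−α)) ∫_a^x (x−y)^{k−α−1} u^{(k)}(y) dy`. -/
noncomputable def caputoL (k : ℕ) (α a : ℝ) (u : ℝ → ℝ) (x : ℝ) : ℝ :=
  (1 / Real.Gamma ((k : ℝ) - α)) *
    ∫ y in a..x, (x - y) ^ ((k : ℝ) - α - 1) * iteratedDeriv k u y

/-- Membership `ω ∈ 𝒰^{α,m}_{−1+}((−1,1))`: `ω ∈ W^{k,1}(−1,1)` and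
`^C D^α_{−1+} ω ∈ W^{m,1}(−1,1)`, with `L i` the (finite) right-hand limits
`D^i(^C D^α_{−1+} ω)(−1+)` for `i < m`. -/
def MemUL (k m : ℕ) (α : ℝ) (ω : ℝ → ℝ) (L : ℕ → ℝ) : Prop :=
  ContinuousOn ω (Icc (-1 : ℝ) 1) ∧
  (∀ i < k, ∀ x ∈ Ioo (-1 : ℝ) 1,
      HasDerivAt (iteratedDeriv i ω) (iteratedDeriv (i + 1) ω x) x) ∧
  (∀ i ≤ k, IntervalIntegrable (iteratedDeriv i ω) volume (-1) 1) ∧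
  (∀ i < m, ∀ x ∈ Ioo (-1 : ℝ) 1,
      HasDerivAt (iteratedDeriv i (caputoL k α (-1) ω))
        (iteratedDeriv (i + 1) (caputoL k α (-1) ω) x) x) ∧
  (∀ i ≤ m, IntervalIntegrable (iteratedDeriv i (caputoL k α (-1) ω)) volume (-1) 1) ∧
  (∀ i < m, Tendsto (iteratedDeriv i (caputoL k α (-1) ω))
      (nhdsWithin (-1 : ℝ) (Ioi (-1))) (nhds (L i)))

/-- The semi-norm `U^{α,m}_{−1+}(ω;(−1,1))`. -/
noncomputable def UsemiL (k m : ℕ) (α : ℝ) (ω : ℝ → ℝ) (L : ℕ → ℝ) : ℝ :=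
  (∫ x in (-1 : ℝ)..1, |iteratedDeriv m (caputoL k α (-1) ω) x|) +
    ∑ i ∈ Finset.range m, |L i|

/-- The Legendre polynomial of degree `n` via Rodrigues' formula. -/
noncomputable def legendre (n : ℕ) (x : ℝ) : ℝ :=
  (1 / ((2 : ℝ) ^ n * (Nat.factorial n : ℝ))) *
    iteratedDeriv n (fun y : ℝ => (y ^ 2 - 1) ^ n) x

/-- The `n`-th Legendre coefficient of `f`. -/
noncomputable def legCoeff (f : ℝ → ℝ) (n : ℕ) : ℝ :=
  ((2 * (n : ℝ) + 1) / 2) * ∫ x in (-1 : ℝ)..1, f x * legendre n x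

/-- The coefficient `d_j` such that `L_n(x) = ∑ j, d_j / j! * (1 - x) ^ j`. -/
noncomputable def legendreCoeffOne (n j : ℕ) : ℝ :=
  (-1) ^ j * n.choose j * (n + j).choose n * j.factorial / 2 ^ j

/-- The right Riemann–Liouville fractional integral of order `μ`, based at `1`, of `L_n`. -/
noncomputable def legendreInt (n : ℕ) (μ x : ℝ) : ℝ :=
  ∑ j ∈ Finset.range (n + 1),
    legendreCoeffOne n j * ((1 - x) ^ (μ + j) / Real.Gamma (μ + j + 1))

lemma legendreCoeffOne_zero (n : ℕ) : legendreCoeffOne n 0 = 1 := by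
  simp [legendreCoeffOne]

lemma legendreCoeffOne_succ_self (n : ℕ) : legendreCoeffOne n (n + 1) = 0 := by
  simp [legendreCoeffOne]

lemma legendreCoeffOne_succ (n j : ℕ) (hj : j ≤ n) :
    2 * ((j : ℝ) + 1) * legendreCoeffOne n (j + 1) =
      -(((n : ℝ) - j) * (n + j + 1) * legendreCoeffOne n j) := by
  have h1 : ((n.choose (j + 1) : ℕ) : ℝ) * (j + 1) = n.choose j * ((n : ℝ) - j) := by
    have := Nat.choose_succ_right_eq n j
    have h : ((n.choose (j + 1) * (j + 1) : ℕ) : ℝ) = ((n.choose j * (n - j) : ℕ) : ℝ) := by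
      rw [this]
    push_cast [Nat.cast_sub hj] at h
    exact h
  have h2 : (((n + (j + 1)).choose n : ℕ) : ℝ) * (j + 1) = (n + j).choose n * ((n : ℝ) + j + 1) := by
    have := Nat.choose_mul_succ_eq (n + j) n
    rw [show n + j + 1 - n = j + 1 by omega] at this
    have h : (((n + j).choose n * (n + j + 1) : ℕ) : ℝ) =
      (((n + j + 1).choose n * (j + 1) : ℕ) : ℝ) := by rw [this]
    push_cast at h
    rw [show n + (j + 1) = n + j + 1 by ring]
    linarith
  unfold legendreCoeffOne
  rw [Nat.factorial_succ, pow_succ, pow_succ]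
  push_cast
  have h3 : (2 : ℝ) ^ j ≠ 0 := by positivity
  field_simp
  linear_combination (-1 : ℝ) * (n + (j + 1)).choose n * (j + 1) * h1 -
    n.choose j * ((n : ℝ) - j) * h2

lemma hasDerivAt_legendreInt (n : ℕ) {μ x : ℝ} (hμ : 0 < μ) (hx : x < 1) :
    HasDerivAt (legendreInt n μ) (-legendreInt n (μ - 1) x) x := by
  unfold legendreInt
  rw [← Finset.sum_neg_distrib]
  refine HasDerivAt.fun_sum fun j _ => ?_
  have hμj : 0 < μ + j := by positivity
  have h1 : HasDerivAt (fun x : ℝ => 1 - x) (-1) x := by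
    simpa using (hasDerivAt_id x).const_sub 1
  have h2 := (h1.rpow_const (p := μ + j) (Or.inl (by linarith))).div_const
    (Real.Gamma (μ + j + 1)) |>.const_mul (legendreCoeffOne n j)
  refine h2.congr_deriv ?_
  rw [Real.Gamma_add_one hμj.ne', show μ - 1 + (j : ℝ) + 1 = μ + j by ring,
    show μ - 1 + (j : ℝ) = μ + j - 1 by ring]
  have := (Real.Gamma_pos_of_pos hμj).ne'
  field_simp

lemma continuous_legendreInt (n : ℕ) {μ : ℝ} (hμ : 0 ≤ μ) : Continuous (legendreInt n μ) := by
  unfold legendreInt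
  refine continuous_finsetSum _ fun j _ => ?_
  have : Continuous fun x : ℝ => (1 - x) ^ (μ + j) :=
    (continuous_const.sub continuous_id).rpow_const fun x => Or.inr (by positivity)
  fun_prop

lemma legendreInt_one (n : ℕ) {μ : ℝ} (hμ : 0 < μ) : legendreInt n μ 1 = 0 := by
  unfold legendreInt
  refine Finset.sum_eq_zero fun j _ => ?_
  rw [sub_self, Real.zero_rpow (by positivity)]
  simp

lemma legendreInt_ode (n : ℕ) {μ x : ℝ} (hμ : 1 < μ) (hx : x < 1) :
    (1 - x ^ 2) * legendreInt n (μ - 2) x - 2 * (μ - 1) * x * legendreInt n (μ - 1) x +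
      (n - μ + 1) * (n + μ) * legendreInt n μ x = 0 := by
  obtain ⟨y, rfl⟩ : ∃ y, x = 1 - y := ⟨1 - x, by ring⟩
  have hy : 0 < y := by linarith
  unfold legendreInt
  rw [Finset.mul_sum, Finset.mul_sum, Finset.mul_sum, ← Finset.sum_sub_distrib,
    ← Finset.sum_add_distrib]
  let T : ℕ → ℝ := fun j => 2 * j * legendreCoeffOne n j * y ^ (μ + j - 1) / Real.Gamma (μ + j)
  have key : ∀ j ∈ Finset.range (n + 1),
      (1 - (1 - y) ^ 2) * (legendreCoeffOne n j *
          ((1 - (1 - y)) ^ (μ - 2 + j) / Real.Gamma (μ - 2 + j + 1))) -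
        2 * (μ - 1) * (1 - y) * (legendreCoeffOne n j *
          ((1 - (1 - y)) ^ (μ - 1 + j) / Real.Gamma (μ - 1 + j + 1))) +
        (n - μ + 1) * (n + μ) * (legendreCoeffOne n j *
          ((1 - (1 - y)) ^ (μ + j) / Real.Gamma (μ + j + 1))) = T j - T (j + 1) := by
    intro j hj
    have hjn : j ≤ n := by simpa [Nat.lt_succ_iff] using hj
    have hrec := legendreCoeffOne_succ n j hjn
    have hj0 : (0 : ℝ) ≤ j := by positivity
    have e0 : μ + j - 1 ≠ 0 := by linarith
    have e1 : μ + j ≠ 0 := by linarith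
    have g1 : Real.Gamma (μ + j) = (μ + j - 1) * Real.Gamma (μ + j - 1) := by
      rw [← Real.Gamma_add_one e0]; ring_nf
    have g2 : Real.Gamma (μ + j + 1) = (μ + j) * ((μ + j - 1) * Real.Gamma (μ + j - 1)) := by
      rw [Real.Gamma_add_one e1, g1]
    have g0 : Real.Gamma (μ + j - 1) ≠ 0 := (Real.Gamma_pos_of_pos (by linarith)).ne'
    have p1 : y ^ (μ - 1 + j) = y ^ (μ - 2 + j) * y := by
      rw [← Real.rpow_add_one hy.ne']; ring_nf
    have p2 : y ^ (μ + j) = y ^ (μ - 2 + j) * y * y := by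
      rw [← Real.rpow_add_one hy.ne', ← Real.rpow_add_one hy.ne']; ring_nf
    simp only [T]
    push_cast
    rw [show 1 - (1 - y) = y by ring, show μ - 2 + (j : ℝ) + 1 = μ + j - 1 by ring,
      show μ - 1 + (j : ℝ) + 1 = μ + j by ring, show μ + ((j : ℝ) + 1) - 1 = μ + j by ring,
      show μ + ((j : ℝ) + 1) = μ + j + 1 by ring, show μ + (j : ℝ) - 1 = μ - 1 + j by ring,
      hrec, p1, p2]
    rw [show μ - 1 + (j : ℝ) = μ + j - 1 by ring, g1, g2]
    field_simp
    ring
  rw [Finset.sum_congr rfl key, Finset.sum_range_sub']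
  simp [T, legendreCoeffOne_succ_self]

lemma legendreInt_neg_one_rec (n : ℕ) {μ : ℝ} (hμ : 1 < μ) :
    2 * (μ - 1) * legendreInt n (μ - 1) (-1) = -((n - μ + 1) * (n + μ) * legendreInt n μ (-1)) := by
  have := legendreInt_ode n hμ (show (-1 : ℝ) < 1 by norm_num)
  norm_num at this
  linarith

lemma legendreInt_zero_rec (n : ℕ) {μ : ℝ} (hμ : 1 < μ) :
    legendreInt n (μ - 2) 0 = -((n - μ + 1) * (n + μ) * legendreInt n μ 0) := by
  have := legendreInt_ode n hμ (show (0 : ℝ) < 1 by norm_num)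
  norm_num at this
  linarith

lemma legendreInt_neg_one_eq_zero (n : ℕ) {i : ℕ} (hi : 1 ≤ i) (hin : i ≤ n) :
    legendreInt n i (-1) = 0 := by
  induction hin using Nat.decreasingInduction with
  | self =>
    have h := legendreInt_neg_one_rec n (μ := n + 1) (by
      have : (1 : ℝ) ≤ n := by exact_mod_cast hi
      linarith)
    have : (1 : ℝ) ≤ n := by exact_mod_cast hi
    rw [show (n : ℝ) - (n + 1) + 1 = 0 by ring, add_sub_cancel_right] at h
    simpa [show (n : ℝ) ≠ 0 by linarith] using h
  | of_succ i _ ih =>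
    have h1 : (1 : ℝ) ≤ i := by exact_mod_cast hi
    have h := legendreInt_neg_one_rec n (μ := i + 1) (by linarith)
    have h' := ih (by omega)
    push_cast at h'
    rw [h', add_sub_cancel_right] at h
    simpa [show (i : ℝ) ≠ 0 by linarith] using h

lemma Gamma_add_nat_eq_prod_Ico {μ : ℝ} (hμ : -1 < μ) (j n : ℕ) (hj : j ≤ n) :
    Real.Gamma (μ + n + 1) =
      Real.Gamma (μ + j + 1) * ∏ i ∈ Finset.Ico j n, (μ + (i + 1)) := by
  induction n, hj using Nat.le_induction with
  | base => simp
  | succ n hn ih =>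
    have : (0 : ℝ) ≤ n := by positivity
    rw [Finset.prod_Ico_succ_top hn, ← mul_assoc, ← ih, Nat.cast_succ,
      show μ + ((n : ℝ) + 1) + 1 = (μ + n + 1) + 1 by ring, Real.Gamma_add_one (by linarith)]
    ring

open Polynomial in
/-- The polynomial `μ ↦ Γ(μ + n + 1) t^{-μ} (I^μ L_n)(1 - t)`. -/
noncomputable def legendreIntPoly (n : ℕ) (t : ℝ) : ℝ[X] :=
  ∑ j ∈ Finset.range (n + 1), C (legendreCoeffOne n j * t ^ j) *
    ∏ i ∈ Finset.Ico j n, (X - C (-((i : ℝ) + 1)))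

lemma legendreInt_mul_Gamma (n : ℕ) {μ t : ℝ} (hμ : -1 < μ) (ht : 0 < t) :
    legendreInt n μ (1 - t) * Real.Gamma (μ + n + 1) =
      t ^ μ * (legendreIntPoly n t).eval μ := by
  unfold legendreInt legendreIntPoly
  rw [Polynomial.eval_finsetSum, Finset.sum_mul, Finset.mul_sum]
  refine Finset.sum_congr rfl fun j hj => ?_
  have hj0 : (0 : ℝ) ≤ j := by positivity
  rw [Gamma_add_nat_eq_prod_Ico hμ j n (by simpa [Nat.lt_succ_iff] using hj),
    show 1 - (1 - t) = t by ring, Real.rpow_add_natCast ht.ne']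
  have := (Real.Gamma_pos_of_pos (show 0 < μ + j + 1 by linarith)).ne'
  simp only [Polynomial.eval_mul, Polynomial.eval_C, Polynomial.eval_prod, Polynomial.eval_sub,
    Polynomial.eval_X, sub_neg_eq_add]
  field_simp

open Polynomial in
lemma legendreIntPoly_eq_prod (n : ℕ) (t : ℝ) (r : ℕ → ℝ) (hr : Function.Injective r)
    (h : ∀ i < n, (legendreIntPoly n t).eval (r i) = 0) :
    legendreIntPoly n t = ∏ i ∈ Finset.range n, (X - C (r i)) := by
  have hdeg : ∀ (s : Finset ℕ) (f : ℕ → ℝ), (∏ i ∈ s, (X - C (f i))).degree = (s.card : WithBot ℕ) := by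
    intro s f
    rw [degree_prod]
    simp
  have hmon : ∀ (s : Finset ℕ) (f : ℕ → ℝ), (∏ i ∈ s, (X - C (f i))).Monic := fun s f =>
    monic_prod_of_monic _ _ fun i _ => monic_X_sub_C _
  refine eq_of_degree_sub_lt_of_eval_finset_eq ((Finset.range n).image r) ?_ ?_
  · rw [Finset.card_image_of_injective _ hr, Finset.card_range, ← mem_degreeLT]
    unfold legendreIntPoly
    rw [Finset.sum_range_succ', add_sub_assoc]
    refine Submodule.add_mem _ (Submodule.sum_mem _ fun j hj => ?_) ?_
    · have hj' : j < n := by simpa using hj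
      rw [← smul_eq_C_mul]
      refine Submodule.smul_mem _ _ (mem_degreeLT.2 ?_)
      rw [hdeg, Nat.card_Ico]
      exact_mod_cast (by omega : n - (j + 1) < n)
    · simp only [legendreCoeffOne_zero, pow_zero, mul_one, C_1, one_mul, Nat.Ico_zero_eq_range]
      rw [mem_degreeLT]
      have := degree_sub_lt_left ((hdeg (Finset.range n) (fun i => -((i : ℝ) + 1))).trans
        (hdeg (Finset.range n) r).symm) (hmon _ _).ne_zero
        ((hmon _ _).leadingCoeff.trans (hmon _ _).leadingCoeff.symm)
      rwa [hdeg, Finset.card_range] at this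
  · intro x hx
    obtain ⟨i, hi, rfl⟩ := Finset.mem_image.1 hx
    rw [h i (by simpa using hi), eval_prod, Finset.prod_eq_zero hi]
    simp

lemma legendreInt_neg_one_mul_Gamma (n : ℕ) {μ : ℝ} (hμ : -1 < μ) :
    legendreInt n μ (-1) * Real.Gamma (μ + n + 1) =
      2 ^ μ * ∏ i ∈ Finset.range n, (μ - (i + 1)) := by
  have h := legendreInt_mul_Gamma n hμ (t := 2) (by norm_num)
  rw [show (1 : ℝ) - 2 = -1 by norm_num] at h
  rw [h, legendreIntPoly_eq_prod n 2 (fun i => (i : ℝ) + 1), Polynomial.eval_prod]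
  · simp
  · intro i j hij
    simpa using hij
  · intro i hi
    have h2 := legendreInt_mul_Gamma n (μ := (i : ℝ) + 1) (t := 2)
      (by have : (0 : ℝ) ≤ i := by positivity
          linarith) (by norm_num)
    have h3 := legendreInt_neg_one_eq_zero n (i := i + 1) (by omega) (by omega)
    push_cast at h3
    rw [show (1 : ℝ) - 2 = -1 by norm_num, h3, zero_mul] at h2
    have : (2 : ℝ) ^ ((i : ℝ) + 1) ≠ 0 := (Real.rpow_pos_of_pos (by norm_num) _).ne'
    simpa [this] using h2.symm

open Polynomial in
lemma legendreIntPoly_one_rec (n : ℕ) (μ : ℝ) :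
    (μ + n - 1) * (legendreIntPoly n 1).eval (μ - 2) =
      (μ - n - 1) * (legendreIntPoly n 1).eval μ := by
  have key : (X + C ((n : ℝ) - 1)) * (legendreIntPoly n 1).comp (X - C 2) =
      (X - C ((n : ℝ) + 1)) * legendreIntPoly n 1 := by
    refine eq_of_infinite_eval_eq _ _ ((Set.Ioi_infinite (1 : ℝ)).mono fun μ hμ => ?_)
    have hμ : 1 < μ := hμ
    have hn : (0 : ℝ) ≤ n := by positivity
    have h1 := legendreInt_mul_Gamma n (μ := μ) (t := 1) (by linarith) (by norm_num)
    have h2 := legendreInt_mul_Gamma n (μ := μ - 2) (t := 1) (by linarith) (by norm_num)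
    have h3 := legendreInt_zero_rec n hμ
    rw [sub_self, Real.one_rpow, one_mul] at h1 h2
    simp only [Set.mem_ofPred_eq, eval_mul, eval_add, eval_X, eval_C, eval_comp, eval_sub]
    have g : Real.Gamma (μ + n + 1) = (μ + n) * ((μ + n - 1) * Real.Gamma (μ - 2 + n + 1)) := by
      rw [Real.Gamma_add_one (by linarith), show μ - 2 + n + 1 = μ + n - 1 by ring,
        ← Real.Gamma_add_one (s := μ + n - 1) (by linarith), sub_add_cancel]
    rw [← h1, ← h2, h3, g]
    ring
  have := congrArg (eval μ) key
  simp only [eval_mul, eval_add, eval_X, eval_C, eval_comp, eval_sub] at this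
  linarith

lemma legendreInt_zero_mul_Gamma (n : ℕ) {μ : ℝ} (hμ : -1 < μ) :
    legendreInt n μ 0 * Real.Gamma (μ + n + 1) =
      ∏ i ∈ Finset.range n, (μ - n + 1 + 2 * i) := by
  have h := legendreInt_mul_Gamma n hμ (t := 1) (by norm_num)
  rw [sub_self, Real.one_rpow, one_mul] at h
  rw [h, legendreIntPoly_eq_prod n 1 (fun i => (n : ℝ) - 1 - 2 * i), Polynomial.eval_prod]
  · refine Finset.prod_congr rfl fun i _ => ?_
    simp only [Polynomial.eval_sub, Polynomial.eval_X, Polynomial.eval_C]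
    ring
  · intro i j hij
    simpa using hij
  · intro i hi
    induction i with
    | zero =>
      have h := legendreIntPoly_one_rec n (n + 1)
      rw [show (n : ℝ) + 1 - n - 1 = 0 by ring, zero_mul,
        show (n : ℝ) + 1 + n - 1 = 2 * n by ring, show (n : ℝ) + 1 - 2 = n - 1 by ring] at h
      have : (n : ℝ) ≠ 0 := by exact_mod_cast hi.ne'
      simpa [this] using h
    | succ i ih =>
      have h := legendreIntPoly_one_rec n ((n : ℝ) - 1 - 2 * i)
      rw [ih (by omega), mul_zero] at h
      have : (n : ℝ) - 1 - i ≠ 0 := by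
        have : ((i + 1 : ℕ) : ℝ) < n := by exact_mod_cast hi
        push_cast at this
        linarith
      rw [show (n : ℝ) - 1 - 2 * i + n - 1 = 2 * (n - 1 - i) by ring,
        show (n : ℝ) - 1 - 2 * i - 2 = n - 1 - 2 * (i + 1) by ring] at h
      push_cast
      simpa [this] using h

lemma Gamma_midpoint_sq_le {x y : ℝ} (hx : 0 < x) (hy : 0 < y) :
    Real.Gamma ((x + y) / 2) ^ 2 ≤ Real.Gamma x * Real.Gamma y := by
  have h := Real.Gamma_mul_add_mul_le_rpow_Gamma_mul_rpow_Gamma hx hy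
    (a := 1 / 2) (b := 1 / 2) (by norm_num) (by norm_num) (by norm_num)
  rw [← Real.sqrt_eq_rpow, ← Real.sqrt_eq_rpow,
    ← Real.sqrt_mul (Real.Gamma_pos_of_pos hx).le] at h
  rw [show (x + y) / 2 = 1 / 2 * x + 1 / 2 * y by ring]
  have h0 : 0 < Real.Gamma (1 / 2 * x + 1 / 2 * y) := Real.Gamma_pos_of_pos (by positivity)
  calc _ ≤ √(Real.Gamma x * Real.Gamma y) ^ 2 := by gcongr
    _ = _ := Real.sq_sqrt (mul_pos (Real.Gamma_pos_of_pos hx) (Real.Gamma_pos_of_pos hy)).le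

/-- The squared normalized Gamma half-step ratio `Γ(x + 1/2)² / (x Γ(x)²)`. -/
noncomputable def gammaHalfRatio (x : ℝ) : ℝ :=
  Real.Gamma (x + 1 / 2) ^ 2 / (x * Real.Gamma x ^ 2)

lemma gammaHalfRatio_pos {x : ℝ} (hx : 0 < x) : 0 < gammaHalfRatio x := by
  have h1 := Real.Gamma_pos_of_pos hx
  have h2 := Real.Gamma_pos_of_pos (show 0 < x + 1 / 2 by linarith)
  unfold gammaHalfRatio
  positivity

lemma gammaHalfRatio_add_one {x : ℝ} (hx : 0 < x) :
    gammaHalfRatio (x + 1) = gammaHalfRatio x * ((x + 1 / 2) ^ 2 / (x * (x + 1))) := by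
  have h1 := Real.Gamma_pos_of_pos hx
  unfold gammaHalfRatio
  rw [show x + 1 + 1 / 2 = x + 1 / 2 + 1 by ring, Real.Gamma_add_one (by linarith),
    Real.Gamma_add_one hx.ne']
  field_simp

lemma gammaHalfRatio_le_one {x : ℝ} (hx : 0 < x) : gammaHalfRatio x ≤ 1 := by
  have h1 := Real.Gamma_pos_of_pos hx
  have h := Gamma_midpoint_sq_le hx (show 0 < x + 1 by linarith)
  rw [show (x + (x + 1)) / 2 = x + 1 / 2 by ring, Real.Gamma_add_one hx.ne'] at h
  unfold gammaHalfRatio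
  rw [div_le_one (by positivity)]
  linarith

lemma le_gammaHalfRatio {x : ℝ} (hx : 1 / 2 < x) : 1 - 1 / 2 / x ≤ gammaHalfRatio x := by
  have h1 := Real.Gamma_pos_of_pos (show 0 < x by linarith)
  have h2 := Real.Gamma_pos_of_pos (show 0 < x - 1 / 2 by linarith)
  have h := Gamma_midpoint_sq_le (show 0 < x - 1 / 2 by linarith) (show 0 < x + 1 / 2 by linarith)
  rw [show (x - 1 / 2 + (x + 1 / 2)) / 2 = x by ring] at h
  have h3 : Real.Gamma (x + 1 / 2) = (x - 1 / 2) * Real.Gamma (x - 1 / 2) := by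
    rw [← Real.Gamma_add_one (by linarith)]; ring_nf
  unfold gammaHalfRatio
  rw [le_div_iff₀ (by positivity)]
  have hx0 : x ≠ 0 := by linarith
  calc _ = (x - 1 / 2) * Real.Gamma x ^ 2 := by field_simp
    _ ≤ (x - 1 / 2) * (Real.Gamma (x - 1 / 2) * Real.Gamma (x + 1 / 2)) := by
        apply mul_le_mul_of_nonneg_left h; linarith
    _ = _ := by rw [h3]; ring

lemma gammaHalfRatio_mul_le {s t : ℝ} (hs : 0 < s) (hst : s ≤ t) (N : ℕ) :
    gammaHalfRatio s * gammaHalfRatio (t + N) ≤ gammaHalfRatio t * gammaHalfRatio (s + N) := by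
  induction N with
  | zero => simp [mul_comm]
  | succ N ih =>
    have hsN : 0 < s + N := by positivity
    have htN : 0 < t + N := by linarith
    have hr : (t + N + 1 / 2) ^ 2 / ((t + N) * (t + N + 1)) ≤
        (s + N + 1 / 2) ^ 2 / ((s + N) * (s + N + 1)) := by
      rw [div_le_div_iff₀ (by positivity) (by positivity)]
      nlinarith [mul_nonneg (show 0 ≤ t - s by linarith) (show 0 ≤ s + N + (t + N) + 1 by linarith)]
    push_cast
    rw [← add_assoc, ← add_assoc, gammaHalfRatio_add_one hsN, gammaHalfRatio_add_one htN,
      ← mul_assoc, ← mul_assoc]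
    have := gammaHalfRatio_pos hs
    have := gammaHalfRatio_pos (hs.trans_le hst)
    have := gammaHalfRatio_pos hsN
    exact mul_le_mul ih hr (by positivity) (by positivity)

lemma gammaHalfRatio_le {s t : ℝ} (hs : 0 < s) (hst : s ≤ t) :
    gammaHalfRatio s ≤ gammaHalfRatio t := by
  have ht := hs.trans_le hst
  have hlim : Tendsto (fun N : ℕ => gammaHalfRatio s * (1 - 1 / 2 / (t + N))) atTop
      (nhds (gammaHalfRatio s * (1 - 0))) :=
    ((tendsto_const_nhds.div_atTop
      (tendsto_atTop_add_const_left _ t tendsto_natCast_atTop_atTop)).const_sub 1).const_mul _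
  rw [sub_zero, mul_one] at hlim
  refine le_of_tendsto hlim ?_
  filter_upwards [eventually_ge_atTop 1] with N hN
  have hN' : (1 : ℝ) ≤ N := by exact_mod_cast hN
  have hsN : 0 < s + N := by positivity
  calc _ ≤ gammaHalfRatio s * gammaHalfRatio (t + N) :=
        mul_le_mul_of_nonneg_left (le_gammaHalfRatio (by linarith)) (gammaHalfRatio_pos hs).le
    _ ≤ gammaHalfRatio t * gammaHalfRatio (s + N) := gammaHalfRatio_mul_le hs hst N
    _ ≤ _ := mul_le_of_le_one_right (gammaHalfRatio_pos ht).le (gammaHalfRatio_le_one hsN)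

lemma prod_range_add_eq_Gamma (n : ℕ) {a : ℝ} (ha : ∀ j : ℤ, a ≠ j) :
    ∏ i ∈ Finset.range n, (a + i) =
      Real.Gamma (a + n) * Real.Gamma (1 - a) * Real.sin (Real.pi * a) / Real.pi := by
  have hΓ : Real.Gamma a ≠ 0 := Real.Gamma_ne_zero fun m h => ha (-m) (by push_cast; exact h)
  have h1 : Real.Gamma (a + n) = Real.Gamma a * ∏ i ∈ Finset.range n, (a + i) := by
    induction n with
    | zero => simp
    | succ n ih =>
      have : a + n ≠ 0 := fun h => ha (-n) (by push_cast; linarith)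
      rw [Finset.prod_range_succ, ← mul_assoc, ← ih, Nat.cast_succ, ← add_assoc,
        Real.Gamma_add_one this, mul_comm]
  have hsin : Real.sin (Real.pi * a) ≠ 0 := by
    intro h
    obtain ⟨j, hj⟩ := Real.sin_eq_zero_iff.1 h
    exact ha j (mul_left_cancel₀ Real.pi_ne_zero (by linarith))
  have h2 := Real.Gamma_mul_Gamma_one_sub a
  rw [eq_div_iff hsin] at h2
  rw [h1, eq_div_iff Real.pi_ne_zero]
  linear_combination (-∏ i ∈ Finset.range n, (a + i)) * h2

/-- The uniform bound `Γ((n-μ+1)/2) / (2^μ √π Γ((n+μ)/2 + 1))` for `I^μ L_n`. -/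
noncomputable def legendreIntBound (n : ℕ) (μ : ℝ) : ℝ :=
  Real.Gamma ((n - μ + 1) / 2) / (2 ^ μ * √Real.pi * Real.Gamma ((n + μ) / 2 + 1))

lemma legendreInt_zero_eq (n : ℕ) {μ : ℝ} (hμ : -1 < μ) (hint : ∀ j : ℤ, μ ≠ j) :
    legendreInt n μ 0 = legendreIntBound n μ * Real.sin (Real.pi * ((μ - n + 1) / 2)) := by
  have hn : (0 : ℝ) ≤ n := by positivity
  have h := legendreInt_zero_mul_Gamma n hμ
  have hprod : ∏ i ∈ Finset.range n, (μ - n + 1 + 2 * (i : ℝ)) =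
      2 ^ n * ∏ i ∈ Finset.range n, ((μ - n + 1) / 2 + i) := by
    have h2 : ∀ i ∈ Finset.range n, μ - n + 1 + 2 * (i : ℝ) = 2 * ((μ - n + 1) / 2 + i) :=
      fun i _ => by ring
    rw [Finset.prod_congr rfl h2, Finset.prod_mul_distrib]
    simp
  rw [hprod, prod_range_add_eq_Gamma n (fun j hj => hint (2 * j + n - 1) (by push_cast; linarith)),
    show (μ - n + 1) / 2 + (n : ℝ) = (μ + n + 1) / 2 by ring,
    show 1 - (μ - n + 1) / 2 = (n - μ + 1) / 2 by ring] at h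
  have hd := Real.Gamma_mul_Gamma_add_half ((μ + n + 1) / 2)
  rw [show (μ + n + 1) / 2 + 1 / 2 = (n + μ) / 2 + 1 by ring,
    show 2 * ((μ + n + 1) / 2) = μ + n + 1 by ring,
    show 1 - (μ + (n : ℝ) + 1) = -(μ + n) by ring, Real.rpow_neg (by norm_num),
    Real.rpow_add_natCast (by norm_num)] at hd
  have g1 := Real.Gamma_pos_of_pos (show 0 < (μ + n + 1) / 2 by linarith)
  have g2 := Real.Gamma_pos_of_pos (show 0 < (n + μ) / 2 + 1 by linarith)
  have g3 := Real.Gamma_pos_of_pos (show 0 < μ + n + 1 by linarith)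
  have h2 : (0 : ℝ) < 2 ^ μ := Real.rpow_pos_of_pos (by norm_num) _
  have hpi := Real.pi_pos
  have hsq : √Real.pi ^ 2 = Real.pi := Real.sq_sqrt hpi.le
  have hG : Real.Gamma (μ + n + 1) = Real.Gamma ((μ + n + 1) / 2) *
      Real.Gamma ((n + μ) / 2 + 1) * (2 ^ μ * 2 ^ n) / √Real.pi := by
    rw [hd]
    field_simp
  rw [hG] at h
  unfold legendreIntBound
  generalize Real.sin _ = S at *
  generalize Real.Gamma ((n + μ) / 2 + 1) = G at *
  field_simp at h ⊢
  apply mul_right_cancel₀ (show √Real.pi ≠ 0 by positivity)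
  linear_combination h + legendreInt n μ 0 * 2 ^ μ * G * hsq

lemma legendreIntBound_pos {n : ℕ} {μ : ℝ} (hμ : 0 ≤ μ) (hn : μ < n + 1) :
    0 < legendreIntBound n μ := by
  have g1 := Real.Gamma_pos_of_pos (show 0 < (n - μ + 1) / 2 by linarith)
  have g2 := Real.Gamma_pos_of_pos (show 0 < (n + μ) / 2 + 1 by positivity)
  have h2 : (0 : ℝ) < 2 ^ μ := Real.rpow_pos_of_pos (by norm_num) _
  have hpi := Real.pi_pos
  unfold legendreIntBound
  positivity

lemma legendreIntBound_sub_one_sq_le {n : ℕ} {μ : ℝ} (hμ : 1 < μ) (hn : μ < n) :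
    legendreIntBound n (μ - 1) ^ 2 ≤
      (n - μ + 1) * (n + μ) * legendreIntBound n μ ^ 2 := by
  obtain ⟨s, hs⟩ : ∃ s, s = ((n : ℝ) - μ + 1) / 2 := ⟨_, rfl⟩
  obtain ⟨t, ht⟩ : ∃ t, t = ((n : ℝ) + μ) / 2 := ⟨_, rfl⟩
  have hs0 : 0 < s := by linarith
  have hst : s ≤ t := by linarith
  have ht0 : 0 < t := by linarith
  have h := gammaHalfRatio_le hs0 hst
  have g1 := Real.Gamma_pos_of_pos hs0
  have g2 := Real.Gamma_pos_of_pos ht0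
  have g3 := Real.Gamma_pos_of_pos (show 0 < s + 1 / 2 by linarith)
  have g4 := Real.Gamma_pos_of_pos (show 0 < t + 1 / 2 by linarith)
  have h2 : (0 : ℝ) < 2 ^ μ := Real.rpow_pos_of_pos (by norm_num) _
  have hpi := Real.pi_pos
  unfold gammaHalfRatio at h
  unfold legendreIntBound
  rw [Real.rpow_sub_one (by norm_num), show ((n : ℝ) - (μ - 1) + 1) / 2 = s + 1 / 2 by rw [hs]; ring,
    show ((n : ℝ) + (μ - 1)) / 2 + 1 = t + 1 / 2 by rw [ht]; ring, ← hs, ← ht,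
    Real.Gamma_add_one ht0.ne', show (n : ℝ) - μ + 1 = 2 * s by linarith,
    show (n : ℝ) + μ = 2 * t by linarith]
  rw [div_le_div_iff₀ (by positivity) (by positivity)] at h
  rw [div_pow, div_pow, ← mul_div_assoc, div_le_div_iff₀ (by positivity) (by positivity)]
  have h5 : 0 ≤ (2 ^ μ) ^ 2 * √Real.pi ^ 2 * t := by positivity
  calc _ = (Real.Gamma (s + 1 / 2) ^ 2 * (t * Real.Gamma t ^ 2)) *
        ((2 ^ μ) ^ 2 * √Real.pi ^ 2 * t) := by ring
    _ ≤ _ := mul_le_mul_of_nonneg_right h h5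
    _ = _ := by ring

lemma abs_legendreInt_le {n : ℕ} {μ : ℝ} (hμ : 1 < μ) (hn : μ < n) (hint : ∀ j : ℤ, μ ≠ j)
    {x : ℝ} (hx : x ∈ Ioo (-1 : ℝ) 1) : |legendreInt n μ x| ≤ legendreIntBound n μ := by
  have hn0 : (0 : ℝ) ≤ n := by positivity
  obtain ⟨b, hb⟩ : ∃ b, b = ((n : ℝ) - μ + 1) * (n + μ) := ⟨_, rfl⟩
  have hb0 : 0 < b := by rw [hb]; exact mul_pos (by linarith) (by linarith)
  let E : ℝ → ℝ := fun x => legendreInt n μ x ^ 2 + (1 - x ^ 2) / b * legendreInt n (μ - 1) x ^ 2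
  have hE : ∀ x < 1, HasDerivAt E (-(2 * (2 * μ - 1) / b * legendreInt n (μ - 1) x ^ 2) * x) x := by
    intro x hx
    have d1 := hasDerivAt_legendreInt n (show 0 < μ by linarith) hx
    have d2 := hasDerivAt_legendreInt n (show 0 < μ - 1 by linarith) hx
    have d3 := ((hasDerivAt_id x).pow 2).const_sub 1 |>.div_const b
    refine ((d1.pow 2).add (d3.mul (d2.pow 2))).congr_deriv ?_
    have ode := legendreInt_ode n hμ hx
    rw [← hb] at ode
    rw [show μ - 1 - 1 = μ - 2 by ring]
    simp only [Pi.pow_apply, id]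
    field_simp
    push_cast
    linear_combination (-2 * legendreInt n (μ - 1) x) * ode
  have hcoef : ∀ x, 0 ≤ 2 * (2 * μ - 1) / b * legendreInt n (μ - 1) x ^ 2 := fun x => by
    have : 0 < 2 * μ - 1 := by linarith
    positivity
  have hE0 : E x ≤ E 0 := by
    rcases le_total 0 x with h0 | h0
    · refine antitoneOn_of_hasDerivWithinAt_nonpos (convex_Icc 0 x)
        (fun y hy => (hE y (hy.2.trans_lt hx.2)).continuousAt.continuousWithinAt)
        (fun y hy => (hE y ?_).hasDerivWithinAt) (fun y hy => ?_) (left_mem_Icc.2 h0)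
        (right_mem_Icc.2 h0) h0
      · rw [interior_Icc] at hy
        exact hy.2.trans hx.2
      · rw [interior_Icc] at hy
        nlinarith [hcoef y, hy.1]
    · refine monotoneOn_of_hasDerivWithinAt_nonneg (convex_Icc x 0)
        (fun y hy => (hE y (hy.2.trans_lt one_pos)).continuousAt.continuousWithinAt)
        (fun y hy => (hE y ?_).hasDerivWithinAt) (fun y hy => ?_) (left_mem_Icc.2 h0)
        (right_mem_Icc.2 h0) h0
      · rw [interior_Icc] at hy
        exact hy.2.trans one_pos
      · rw [interior_Icc] at hy
        nlinarith [hcoef y, hy.2]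
  have hE1 : legendreInt n μ x ^ 2 ≤ E x := by
    have : 0 ≤ 1 - x ^ 2 := by nlinarith [hx.1, hx.2]
    simp only [E]
    have : 0 ≤ (1 - x ^ 2) / b * legendreInt n (μ - 1) x ^ 2 := by positivity
    linarith
  have hE2 : E 0 ≤ legendreIntBound n μ ^ 2 := by
    have hle := legendreIntBound_sub_one_sq_le hμ hn
    rw [← hb] at hle
    simp only [E]
    rw [legendreInt_zero_eq n (by linarith) hint, legendreInt_zero_eq n (μ := μ - 1) (by linarith)
      (fun j hj => hint (j + 1) (by push_cast; linarith)),
      show Real.pi * ((μ - n + 1) / 2) = Real.pi * ((μ - 1 - n + 1) / 2) + Real.pi / 2 by ring,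
      Real.sin_add_pi_div_two]
    have hsc := Real.sin_sq_add_cos_sq (Real.pi * ((μ - 1 - n + 1) / 2))
    generalize Real.sin _ = S at *
    generalize Real.cos _ = C at *
    have h6 : (1 - 0 ^ 2) / b * (legendreIntBound n (μ - 1) * S) ^ 2 ≤
        legendreIntBound n μ ^ 2 * S ^ 2 := by
      rw [show (1 - 0 ^ 2) / b * (legendreIntBound n (μ - 1) * S) ^ 2 =
        legendreIntBound n (μ - 1) ^ 2 * S ^ 2 / b by ring, div_le_iff₀ hb0]
      nlinarith [mul_le_mul_of_nonneg_right hle (sq_nonneg S)]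
    calc _ ≤ (legendreIntBound n μ * C) ^ 2 + legendreIntBound n μ ^ 2 * S ^ 2 := by gcongr
      _ = legendreIntBound n μ ^ 2 * (S ^ 2 + C ^ 2) := by ring
      _ = _ := by rw [hsc, mul_one]
  exact abs_le_of_sq_le_sq (hE1.trans (hE0.trans hE2))
    (legendreIntBound_pos (by linarith) (by linarith)).le

lemma abs_legendreInt_neg_one_add_one {n : ℕ} {α : ℝ} (hα : 0 < α) (hn : α < n)
    (hint : ∀ j : ℤ, α ≠ j) :
    |legendreInt n (α + 1) (-1)| =
      2 ^ (α + 1) * Real.Gamma (α + 1) * Real.Gamma (n - α) * |Real.sin (α * Real.pi)| /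
        (Real.pi * Real.Gamma (n + α + 2)) := by
  have h := legendreInt_neg_one_mul_Gamma n (μ := α + 1) (by linarith)
  have hprod : ∏ i ∈ Finset.range n, (α + 1 - ((i : ℝ) + 1)) =
      ∏ i ∈ Finset.range n, ((α - n + 1) + i) := by
    rw [← Finset.prod_range_reflect]
    refine Finset.prod_congr rfl fun i hi => ?_
    have hi' : i + 1 ≤ n := by simpa using hi
    rw [show n - 1 - i = n - (i + 1) by omega, Nat.cast_sub hi']
    push_cast
    ring
  have hsin : Real.sin (Real.pi * (α - n + 1)) = -((-1) ^ n * Real.sin (α * Real.pi)) := by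
    rw [show Real.pi * (α - n + 1) = α * Real.pi - n * Real.pi + Real.pi by ring,
      Real.sin_add_pi, Real.sin_sub_nat_mul_pi]
  rw [hprod, prod_range_add_eq_Gamma n (fun j hj => hint (j + n - 1) (by push_cast; linarith)),
    show α - n + 1 + n = α + 1 by ring, show 1 - (α - n + 1) = n - α by ring,
    show α + 1 + n + 1 = n + α + 2 by ring, hsin] at h
  have g1 := Real.Gamma_pos_of_pos (show 0 < α + 1 by linarith)
  have g2 := Real.Gamma_pos_of_pos (show 0 < n - α by linarith)
  have g3 := Real.Gamma_pos_of_pos (show 0 < n + α + 2 by positivity)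
  have hpi := Real.pi_pos
  have habs := congrArg abs h
  have h2 : (0 : ℝ) < 2 ^ (α + 1) := Real.rpow_pos_of_pos (by norm_num) _
  simp only [abs_mul, abs_div, abs_neg, abs_pow, abs_one, one_pow, abs_of_pos g1, abs_of_pos g2,
    abs_of_pos g3, abs_of_pos hpi, abs_of_pos h2, one_mul] at habs
  rw [eq_div_iff (by positivity)]
  field_simp at habs
  linear_combination habs

lemma abs_legendreInt_neg_one_le {n : ℕ} {α : ℝ} (hα : 0 < α) (i : ℕ) (hi : α + i + 1 < n) :
    |legendreInt n (α + i + 1) (-1)| ≤ |legendreInt n (α + 1) (-1)| := by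
  induction i with
  | zero => simp
  | succ i ih =>
    push_cast at hi ⊢
    refine le_trans ?_ (ih (by linarith))
    have hi0 : (0 : ℝ) ≤ i := by positivity
    have h := congrArg abs (legendreInt_neg_one_rec n (μ := α + (i + 1) + 1) (by linarith))
    rw [show α + ((i : ℝ) + 1) + 1 - 1 = α + i + 1 by ring, abs_neg, abs_mul,
      abs_mul (((n : ℝ) - _ + 1) * _), abs_of_pos (show 0 < 2 * (α + i + 1) by linarith),
      abs_of_pos (mul_pos (show 0 < (n : ℝ) - (α + (i + 1) + 1) + 1 by linarith)
        (show 0 < (n : ℝ) + (α + (i + 1) + 1) by linarith))] at h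
    refine le_of_mul_le_mul_left (a := 2 * (α + i + 1)) ?_ (by linarith)
    rw [h]
    refine mul_le_mul_of_nonneg_right ?_ (abs_nonneg _)
    nlinarith

lemma iteratedDeriv_polynomial_eval (p : Polynomial ℝ) (n : ℕ) :
    iteratedDeriv n (fun x => p.eval x) = fun x => (Polynomial.derivative^[n] p).eval x := by
  induction n with
  | zero => simp
  | succ n ih =>
    rw [iteratedDeriv_succ, ih, Function.iterate_succ_apply']
    ext x
    exact Polynomial.deriv _

open Polynomial in
lemma legendre_eq_legendreInt (n : ℕ) (x : ℝ) : legendre n x = legendreInt n 0 x := by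
  let P : ℝ[X] := X ^ n * (1 - X) ^ n
  have hP : derivative^[n] P = (n.factorial : ℝ[X]) * (shiftedLegendre n).map (Int.castRingHom ℝ) := by
    have h := congrArg (Polynomial.map (Int.castRingHom ℝ)) (factorial_mul_shiftedLegendre_eq n)
    rw [← iterate_derivative_map] at h
    simpa [P] using h.symm
  have hf : (fun y : ℝ => (y ^ 2 - 1) ^ n) =
      fun y => (-4) ^ n * (fun z => (fun w => P.eval w) (1 / 2 * z)) (1 - y) := by
    ext y
    simp only [P, eval_mul, eval_pow, eval_X, eval_sub, eval_one]
    rw [← mul_pow, ← mul_pow]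
    ring
  have hc : ContDiff ℝ n (fun w => P.eval w) := by
    simpa only [coe_aeval_eq_eval] using Polynomial.contDiff_aeval (𝕜 := ℝ) P n
  unfold legendre legendreInt
  have hs := congrFun (iteratedDeriv_comp_const_sub (n := n)
    (f := fun z : ℝ => (fun w => P.eval w) (1 / 2 * z)) (s := (1 : ℝ))) x
  rw [hf, iteratedDeriv_const_mul_field, hs,
    iteratedDeriv_comp_const_mul hc, iteratedDeriv_polynomial_eval, hP]
  simp only [eval_mul, eval_natCast, smul_eq_mul, shiftedLegendre, Polynomial.map_sum,
    eval_finsetSum, Finset.mul_sum]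
  refine Finset.sum_congr rfl fun j _ => ?_
  unfold legendreCoeffOne
  rw [zero_add, Real.rpow_natCast, Real.Gamma_nat_eq_factorial]
  have h1 : (n.factorial : ℝ) ≠ 0 := by positivity
  have h2 : (j.factorial : ℝ) ≠ 0 := by positivity
  have h3 : (-4 : ℝ) ^ n * ((-1) ^ n * (1 / 2) ^ n) = 2 ^ n := by
    rw [← mul_pow, ← mul_pow]; norm_num
  have h4 : (2 : ℝ) ^ n ≠ 0 := by positivity
  simp [mul_pow]
  have h5 : (-4 : ℝ) ^ n * (-1) ^ n = (2 ^ n) ^ 2 := by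
    rw [← mul_pow, ← pow_mul, mul_comm n 2, pow_mul]; norm_num
  field_simp
  rw [h5]

lemma exists_continuousOn_eqOn_of_hasDerivAt {f f' : ℝ → ℝ}
    (hf : ∀ x ∈ Ioo (-1 : ℝ) 1, HasDerivAt f (f' x) x)
    (hf' : IntervalIntegrable f' volume (-1) 1) :
    ∃ g : ℝ → ℝ, ContinuousOn g (Icc (-1) 1) ∧ EqOn f g (Ioo (-1) 1) := by
  have hmem : (0 : ℝ) ∈ uIcc (-1 : ℝ) 1 := by rw [uIcc_of_le] <;> norm_num
  refine ⟨fun x => f 0 + ∫ t in (0 : ℝ)..x, f' t, ?_, fun x hx => ?_⟩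
  · have h := intervalIntegral.continuousOn_primitive_interval' hf' hmem
    rw [uIcc_of_le (by norm_num)] at h
    exact continuousOn_const.add h
  · have hsub : uIcc 0 x ⊆ Ioo (-1 : ℝ) 1 :=
      (ordConnected_Ioo.uIcc_subset (by norm_num) hx)
    have h := intervalIntegral.integral_eq_sub_of_hasDerivAt (fun y hy => hf y (hsub hy))
      (hf'.mono_set (by
        rw [uIcc_of_le (show (-1 : ℝ) ≤ 1 by norm_num)]
        exact hsub.trans Ioo_subset_Icc_self))
    simp only [h]; ring

lemma exists_tendsto_left_of_hasDerivAt {f f' : ℝ → ℝ}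
    (hf : ∀ x ∈ Ioo (-1 : ℝ) 1, HasDerivAt f (f' x) x)
    (hf' : IntervalIntegrable f' volume (-1) 1) :
    ∃ l, Tendsto f (nhdsWithin (-1) (Ioi (-1))) (nhds l) := by
  obtain ⟨g, hg, hfg⟩ := exists_continuousOn_eqOn_of_hasDerivAt hf hf'
  refine ⟨g (-1), ?_⟩
  rw [← nhdsWithin_Ioo_eq_nhdsGT (show (-1 : ℝ) < 1 by norm_num)]
  exact ((hg (-1) (by norm_num)).mono Ioo_subset_Icc_self).tendsto.congr'
    (eventually_nhdsWithin_of_forall fun x hx => (hfg hx).symm)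

lemma exists_tendsto_right_of_hasDerivAt {f f' : ℝ → ℝ}
    (hf : ∀ x ∈ Ioo (-1 : ℝ) 1, HasDerivAt f (f' x) x)
    (hf' : IntervalIntegrable f' volume (-1) 1) :
    ∃ l, Tendsto f (nhdsWithin 1 (Iio 1)) (nhds l) := by
  obtain ⟨g, hg, hfg⟩ := exists_continuousOn_eqOn_of_hasDerivAt hf hf'
  refine ⟨g 1, ?_⟩
  rw [← nhdsWithin_Ioo_eq_nhdsLT (show (-1 : ℝ) < 1 by norm_num)]
  exact ((hg 1 (by norm_num)).mono Ioo_subset_Icc_self).tendsto.congr'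
    (eventually_nhdsWithin_of_forall fun x hx => (hfg hx).symm)

lemma integral_mul_legendreInt_eq {f f' : ℝ → ℝ} {l μ : ℝ} (n : ℕ) (hμ : 0 ≤ μ)
    (hf : ∀ x ∈ Ioo (-1 : ℝ) 1, HasDerivAt f (f' x) x)
    (hi : IntervalIntegrable f volume (-1) 1)
    (hf' : IntervalIntegrable f' volume (-1) 1)
    (hl : Tendsto f (nhdsWithin (-1) (Ioi (-1))) (nhds l)) :
    ∫ x in (-1 : ℝ)..1, f x * legendreInt n μ x =
      l * legendreInt n (μ + 1) (-1) + ∫ x in (-1 : ℝ)..1, f' x * legendreInt n (μ + 1) x := by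
  obtain ⟨r, hr⟩ := exists_tendsto_right_of_hasDerivAt hf hf'
  have hH := continuous_legendreInt n hμ
  have hH1 := continuous_legendreInt n (show 0 ≤ μ + 1 by linarith)
  have h1 := hf'.mul_continuousOn (hH1.continuousOn (s := uIcc (-1) 1))
  have h2 := hi.mul_continuousOn (hH.continuousOn (s := uIcc (-1) 1))
  have h := intervalIntegral.integral_eq_sub_of_hasDerivAt_of_tendsto
    (f := fun x => f x * legendreInt n (μ + 1) x)
    (f' := fun x => f' x * legendreInt n (μ + 1) x - f x * legendreInt n μ x)
    (show (-1 : ℝ) < 1 by norm_num)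
    (fun x hx => by
      have := (hf x hx).mul (hasDerivAt_legendreInt n (show 0 < μ + 1 by linarith) hx.2)
      rw [add_sub_cancel_right] at this
      exact this.congr_deriv (by ring))
    (h1.sub h2)
    (hl.mul (hH1.continuousAt.tendsto.mono_left nhdsWithin_le_nhds))
    (hr.mul (hH1.continuousAt.tendsto.mono_left nhdsWithin_le_nhds))
  rw [intervalIntegral.integral_sub h1 h2, legendreInt_one n (by linarith)] at h
  linarith

lemma integral_mul_legendreInt_eq_sum {f : ℕ → ℝ → ℝ} {L : ℕ → ℝ} {μ : ℝ} (n m : ℕ) (hμ : 0 ≤ μ)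
    (hf : ∀ i < m, ∀ x ∈ Ioo (-1 : ℝ) 1, HasDerivAt (f i) (f (i + 1) x) x)
    (hi : ∀ i ≤ m, IntervalIntegrable (f i) volume (-1) 1)
    (hL : ∀ i < m, Tendsto (f i) (nhdsWithin (-1) (Ioi (-1))) (nhds (L i))) :
    ∫ x in (-1 : ℝ)..1, f 0 x * legendreInt n μ x =
      ∑ i ∈ Finset.range m, L i * legendreInt n (μ + i + 1) (-1) +
        ∫ x in (-1 : ℝ)..1, f m x * legendreInt n (μ + m) x := by
  induction m with
  | zero => simp
  | succ m ih =>
    rw [ih (fun i h => hf i (by omega)) (fun i h => hi i (by omega)) (fun i h => hL i (by omega)),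
      integral_mul_legendreInt_eq n (by positivity) (hf m (by omega)) (hi m (by omega))
        (hi (m + 1) le_rfl) (hL m (by omega)), Finset.sum_range_succ]
    push_cast
    simp only [add_assoc]

lemma integral_mul_legendreInt_zero {f : ℕ → ℝ → ℝ} (n k : ℕ) (hkn : k ≤ n)
    (hf : ∀ i < k, ∀ x ∈ Ioo (-1 : ℝ) 1, HasDerivAt (f i) (f (i + 1) x) x)
    (hi : ∀ i ≤ k, IntervalIntegrable (f i) volume (-1) 1) :
    ∫ x in (-1 : ℝ)..1, f 0 x * legendreInt n 0 x =
      ∫ x in (-1 : ℝ)..1, f k x * legendreInt n k x := by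
  have h : ∀ i, ∃ l, i < k → Tendsto (f i) (nhdsWithin (-1) (Ioi (-1))) (nhds l) := fun i => by
    by_cases hik : i < k
    · obtain ⟨l, hl⟩ := exists_tendsto_left_of_hasDerivAt (hf i hik) (hi (i + 1) hik)
      exact ⟨l, fun _ => hl⟩
    · exact ⟨0, fun h => absurd h hik⟩
  choose L hL using h
  rw [integral_mul_legendreInt_eq_sum n k le_rfl hf hi hL, Finset.sum_eq_zero, zero_add, zero_add]
  intro i hik
  have := legendreInt_neg_one_eq_zero n (i := i + 1) (by omega)
    (by have := Finset.mem_range.1 hik; omega)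
  push_cast at this
  rw [zero_add, this, mul_zero]

lemma integral_rpow_mul_sub_rpow {s t a : ℝ} (hs : 0 < s) (ht : 0 < t) (ha : 0 < a) :
    ∫ x in (0 : ℝ)..a, x ^ (s - 1) * (a - x) ^ (t - 1) =
      a ^ (s + t - 1) * (Real.Gamma s * Real.Gamma t / Real.Gamma (s + t)) := by
  have h := Complex.betaIntegral_scaled s t ha
  rw [Complex.betaIntegral_eq_Gamma_mul_div _ _ (by simpa) (by simpa), ← Complex.ofReal_add,
    Complex.Gamma_ofReal, Complex.Gamma_ofReal, Complex.Gamma_ofReal] at h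
  apply Complex.ofReal_injective
  rw [← intervalIntegral.integral_ofReal]
  push_cast
  rw [Complex.ofReal_cpow ha.le]
  push_cast at h ⊢
  rw [← h]
  refine intervalIntegral.integral_congr fun x hx => ?_
  rw [uIcc_of_le ha.le] at hx
  rw [Complex.ofReal_cpow hx.1, Complex.ofReal_cpow (sub_nonneg.2 hx.2)]
  push_cast
  rfl

lemma integral_sub_rpow_mul_legendreInt (n : ℕ) {α β y : ℝ} (hα : 0 < α) (hβ : 0 < β)
    (hy : y < 1) :
    ∫ x in y..1, (x - y) ^ (β - 1) * legendreInt n α x =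
      Real.Gamma β * legendreInt n (α + β) y := by
  have hI : IntervalIntegrable (fun x => (x - y) ^ (β - 1)) volume y 1 := by
    have := (intervalIntegral.intervalIntegrable_rpow' (a := 0) (b := 1 - y)
      (show -1 < β - 1 by linarith)).comp_sub_right y
    simpa using this
  have hterm (j : ℕ) : ∫ x in y..1, (x - y) ^ (β - 1) * (1 - x) ^ (α + j) =
      (1 - y) ^ (α + β + j) *
        (Real.Gamma β * Real.Gamma (α + j + 1) / Real.Gamma (α + β + j + 1)) := by
    have h := intervalIntegral.integral_comp_sub_right
      (fun z => z ^ (β - 1) * ((1 - y) - z) ^ (α + j + 1 - 1)) (a := y) (b := 1) y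
    rw [sub_self, integral_rpow_mul_sub_rpow hβ (by positivity) (by linarith)] at h
    rw [show α + β + j = β + (α + j + 1) - 1 by ring,
      show β + (α + j + 1) - 1 + 1 = β + (α + j + 1) by ring, ← h]
    simp
  unfold legendreInt
  simp only [Finset.mul_sum]
  rw [intervalIntegral.integral_finsetSum]
  · refine Finset.sum_congr rfl fun j _ => ?_
    have hg : Real.Gamma (α + j + 1) ≠ 0 := (Real.Gamma_pos_of_pos (by positivity)).ne'
    have hg' : Real.Gamma (α + β + j + 1) ≠ 0 := (Real.Gamma_pos_of_pos (by positivity)).ne'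
    rw [show (fun x => (x - y) ^ (β - 1) * (legendreCoeffOne n j *
        ((1 - x) ^ (α + j) / Real.Gamma (α + j + 1)))) =
      fun x => (legendreCoeffOne n j / Real.Gamma (α + j + 1)) *
        ((x - y) ^ (β - 1) * (1 - x) ^ (α + j)) by ext x; ring,
      intervalIntegral.integral_const_mul, hterm]
    field_simp
  · intro j _
    refine hI.mul_continuousOn (Continuous.continuousOn ?_)
    have : Continuous fun x : ℝ => (1 - x) ^ (α + j) :=
      (continuous_const.sub continuous_id).rpow_const fun x => Or.inr (by positivity)
    fun_prop

lemma integral_integral_rpow_swap {u H : ℝ → ℝ} {β : ℝ} (hβ : 0 < β)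
    (hu : IntervalIntegrable u volume (-1) 1) (hH : Continuous H) :
    ∫ x in (-1 : ℝ)..1, (∫ y in (-1 : ℝ)..x, (x - y) ^ (β - 1) * u y) * H x =
      ∫ y in (-1 : ℝ)..1, u y * ∫ x in y..1, (x - y) ^ (β - 1) * H x := by
  let S : Set ℝ := Ioc (-1) 1
  let K : ℝ → ℝ := (Ioc (0 : ℝ) 2).indicator fun z => z ^ (β - 1)
  let U : ℝ → ℝ := S.indicator u
  let h : ℝ → ℝ := S.indicator H
  have hU : Integrable U := by
    rw [integrable_indicator_iff measurableSet_Ioc]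
    exact (intervalIntegrable_iff_integrableOn_Ioc_of_le (by norm_num)).1 hu
  have hK : Integrable K := by
    rw [integrable_indicator_iff measurableSet_Ioc]
    exact (intervalIntegrable_iff_integrableOn_Ioc_of_le (by norm_num)).1
      (intervalIntegral.intervalIntegrable_rpow' (by linarith))
  obtain ⟨C, hC⟩ := isCompact_Icc.exists_bound_of_continuousOn (hH.continuousOn (s := Icc (-1) 1))
  have hhC : ∀ x, ‖h x‖ ≤ max C 0 := fun x => by
    by_cases hx : x ∈ S
    · simp only [h, indicator_of_mem hx]
      exact (hC x (Ioc_subset_Icc_self hx)).trans (le_max_left _ _)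
    · simp [h, indicator_of_notMem hx]
  have hhm : Measurable h := hH.measurable.indicator measurableSet_Ioc
  have hF : Integrable (Function.uncurry fun x y => (U y * K (x - y)) * h x)
      (volume.prod volume) :=
    (hU.convolution_integrand (ContinuousLinearMap.mul ℝ ℝ) hK).mul_bdd (c := max C 0)
      (hhm.comp measurable_fst).aestronglyMeasurable (Eventually.of_forall fun p => hhC p.1)
  have hswap := integral_integral_swap hF
  have hL : ∀ x, ∫ y, (U y * K (x - y)) * h x =
      S.indicator (fun x => (∫ y in (-1 : ℝ)..x, (x - y) ^ (β - 1) * u y) * H x) x := by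
    intro x
    by_cases hx : x ∈ S
    · rw [integral_mul_const, indicator_of_mem hx, intervalIntegral.integral_of_le hx.1.le,
        integral_Ioc_eq_integral_Ioo, ← integral_indicator measurableSet_Ioo]
      simp only [h, indicator_of_mem hx]
      congr 1
      refine integral_congr_ae (Eventually.of_forall fun y => ?_)
      by_cases hy : y ∈ Ioo (-1) x
      · have h1 : y ∈ S := ⟨hy.1, hy.2.le.trans hx.2⟩
        have h2 : x - y ∈ Ioc (0 : ℝ) 2 := ⟨by linarith [hy.2], by linarith [hy.1, hx.2]⟩
        simp only [U, K, indicator_of_mem h1, indicator_of_mem h2, indicator_of_mem hy]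
        ring
      · rw [indicator_of_notMem hy]
        by_cases h1 : y ∈ S
        · have h2 : x - y ∉ Ioc (0 : ℝ) 2 := fun h2 => hy ⟨h1.1, by linarith [h2.1]⟩
          simp [K, indicator_of_notMem h2]
        · simp [U, indicator_of_notMem h1]
    · simp [h, indicator_of_notMem hx]
  have hR : ∀ y, ∫ x, (U y * K (x - y)) * h x =
      S.indicator (fun y => u y * ∫ x in y..1, (x - y) ^ (β - 1) * H x) y := by
    intro y
    by_cases hy : y ∈ S
    · simp only [mul_assoc]
      rw [integral_const_mul, indicator_of_mem hy, intervalIntegral.integral_of_le hy.2,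
        ← integral_indicator measurableSet_Ioc]
      simp only [U, indicator_of_mem hy]
      congr 1
      refine integral_congr_ae (Eventually.of_forall fun x => ?_)
      by_cases hx : x ∈ Ioc y 1
      · have h1 : x ∈ S := ⟨hy.1.trans hx.1, hx.2⟩
        have h2 : x - y ∈ Ioc (0 : ℝ) 2 := ⟨by linarith [hx.1], by linarith [hy.1, hx.2]⟩
        simp only [h, K, indicator_of_mem h1, indicator_of_mem h2, indicator_of_mem hx]
      · rw [indicator_of_notMem hx]
        by_cases h1 : x ∈ S
        · have h2 : x - y ∉ Ioc (0 : ℝ) 2 := fun h2 => hx ⟨by linarith [h2.1], h1.2⟩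
          simp [K, indicator_of_notMem h2]
        · simp [h, indicator_of_notMem h1]
    · simp [U, indicator_of_notMem hy]
  simp only [hL, hR] at hswap
  rw [integral_indicator measurableSet_Ioc, integral_indicator measurableSet_Ioc] at hswap
  rw [intervalIntegral.integral_of_le (by norm_num), intervalIntegral.integral_of_le (by norm_num)]
  exact hswap

lemma integral_caputoL_mul_legendreInt (n k : ℕ) {α : ℝ} {ω : ℝ → ℝ} (hα : 0 < α)
    (hαk : α < k) (hω : IntervalIntegrable (iteratedDeriv k ω) volume (-1) 1) :
    ∫ x in (-1 : ℝ)..1, caputoL k α (-1) ω x * legendreInt n α x =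
      ∫ x in (-1 : ℝ)..1, iteratedDeriv k ω x * legendreInt n k x := by
  have hβ : 0 < (k : ℝ) - α := sub_pos.2 hαk
  have hΓ := (Real.Gamma_pos_of_pos hβ).ne'
  unfold caputoL
  simp only [mul_assoc]
  rw [intervalIntegral.integral_const_mul,
    integral_integral_rpow_swap hβ hω (continuous_legendreInt n hα.le),
    ← intervalIntegral.integral_const_mul, intervalIntegral.integral_of_le (by norm_num),
    intervalIntegral.integral_of_le (by norm_num), integral_Ioc_eq_integral_Ioo,
    integral_Ioc_eq_integral_Ioo]
  refine setIntegral_congr_fun measurableSet_Ioo fun y hy => ?_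
  rw [integral_sub_rpow_mul_legendreInt n hα hβ hy.2, add_sub_cancel]
  field_simp

lemma abs_integral_mul_legendreInt_le (n : ℕ) {μ : ℝ} {f : ℝ → ℝ} (hμ : 1 < μ) (hn : μ < n)
    (hint : ∀ j : ℤ, μ ≠ j) (hf : IntervalIntegrable f volume (-1) 1) :
    |∫ x in (-1 : ℝ)..1, f x * legendreInt n μ x| ≤
      legendreIntBound n μ * ∫ x in (-1 : ℝ)..1, |f x| := by
  have hH := (continuous_legendreInt n (zero_le_one.trans hμ.le)).continuousOn (s := uIcc (-1) 1)
  rw [← intervalIntegral.integral_const_mul]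
  refine (intervalIntegral.abs_integral_le_integral_abs (by norm_num)).trans ?_
  refine intervalIntegral.integral_mono_on_of_le_Ioo (by norm_num) (hf.mul_continuousOn hH).abs
    (hf.abs.const_mul _) fun x hx => ?_
  rw [abs_mul, mul_comm]
  exact mul_le_mul_of_nonneg_right (abs_legendreInt_le hμ hn hint hx) (abs_nonneg _)

/-- bound on the `n`-th Legendre coefficient of
`ω ∈ 𝒰^{α,m}_{−1+}((−1,1))` for `n > α + m`. -/
theorem stmt_6 (k m : ℕ) (hk : 1 ≤ k) (hm : 1 ≤ m) (α : ℝ)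
    (hα1 : (k : ℝ) - 1 < α) (hα2 : α < (k : ℝ)) (hαint : ∀ j : ℤ, α ≠ (j : ℝ))
    (ω : ℝ → ℝ) (L : ℕ → ℝ) (hω : MemUL k m α ω L)
    (n : ℕ) (hn : α + (m : ℝ) < (n : ℝ)) :
    |legCoeff ω n| ≤
      ((2 * (n : ℝ) + 1) * Real.Gamma (((n : ℝ) - α - (m : ℝ) + 1) / 2) /
          ((2 : ℝ) ^ (α + (m : ℝ) + 1) * Real.sqrt Real.pi *
            Real.Gamma (((n : ℝ) + α + (m : ℝ)) / 2 + 1)) +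
        |Real.sin (α * Real.pi)| *
          (((n : ℝ) + α + (m : ℝ)) / ((n : ℝ) - α - (m : ℝ) + 2)) *
          ((2 : ℝ) ^ α * Real.Gamma (α + 1) * ((2 * (n : ℝ) + 1) / Real.pi) *
            (Real.Gamma ((n : ℝ) - α) / Real.Gamma ((n : ℝ) + α + 2)))) *
      UsemiL k m α ω L := by
  have hk' : (1 : ℝ) ≤ k := by exact_mod_cast hk
  have hm' : (1 : ℝ) ≤ m := by exact_mod_cast hm
  have hα : 0 < α := by linarith
  have hkn : k ≤ n := by
    have : (k : ℝ) < n := by linarith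
    exact_mod_cast this.le
  have hint : ∀ j : ℤ, α + m ≠ j := fun j hj => hαint (j - m) (by push_cast; linarith)
  obtain ⟨-, hωd, hωi, hgd, hgi, hgL⟩ := hω
  have hcoeff : ∫ x in (-1 : ℝ)..1, ω x * legendre n x =
      ∑ i ∈ Finset.range m, L i * legendreInt n (α + i + 1) (-1) +
        ∫ x in (-1 : ℝ)..1, iteratedDeriv m (caputoL k α (-1) ω) x * legendreInt n (α + m) x := by
    rw [← integral_mul_legendreInt_eq_sum n m hα.le hgd hgi hgL]
    simp only [iteratedDeriv_zero]
    rw [integral_caputoL_mul_legendreInt n k hα hα2 (hωi k le_rfl),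
      ← integral_mul_legendreInt_zero n k hkn hωd hωi]
    simp only [iteratedDeriv_zero, legendre_eq_legendreInt]
  have hB : |∫ x in (-1 : ℝ)..1,
      iteratedDeriv m (caputoL k α (-1) ω) x * legendreInt n (α + m) x| ≤
      legendreIntBound n (α + m) *
        ∫ x in (-1 : ℝ)..1, |iteratedDeriv m (caputoL k α (-1) ω) x| :=
    abs_integral_mul_legendreInt_le n (by linarith) hn hint (hgi m le_rfl)
  have hsum : |∑ i ∈ Finset.range m, L i * legendreInt n (α + i + 1) (-1)| ≤
      |legendreInt n (α + 1) (-1)| * ∑ i ∈ Finset.range m, |L i| := by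
    rw [Finset.mul_sum]
    refine (Finset.abs_sum_le_sum_abs _ _).trans (Finset.sum_le_sum fun i hi => ?_)
    have him : (i : ℝ) + 1 ≤ m := by exact_mod_cast Finset.mem_range.1 hi
    rw [abs_mul, mul_comm]
    exact mul_le_mul_of_nonneg_right (abs_legendreInt_neg_one_le hα i (by linarith))
      (abs_nonneg _)
  have hI0 : 0 ≤ ∫ x in (-1 : ℝ)..1, |iteratedDeriv m (caputoL k α (-1) ω) x| :=
    intervalIntegral.integral_nonneg (by norm_num) fun _ _ => abs_nonneg _
  have hS0 : 0 ≤ ∑ i ∈ Finset.range m, |L i| := Finset.sum_nonneg fun _ _ => abs_nonneg _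
  have hB0 := (legendreIntBound_pos (n := n) (show 0 ≤ α + m by linarith) (by linarith)).le
  have hH0 := abs_nonneg (legendreInt n (α + 1) (-1))
  have hfirst : (2 * (n : ℝ) + 1) * Real.Gamma (((n : ℝ) - α - (m : ℝ) + 1) / 2) /
      ((2 : ℝ) ^ (α + (m : ℝ) + 1) * Real.sqrt Real.pi *
        Real.Gamma (((n : ℝ) + α + (m : ℝ)) / 2 + 1)) =
      (2 * (n : ℝ) + 1) / 2 * legendreIntBound n (α + m) := by
    rw [legendreIntBound, Real.rpow_add_one two_ne_zero, sub_sub, add_assoc (n : ℝ)]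
    ring
  have hsecond : |Real.sin (α * Real.pi)| * ((2 : ℝ) ^ α * Real.Gamma (α + 1) *
      ((2 * (n : ℝ) + 1) / Real.pi) * (Real.Gamma ((n : ℝ) - α) / Real.Gamma ((n : ℝ) + α + 2))) =
      (2 * (n : ℝ) + 1) / 2 * |legendreInt n (α + 1) (-1)| := by
    rw [abs_legendreInt_neg_one_add_one hα (by linarith) hαint, Real.rpow_add_one two_ne_zero]
    ring
  have hratio : 1 ≤ ((n : ℝ) + α + m) / ((n : ℝ) - α - m + 2) := by
    rw [one_le_div (by linarith)]; linarith
  have hn0 : 0 ≤ (2 * (n : ℝ) + 1) / 2 := by positivity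
  rw [hfirst, mul_right_comm |Real.sin (α * Real.pi)|, hsecond, legCoeff, hcoeff, abs_mul,
    abs_of_nonneg hn0, UsemiL]
  have hH := mul_le_mul_of_nonneg_left hratio hH0
  rw [mul_one] at hH
  calc _ ≤ (2 * (n : ℝ) + 1) / 2 * (|legendreInt n (α + 1) (-1)| * ∑ i ∈ Finset.range m, |L i| +
        legendreIntBound n (α + m) *
          ∫ x in (-1 : ℝ)..1, |iteratedDeriv m (caputoL k α (-1) ω) x|) :=
        mul_le_mul_of_nonneg_left ((abs_add_le _ _).trans (add_le_add hsum hB)) hn0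
    _ ≤ (2 * (n : ℝ) + 1) / 2 * ((legendreIntBound n (α + m) + |legendreInt n (α + 1) (-1)| *
        (((n : ℝ) + α + m) / ((n : ℝ) - α - m + 2))) *
        ((∫ x in (-1 : ℝ)..1, |iteratedDeriv m (caputoL k α (-1) ω) x|) +
          ∑ i ∈ Finset.range m, |L i|)) := by
        refine mul_le_mul_of_nonneg_left ?_ hn0
        nlinarith [mul_le_mul_of_nonneg_right hH hS0, mul_nonneg hB0 hS0,
          mul_nonneg (hH0.trans hH) hI0]
    _ = _ := by ring
end

section
/- Let k, m ∈ ℕ, let α ∈ (k−1, k) be a non-integer real, and let ω ∈ 𝒰^{α,m}_{−1+}((−1,1)). Then for every integer n with n > α + m, the n-th Legendre coefficient ω̂′_n of the derivative ω′ satisfies |ω̂′_n| ≤ { (2n+1)Γ((n−α−m)/2 + 1) / (2^{α+m} √π Γ((n+α+m+1)/2)) + |sin(απ)| · ((n+α+m−1)/(n−α−m+3)) · Ĉ_{n,α−1} } · U^{α,m}_{−1+}(ω;(−1,1)), where Ĉ_{n,α−1} := 2^{α−1} Γ(α) ((2n+1)/π) Γ(n−α+1)/Γ(n+α+1). -/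
open MeasureTheory Set Filter

theorem inv_Gamma_eq_mul_inv_Gamma_add_one (s : ℝ) :
    (Real.Gamma s)⁻¹ = s * (Real.Gamma (s + 1))⁻¹ := by
  rcases eq_or_ne s 0 with rfl | hs
  · simp [Real.Gamma_zero]
  · rw [Real.Gamma_add_one hs, mul_inv, ← mul_assoc, mul_inv_cancel₀ hs, one_mul]

theorem Gamma_add_natCast_add_one_eq {x : ℝ} (hx : 0 < x) (N : ℕ) :
    Real.Gamma (x + N + 1) = Real.Gamma x * ∏ j ∈ Finset.range (N + 1), (x + j) := by
  induction N with
  | zero => simp [Real.Gamma_add_one hx.ne', mul_comm]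
  | succ N ih =>
    rw [Finset.prod_range_succ, ← mul_assoc, ← ih, Real.Gamma_add_one (by positivity)]
    push_cast
    ring_nf

theorem tendsto_Gamma_add_natCast_div {x : ℝ} (hx : 0 < x) :
    Tendsto (fun N : ℕ => Real.Gamma (x + N) / ((N : ℝ) ^ (x - 1) * N.factorial)) atTop
      (nhds 1) := by
  have h1 := (Real.GammaSeq_tendsto_Gamma x).inv₀ (Real.Gamma_pos_of_pos hx).ne'
  have h2 := (h1.const_mul (Real.Gamma x))
  rw [mul_inv_cancel₀ (Real.Gamma_pos_of_pos hx).ne'] at h2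
  have h3 : Tendsto (fun N : ℕ => (N : ℝ) / (N + x)) atTop (nhds 1) :=
    tendsto_natCast_div_add_atTop x
  have h4 := h2.mul h3
  rw [mul_one] at h4
  refine h4.congr' ?_
  filter_upwards [eventually_gt_atTop 0] with N hN
  have hN' : (0 : ℝ) < N := by exact_mod_cast hN
  have e1 := Gamma_add_natCast_add_one_eq hx N
  rw [Real.Gamma_add_one (by positivity)] at e1
  have hp : 0 < ∏ j ∈ Finset.range (N + 1), (x + j) :=
    Finset.prod_pos fun j _ => by positivity
  have hf : (0 : ℝ) < N.factorial := by exact_mod_cast N.factorial_pos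
  have hr : (0 : ℝ) < (N : ℝ) ^ x := by positivity
  rw [Real.GammaSeq, Real.rpow_sub_one hN'.ne']
  field_simp
  linear_combination -e1

theorem log_add_div_sub_le {z d : ℝ} (hz : 1 / 2 < z) (hd0 : 0 ≤ d) (hd : d ≤ 1 / 2) :
    Real.log ((z + d) / (z - d)) ≤ 2 * d * Real.log ((z + 1 / 2) / (z - 1 / 2)) := by
  have key : ∀ e : ℝ, 0 ≤ e → e ≤ 1 / 2 →
      HasSum (fun k : ℕ => (2 : ℝ) * (1 / (2 * k + 1)) * (e / z) ^ (2 * k + 1))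
        (Real.log ((z + e) / (z - e))) := by
    intro e he0 he
    have hlt : |e / z| < 1 := by
      rw [abs_of_nonneg (by positivity), div_lt_one (by linarith)]
      linarith
    have := Real.hasSum_log_sub_log_of_abs_lt_one hlt
    have h1 : 0 < 1 + e / z := by positivity
    have h2 : 0 < 1 - e / z := by linarith [(abs_lt.1 hlt).2]
    rw [← Real.log_div h1.ne' h2.ne'] at this
    convert this using 2
    have : z ≠ 0 := by linarith
    field_simp
  refine hasSum_le ?_ (key d hd0 hd) ((key (1 / 2) (by norm_num) le_rfl).mul_left (2 * d))
  intro k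
  have h1 : d / z = 2 * d * (1 / 2 / z) := by ring
  rw [h1, mul_pow]
  have h2 : (2 * d) ^ (2 * k + 1) ≤ 2 * d := by
    rw [pow_succ]
    exact mul_le_of_le_one_left (by linarith) (pow_le_one₀ (by linarith) (by linarith))
  have h3 : (0 : ℝ) ≤ 2 * (1 / (2 * k + 1)) * (1 / 2 / z) ^ (2 * k + 1) := by positivity
  nlinarith [mul_le_mul_of_nonneg_left h2 h3]

theorem add_div_sub_le_rpow {z d : ℝ} (hz : 1 / 2 < z) (hd0 : 0 ≤ d) (hd : d ≤ 1 / 2) :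
    (z + d) / (z - d) ≤ ((z + 1 / 2) / (z - 1 / 2)) ^ (2 * d) := by
  have h1 : 0 < (z + d) / (z - d) := div_pos (by linarith) (by linarith)
  have h2 : 0 < (z + 1 / 2) / (z - 1 / 2) := div_pos (by linarith) (by linarith)
  rw [← Real.log_le_log_iff h1 (Real.rpow_pos_of_pos h2 _), Real.log_rpow h2]
  exact log_add_div_sub_le hz hd0 hd

theorem rpow_mul_Gamma_le {c d : ℝ} (hc : 0 < c) (hd0 : 0 ≤ d) (hd : d ≤ 1 / 2) :
    c ^ (2 * d) * Real.Gamma (c + 1 / 2 - d) ≤ Real.Gamma (c + 1 / 2 + d) := by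
  set f : ℕ → ℝ := fun N => Real.Gamma (c + 1 / 2 + d + N) /
    (Real.Gamma (c + 1 / 2 - d + N) * (c + N) ^ (2 * d)) with hf
  have hanti : Antitone f := by
    refine antitone_nat_of_succ_le fun N => ?_
    have hz : (0 : ℝ) < c + N := by positivity
    have h0 := add_div_sub_le_rpow (z := c + N + 1 / 2) (by linarith) hd0 hd
    have g1 := Real.Gamma_pos_of_pos (show 0 < c + 1 / 2 + d + N by positivity)
    have hp2 : 0 < c + 1 / 2 - d + N := by linarith
    have g2 := Real.Gamma_pos_of_pos hp2
    simp only [hf]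
    push_cast
    rw [show c + 1 / 2 + d + (N + 1 : ℝ) = c + 1 / 2 + d + N + 1 by ring,
      show c + 1 / 2 - d + (N + 1 : ℝ) = c + 1 / 2 - d + N + 1 by ring,
      Real.Gamma_add_one (by positivity), Real.Gamma_add_one hp2.ne']
    rw [show c + N + 1 / 2 + 1 / 2 = c + (N + 1 : ℝ) by ring, add_sub_cancel_right,
      Real.div_rpow (by positivity) hz.le] at h0
    have r1 : 0 < (c + (N + 1 : ℝ)) ^ (2 * d) := by positivity
    have r2 : 0 < (c + (N : ℝ)) ^ (2 * d) := by positivity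
    rw [div_le_div_iff₀ (by linarith) r2] at h0
    rw [div_le_div_iff₀ (by positivity) (by positivity)]
    have := mul_le_mul_of_nonneg_left h0 (mul_pos g1 g2).le
    calc _ = Real.Gamma (c + 1 / 2 + d + N) * Real.Gamma (c + 1 / 2 - d + N) *
          ((c + N + 1 / 2 + d) * (c + N) ^ (2 * d)) := by ring
      _ ≤ _ := this
      _ = _ := by ring
  have hlim : Tendsto f atTop (nhds 1) := by
    have t1 := tendsto_Gamma_add_natCast_div (show 0 < c + 1 / 2 + d by positivity)
    have t2 := tendsto_Gamma_add_natCast_div (show 0 < c + 1 / 2 - d by linarith)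
    have t3 : Tendsto (fun N : ℕ => ((N : ℝ) / (N + c)) ^ (2 * d)) atTop (nhds (1 ^ (2 * d))) :=
      (tendsto_natCast_div_add_atTop c).rpow_const (Or.inl one_ne_zero)
    have t4 := (t1.div t2 one_ne_zero).mul t3
    simp only [Real.one_rpow, div_one, mul_one] at t4
    refine t4.congr' ?_
    filter_upwards [eventually_gt_atTop 0] with N hN
    have hN' : (0 : ℝ) < N := by exact_mod_cast hN
    have hff : (0 : ℝ) < N.factorial := by exact_mod_cast N.factorial_pos
    have e1 : (N : ℝ) ^ (c + 1 / 2 + d - 1) = N ^ (c + 1 / 2 - d - 1) * N ^ (2 * d) := by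
      rw [← Real.rpow_add hN']; ring_nf
    have g2 := Real.Gamma_pos_of_pos (show 0 < c + 1 / 2 - d + N by linarith)
    simp only [hf, Pi.div_apply]
    rw [Real.div_rpow hN'.le (by positivity), e1, add_comm (N : ℝ) c]
    field_simp
  have h := hanti.le_of_tendsto hlim 0
  have g2 := Real.Gamma_pos_of_pos (show 0 < c + 1 / 2 - d by linarith)
  simp only [hf, Nat.cast_zero, add_zero] at h
  rw [le_div_iff₀ (by positivity), one_mul] at h
  linarith

theorem Gamma_half_shift_le {x b p q : ℝ} (hx : 0 < x) (hb : 0 ≤ b)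
    (hstep : ∀ z, x ≤ z → z ^ 2 * (z + b) ^ 2 * ((z + 1) ^ 2 + p * (z + 1) + q) ≤
      (z + 1 / 2) ^ 2 * (z + b + 1 / 2) ^ 2 * (z ^ 2 + p * z + q)) :
    (Real.Gamma (x + 1 / 2) * Real.Gamma (x + b + 1 / 2)) ^ 2 ≤
      (x ^ 2 + p * x + q) * (Real.Gamma x * Real.Gamma (x + b)) ^ 2 := by
  set f : ℕ → ℝ := fun N => ((x + N) ^ 2 + p * (x + N) + q) *
    (Real.Gamma (x + N) * Real.Gamma (x + b + N)) ^ 2 /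
      (Real.Gamma (x + 1 / 2 + N) * Real.Gamma (x + b + 1 / 2 + N)) ^ 2 with hf
  have hanti : Antitone f := by
    refine antitone_nat_of_succ_le fun N => ?_
    have hz : x ≤ x + N := by linarith [(Nat.cast_nonneg N : (0 : ℝ) ≤ N)]
    have h0 := hstep _ hz
    have g1 := Real.Gamma_pos_of_pos (show 0 < x + N by positivity)
    have g2 := Real.Gamma_pos_of_pos (show 0 < x + b + N by positivity)
    have g3 := Real.Gamma_pos_of_pos (show 0 < x + 1 / 2 + N by positivity)
    have g4 := Real.Gamma_pos_of_pos (show 0 < x + b + 1 / 2 + N by positivity)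
    simp only [hf]
    push_cast
    simp only [← add_assoc]
    rw [Real.Gamma_add_one (by positivity), Real.Gamma_add_one (by positivity),
      Real.Gamma_add_one (by positivity), Real.Gamma_add_one (by positivity)]
    rw [div_le_div_iff₀ (by positivity) (by positivity)]
    have := mul_le_mul_of_nonneg_left h0 (sq_nonneg (Real.Gamma (x + N) * Real.Gamma (x + b + N) *
      (Real.Gamma (x + 1 / 2 + N) * Real.Gamma (x + b + 1 / 2 + N))))
    convert this using 1 <;> ring
  have hlim : Tendsto f atTop (nhds 1) := by
    have t1 := tendsto_Gamma_add_natCast_div hx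
    have t2 := tendsto_Gamma_add_natCast_div (show 0 < x + b by positivity)
    have t3 := tendsto_Gamma_add_natCast_div (show 0 < x + 1 / 2 by positivity)
    have t4 := tendsto_Gamma_add_natCast_div (show 0 < x + b + 1 / 2 by positivity)
    have ti : Tendsto (fun N : ℕ => ((N : ℝ))⁻¹) atTop (nhds 0) :=
      tendsto_inv_atTop_nhds_zero_nat
    have t5 : Tendsto (fun N : ℕ => (1 + x * (N : ℝ)⁻¹) ^ 2 + p * (1 + x * (N : ℝ)⁻¹) * (N : ℝ)⁻¹
        + q * (N : ℝ)⁻¹ ^ 2) atTop (nhds ((1 + x * 0) ^ 2 + p * (1 + x * 0) * 0 + q * 0 ^ 2)) := by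
      have a1 := (ti.const_mul x).const_add 1
      exact ((a1.pow 2).add ((a1.const_mul p).mul ti)).add ((ti.pow 2).const_mul q)
    have t6 := (((t1.mul t2).div (t3.mul t4) (by norm_num)).pow 2).mul t5
    norm_num at t6
    refine t6.congr' ?_
    filter_upwards [eventually_gt_atTop 0] with N hN
    have hN' : (0 : ℝ) < N := by exact_mod_cast hN
    have hff : (0 : ℝ) < N.factorial := by exact_mod_cast N.factorial_pos
    have g3 := Real.Gamma_pos_of_pos (show 0 < x + 1 / 2 + N by positivity)
    have g4 := Real.Gamma_pos_of_pos (show 0 < x + b + 1 / 2 + N by positivity)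
    have e1 : (N : ℝ) ^ (x + 1 / 2 - 1) * (N : ℝ) ^ (x + b + 1 / 2 - 1)
        = N ^ (x - 1) * N ^ (x + b - 1) * N := by
      rw [← Real.rpow_add hN', ← Real.rpow_add hN', ← Real.rpow_add_one hN'.ne']; ring_nf
    have r1 : 0 < (N : ℝ) ^ (x - 1) := by positivity
    have r2 : 0 < (N : ℝ) ^ (x + b - 1) := by positivity
    have r3 : 0 < (N : ℝ) ^ (x + 1 / 2 - 1) := by positivity
    have r4 : 0 < (N : ℝ) ^ (x + b + 1 / 2 - 1) := by positivity
    simp only [hf]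
    have e2 : Real.Gamma (x + N) / ((N : ℝ) ^ (x - 1) * N.factorial) *
        (Real.Gamma (x + b + N) / ((N : ℝ) ^ (x + b - 1) * N.factorial)) /
        (Real.Gamma (x + 1 / 2 + N) / ((N : ℝ) ^ (x + 1 / 2 - 1) * N.factorial) *
        (Real.Gamma (x + b + 1 / 2 + N) / ((N : ℝ) ^ (x + b + 1 / 2 - 1) * N.factorial))) =
        Real.Gamma (x + N) * Real.Gamma (x + b + N) * N /
          (Real.Gamma (x + 1 / 2 + N) * Real.Gamma (x + b + 1 / 2 + N)) := by
      calc _ = Real.Gamma (x + N) * Real.Gamma (x + b + N) /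
          (Real.Gamma (x + 1 / 2 + N) * Real.Gamma (x + b + 1 / 2 + N)) *
          (((N : ℝ) ^ (x + 1 / 2 - 1) * (N : ℝ) ^ (x + b + 1 / 2 - 1)) /
            (N ^ (x - 1) * N ^ (x + b - 1))) := by field_simp
        _ = _ := by rw [e1]; field_simp
    norm_num at e2 ⊢
    rw [e2]
    field_simp
    ring
  have h := hanti.le_of_tendsto hlim 0
  have g3 := Real.Gamma_pos_of_pos (show 0 < x + 1 / 2 by positivity)
  have g4 := Real.Gamma_pos_of_pos (show 0 < x + b + 1 / 2 by positivity)
  simp only [hf, Nat.cast_zero, add_zero] at h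
  rw [le_div_iff₀ (by positivity), one_mul] at h
  linarith

/-- Coefficient of `(1 - t) ^ (j + β)` in the right-sided fractional integral of order `β` of the
Legendre polynomial of degree `n`. -/
noncomputable def fracLegendreCoeff (n : ℕ) (β : ℝ) (j : ℕ) : ℝ :=
  (-1) ^ j * ((n.choose j : ℝ) * ((n + j).choose j : ℝ) * (j.factorial : ℝ)) / 2 ^ j *
    (Real.Gamma (j + β + 1))⁻¹

/-- The right-sided fractional integral (from `1`) of order `β` of the Legendre polynomial of
degree `n`. -/
noncomputable def fracLegendre (n : ℕ) (β t : ℝ) : ℝ :=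
  ∑ j ∈ Finset.range (n + 1), fracLegendreCoeff n β j * (1 - t) ^ ((j : ℝ) + β)

theorem fracLegendreCoeff_eq_zero {n j : ℕ} (h : n < j) (β : ℝ) :
    fracLegendreCoeff n β j = 0 := by
  simp [fracLegendreCoeff, Nat.choose_eq_zero_of_lt h]

theorem fracLegendre_eq_sum_range {n M : ℕ} (h : n < M) (β t : ℝ) :
    fracLegendre n β t =
      ∑ j ∈ Finset.range M, fracLegendreCoeff n β j * (1 - t) ^ ((j : ℝ) + β) := by
  refine Finset.sum_subset (Finset.range_mono h) fun j _ hj => ?_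
  rw [fracLegendreCoeff_eq_zero (by simpa using hj), zero_mul]

theorem fracLegendreCoeff_sub_one (n : ℕ) (β : ℝ) (j : ℕ) :
    fracLegendreCoeff n (β - 1) j = fracLegendreCoeff n β j * (j + β) := by
  rw [fracLegendreCoeff, fracLegendreCoeff, show (j : ℝ) + (β - 1) + 1 = j + β by ring,
    inv_Gamma_eq_mul_inv_Gamma_add_one (j + β)]
  ring

theorem choose_mul_choose_mul_factorial_succ (n j : ℕ) :
    (n.choose (j + 1) : ℝ) * ((n + (j + 1)).choose (j + 1) : ℝ) * ((j + 1).factorial : ℝ) *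
      (j + 1) = n.choose j * (n + j).choose j * j.factorial * ((n - j) * (n + j + 1)) := by
  have h1 : (n.choose (j + 1) : ℝ) * (j + 1) = n.choose j * (n - j) := by
    rcases le_or_gt j n with h | h
    · have := Nat.choose_succ_right_eq n j
      have h2 := congrArg (Nat.cast (R := ℝ)) this
      push_cast [Nat.cast_sub h] at h2
      exact h2
    · simp [Nat.choose_eq_zero_of_lt h, Nat.choose_eq_zero_of_lt (Nat.lt_succ_of_lt h)]
  have h2 : ((n + (j + 1)).choose (j + 1) : ℝ) * (j + 1) = (n + j + 1) * (n + j).choose j := by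
    have := Nat.add_one_mul_choose_eq (n + j) j
    have h2 := congrArg (Nat.cast (R := ℝ)) this
    push_cast at h2
    rw [← add_assoc]
    exact h2.symm
  rw [Nat.factorial_succ]
  push_cast
  linear_combination ((n + (j + 1)).choose (j + 1) : ℝ) * (j.factorial : ℝ) * (j + 1) * h1 +
    (n.choose j : ℝ) * (n - j) * j.factorial * h2

theorem choose_mul_choose_succ_left (n j : ℕ) :
    ((n + 1).choose j : ℝ) * ((n + 1 + j).choose j : ℝ) * (n + 1 - j) =
      n.choose j * (n + j).choose j * (n + 1 + j) := by
  have h1 : ((n + 1).choose j : ℝ) * (n + 1 - j) = n.choose j * (n + 1) := by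
    rcases le_or_gt j (n + 1) with h | h
    · have := Nat.choose_mul_succ_eq n j
      have h2 := congrArg (Nat.cast (R := ℝ)) this
      push_cast [Nat.cast_sub h] at h2
      exact h2.symm
    · simp [Nat.choose_eq_zero_of_lt h, Nat.choose_eq_zero_of_lt (show n < j by omega)]
  have h2 : ((n + 1 + j).choose j : ℝ) * (n + 1) = (n + j).choose j * (n + 1 + j) := by
    have := Nat.choose_mul_succ_eq (n + j) j
    have h2 := congrArg (Nat.cast (R := ℝ)) this
    rw [show n + j + 1 - j = n + 1 by omega, show n + j + 1 = n + 1 + j by omega] at h2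
    push_cast at h2
    exact h2.symm
  linear_combination ((n + 1 + j).choose j : ℝ) * h1 + (n.choose j : ℝ) * h2

theorem fracLegendreCoeff_succ_right (n : ℕ) (β : ℝ) (j : ℕ) :
    2 * (j + 1) * (j + 1 + β) * fracLegendreCoeff n β (j + 1) =
      -((n - j) * (n + j + 1) * fracLegendreCoeff n β j) := by
  have h := choose_mul_choose_mul_factorial_succ n j
  simp only [fracLegendreCoeff]
  rw [inv_Gamma_eq_mul_inv_Gamma_add_one (j + β + 1)]
  push_cast
  rw [show (j : ℝ) + 1 + β + 1 = j + β + 1 + 1 by ring, pow_succ, pow_succ]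
  generalize (Real.Gamma (j + β + 1 + 1))⁻¹ = G
  field_simp
  linear_combination (-(j + 1 + β) * G) * h

theorem fracLegendreCoeff_succ_left (n : ℕ) (β : ℝ) (j : ℕ) :
    (n + 1 - j) * fracLegendreCoeff (n + 1) β j = (n + 1 + j) * fracLegendreCoeff n β j := by
  have h := choose_mul_choose_succ_left n j
  simp only [fracLegendreCoeff]
  generalize (Real.Gamma (j + β + 1))⁻¹ = G
  field_simp
  linear_combination G * h

theorem sum_range_telescope {a b X : ℕ → ℝ} (h0 : a 0 = 0) (h : ∀ j, a (j + 1) = -b j) (M : ℕ) :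
    ∑ j ∈ Finset.range M, (a j * X j + b j * X (j + 1)) = -(a M * X M) := by
  induction M with
  | zero => simp [h0]
  | succ M ih => rw [Finset.sum_range_succ, ih, h]; ring

theorem one_sub_rpow_succ {t : ℝ} (ht : t < 1) (j : ℕ) (β : ℝ) :
    (1 - t) ^ (((j + 1 : ℕ) : ℝ) + β) = (1 - t) * (1 - t) ^ ((j : ℝ) + β) := by
  rw [show ((j + 1 : ℕ) : ℝ) + β = j + β + 1 by push_cast; ring,
    Real.rpow_add_one (by linarith), mul_comm]

theorem fracLegendre_sub_one_mul (n : ℕ) (β : ℝ) {t : ℝ} (ht : t < 1) {M : ℕ} (h : n < M) :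
    (1 - t) * fracLegendre n (β - 1) t = ∑ j ∈ Finset.range M,
      fracLegendreCoeff n β j * (j + β) * (1 - t) ^ ((j : ℝ) + β) := by
  rw [fracLegendre_eq_sum_range h, Finset.mul_sum]
  refine Finset.sum_congr rfl fun j _ => ?_
  rw [fracLegendreCoeff_sub_one, show (j : ℝ) + β = j + (β - 1) + 1 by ring,
    Real.rpow_add_one (by linarith)]
  ring

theorem hasDerivAt_fracLegendre (n : ℕ) (β : ℝ) {t : ℝ} (ht : t < 1) :
    HasDerivAt (fracLegendre n β) (-fracLegendre n (β - 1) t) t := by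
  unfold fracLegendre
  rw [← Finset.sum_neg_distrib]
  refine HasDerivAt.fun_sum fun j _ => ?_
  have h := (((hasDerivAt_id' t).const_sub 1).rpow_const (p := (j : ℝ) + β)
    (Or.inl (by linarith))).const_mul (fracLegendreCoeff n β j)
  refine h.congr_deriv ?_
  rw [fracLegendreCoeff_sub_one, show (j : ℝ) + (β - 1) = j + β - 1 by ring]
  ring

theorem fracLegendre_down (n : ℕ) (β : ℝ) {t : ℝ} (ht : t < 1) :
    -((1 - t ^ 2) * fracLegendre (n + 1) (β - 1) t) =
      (n + 1 - β) * fracLegendre n β t - (n + 1 + β) * t * fracLegendre (n + 1) β t := by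
  have h := sum_range_telescope
    (a := fun j : ℕ => (n + 1 - β - 2 * j) * fracLegendreCoeff (n + 1) β j -
      (n + 1 - β) * fracLegendreCoeff n β j)
    (b := fun j : ℕ => (j - (n + 1)) * fracLegendreCoeff (n + 1) β j)
    (X := fun j : ℕ => (1 - t) ^ ((j : ℝ) + β)) (by simp [fracLegendreCoeff]) (fun j => by
      have h1 := fracLegendreCoeff_succ_right (n + 1) β j
      have h2 := fracLegendreCoeff_succ_left n β (j + 1)
      push_cast at h1 h2 ⊢
      have h3 : (n : ℝ) + 1 + (j + 1) ≠ 0 := by positivity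
      apply mul_left_cancel₀ h3
      linear_combination -h1 + (n + 1 - β) * h2) (n + 2)
  rw [fracLegendreCoeff_eq_zero (by omega), fracLegendreCoeff_eq_zero (by omega)] at h
  rw [show (1 - t ^ 2) * fracLegendre (n + 1) (β - 1) t =
      (1 + t) * ((1 - t) * fracLegendre (n + 1) (β - 1) t) by ring,
    fracLegendre_sub_one_mul _ _ ht (show n + 1 < n + 2 by omega),
    fracLegendre_eq_sum_range (show n < n + 2 by omega),
    fracLegendre_eq_sum_range (show n + 1 < n + 2 by omega), ← sub_eq_zero]
  simp only [mul_zero, sub_zero, zero_mul, neg_zero] at h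
  rw [← h]
  simp only [Finset.mul_sum, ← Finset.sum_neg_distrib, ← Finset.sum_sub_distrib]
  refine Finset.sum_congr rfl fun j _ => ?_
  rw [one_sub_rpow_succ ht]
  ring

theorem fracLegendre_up (n : ℕ) (β : ℝ) {t : ℝ} (ht : t < 1) :
    -((1 - t ^ 2) * fracLegendre n (β - 1) t) =
      (n + 1 - β) * t * fracLegendre n β t - (n + 1 + β) * fracLegendre (n + 1) β t := by
  have h := sum_range_telescope
    (a := fun j : ℕ => -(2 * (j + β) + n + 1 - β) * fracLegendreCoeff n β j +
      (n + 1 + β) * fracLegendreCoeff (n + 1) β j)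
    (b := fun j : ℕ => (n + 1 + j) * fracLegendreCoeff n β j)
    (X := fun j : ℕ => (1 - t) ^ ((j : ℝ) + β)) (by simp [fracLegendreCoeff]; ring) (fun j => by
      have h1 := fracLegendreCoeff_succ_right (n + 1) β j
      have h2 := fracLegendreCoeff_succ_left n β (j + 1)
      have h3 := fracLegendreCoeff_succ_left n β j
      push_cast at h1 h2 h3 ⊢
      have h4 : (n : ℝ) + 1 + (j + 1) ≠ 0 := by positivity
      apply mul_left_cancel₀ h4
      linear_combination h1 + (2 * (j + 1 + β) + n + 1 - β) * h2 - (n + j + 2) * h3) (n + 2)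
  rw [fracLegendreCoeff_eq_zero (by omega), fracLegendreCoeff_eq_zero (by omega)] at h
  rw [show (1 - t ^ 2) * fracLegendre n (β - 1) t =
      (1 + t) * ((1 - t) * fracLegendre n (β - 1) t) by ring,
    fracLegendre_sub_one_mul _ _ ht (show n < n + 2 by omega),
    fracLegendre_eq_sum_range (show n < n + 2 by omega),
    fracLegendre_eq_sum_range (show n + 1 < n + 2 by omega), ← sub_eq_zero]
  simp only [mul_zero, add_zero, zero_mul, neg_zero] at h
  rw [← h]
  simp only [Finset.mul_sum, ← Finset.sum_neg_distrib, ← Finset.sum_sub_distrib]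
  refine Finset.sum_congr rfl fun j _ => ?_
  rw [one_sub_rpow_succ ht]
  ring

theorem fracLegendre_ode (n : ℕ) (β : ℝ) {t : ℝ} (ht : t < 1) :
    (1 - t ^ 2) * fracLegendre n (β - 2) t - 2 * (β - 1) * t * fracLegendre n (β - 1) t +
      (n + β) * (n - β + 1) * fracLegendre n β t = 0 := by
  have h := sum_range_telescope
    (a := fun j : ℕ => 2 * (j + β) * j * fracLegendreCoeff n β j)
    (b := fun j : ℕ => (n * (n + 1) - j * (j + 1)) * fracLegendreCoeff n β j)
    (X := fun j : ℕ => (1 - t) ^ ((j : ℝ) + (β - 1))) (by simp) (fun j => by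
      have h1 := fracLegendreCoeff_succ_right n β j
      push_cast
      linear_combination h1) (n + 1)
  rw [fracLegendreCoeff_eq_zero (by omega)] at h
  simp only [mul_zero, zero_mul, neg_zero] at h
  rw [show (1 - t ^ 2) * fracLegendre n (β - 2) t =
      (1 + t) * ((1 - t) * fracLegendre n (β - 1 - 1) t) by ring_nf,
    fracLegendre_sub_one_mul _ _ ht (Nat.lt_succ_self n), ← h, fracLegendre, fracLegendre]
  simp only [Finset.mul_sum, ← Finset.sum_sub_distrib, ← Finset.sum_add_distrib]
  refine Finset.sum_congr rfl fun j _ => ?_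
  rw [one_sub_rpow_succ ht, show (j : ℝ) + β = j + (β - 1) + 1 by ring,
    Real.rpow_add_one (by linarith), fracLegendreCoeff_sub_one]
  ring

theorem iteratedDeriv_aeval_one_sub_div_two (p : Polynomial ℤ) (i : ℕ) :
    iteratedDeriv i (fun t : ℝ => Polynomial.aeval ((1 - t) / 2) p) =
      fun t : ℝ => (-1 / 2) ^ i *
        Polynomial.aeval ((1 - t) / 2) (Polynomial.derivative^[i] p) := by
  induction i with
  | zero => simp
  | succ i ih =>
    rw [iteratedDeriv_succ, ih]
    ext t
    have h1 := ((Polynomial.derivative^[i] p).hasDerivAt_aeval ((1 - t) / 2)).comp t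
      (((hasDerivAt_id' t).const_sub 1).div_const 2)
    have h2 := (h1.const_mul ((-1 / 2 : ℝ) ^ i)).deriv
    simp only [Function.comp_def] at h2
    rw [h2, Function.iterate_succ_apply', pow_succ]
    ring

theorem legendre_eq_aeval_shiftedLegendre (n : ℕ) (t : ℝ) :
    legendre n t = Polynomial.aeval ((1 - t) / 2) (Polynomial.shiftedLegendre n) := by
  have h1 : (fun y : ℝ => (y ^ 2 - 1) ^ n) = fun y : ℝ => (-4) ^ n *
      Polynomial.aeval ((1 - y) / 2) (Polynomial.X ^ n * (1 - Polynomial.X : Polynomial ℤ) ^ n) := by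
    ext y
    simp only [map_mul, map_pow, Polynomial.aeval_X, map_sub, map_one]
    rw [← mul_pow, ← mul_pow]
    ring
  have h2 : Polynomial.aeval ((1 - t) / 2)
      ((n.factorial : Polynomial ℤ) * Polynomial.shiftedLegendre n) =
      (n.factorial : ℝ) * Polynomial.aeval ((1 - t) / 2) (Polynomial.shiftedLegendre n) := by
    simp
  rw [legendre, h1, iteratedDeriv_const_mul_field, iteratedDeriv_aeval_one_sub_div_two,
    ← Polynomial.factorial_mul_shiftedLegendre_eq]
  simp only [h2]
  have hf : (n.factorial : ℝ) ≠ 0 := by exact_mod_cast n.factorial_ne_zero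
  have h3 : (-4 : ℝ) ^ n * (-1 / 2) ^ n = 2 ^ n := by rw [← mul_pow]; norm_num
  field_simp
  linear_combination Polynomial.aeval ((1 - t) / 2) (Polynomial.shiftedLegendre n) * h3

theorem legendre_neg (n : ℕ) (t : ℝ) : legendre n (-t) = (-1) ^ n * legendre n t := by
  rw [legendre_eq_aeval_shiftedLegendre, legendre_eq_aeval_shiftedLegendre,
    Polynomial.shiftedLegendre_eval_symm]
  ring_nf

theorem fracLegendre_zero (n : ℕ) (t : ℝ) : fracLegendre n 0 t = legendre n t := by
  rw [legendre_eq_aeval_shiftedLegendre, Polynomial.shiftedLegendre, map_sum, fracLegendre]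
  refine Finset.sum_congr rfl fun j _ => ?_
  have hf : (j.factorial : ℝ) ≠ 0 := by exact_mod_cast j.factorial_ne_zero
  rw [fracLegendreCoeff, add_zero, Real.Gamma_nat_eq_factorial, Real.rpow_natCast]
  simp only [map_mul, map_pow, Polynomial.aeval_X, Polynomial.aeval_C]
  have : (n + j).choose j = (n + j).choose n := by
    rw [Nat.choose_symm_add]
  rw [this]
  simp
  rw [div_pow]
  field_simp

theorem continuous_fracLegendre (n : ℕ) {β : ℝ} (hβ : 0 ≤ β) : Continuous (fracLegendre n β) := by
  unfold fracLegendre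
  refine continuous_finsetSum _ fun j _ => ?_
  exact continuous_const.mul ((continuous_const.sub continuous_id).rpow_const
    fun _ => Or.inr (by positivity))

theorem fracLegendre_one (n : ℕ) {β : ℝ} (hβ : 0 < β) : fracLegendre n β 1 = 0 := by
  refine Finset.sum_eq_zero fun j _ => ?_
  rw [sub_self, Real.zero_rpow (by positivity), mul_zero]

theorem fracLegendre_neg_one (n : ℕ) {β : ℝ} (hβ : 0 ≤ β) :
    fracLegendre n β (-1) = (-1) ^ n * (2 ^ β / Real.Gamma (β + 1) *
      ∏ j ∈ Finset.range n, ((j + 1 - β) / (j + 1 + β))) := by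
  induction n with
  | zero => simp [fracLegendre, fracLegendreCoeff]; norm_num; ring
  | succ n ih =>
    have h := fracLegendre_down n β (show (-1 : ℝ) < 1 by norm_num)
    have h2 : (n : ℝ) + 1 + β ≠ 0 := by positivity
    rw [Finset.prod_range_succ, pow_succ]
    have h3 : fracLegendre (n + 1) β (-1) = -((n + 1 - β) / (n + 1 + β)) * fracLegendre n β (-1) := by
      field_simp
      linear_combination -h
    rw [h3, ih]
    ring

theorem fracLegendre_natCast_neg_one {n j : ℕ} (h0 : 1 ≤ j) (hj : j ≤ n) :
    fracLegendre n j (-1) = 0 := by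
  rw [fracLegendre_neg_one n (Nat.cast_nonneg j), Finset.prod_eq_zero (i := j - 1)
    (Finset.mem_range.2 (by omega))]
  · simp
  · rw [Nat.cast_sub h0]; simp

theorem intervalIntegrable_fracLegendre (n : ℕ) {β : ℝ} (hβ : -1 < β) (a b : ℝ) :
    IntervalIntegrable (fracLegendre n β) volume a b := by
  have hsum : fracLegendre n β = ∑ j ∈ Finset.range (n + 1),
      fun t => fracLegendreCoeff n β j * (1 - t) ^ ((j : ℝ) + β) := by
    ext t
    simp [fracLegendre]
  rw [hsum]
  refine IntervalIntegrable.sum _ fun j _ => ?_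
  have h := (intervalIntegral.intervalIntegrable_rpow' (a := 1 - a) (b := 1 - b)
    (show -1 < (j : ℝ) + β by linarith [(Nat.cast_nonneg j : (0 : ℝ) ≤ j)])).comp_sub_left 1
  simp only [sub_sub_cancel] at h
  exact h.const_mul _

theorem exists_abs_fracLegendre_le (n : ℕ) (β : ℝ) :
    ∃ C, 0 ≤ C ∧ ∀ x ∈ Ico (-1 : ℝ) 1, |fracLegendre n β x| ≤ C * (1 - x) ^ β := by
  refine ⟨∑ j ∈ Finset.range (n + 1), |fracLegendreCoeff n β j| * 2 ^ j,
    Finset.sum_nonneg fun _ _ => by positivity, fun x hx => ?_⟩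
  have hx1 : 0 < 1 - x := by linarith [hx.2]
  rw [Finset.sum_mul]
  refine (Finset.abs_sum_le_sum_abs _ _).trans (Finset.sum_le_sum fun j _ => ?_)
  rw [abs_mul, Real.rpow_add hx1, Real.rpow_natCast, abs_of_nonneg
    (show 0 ≤ (1 - x) ^ j * (1 - x) ^ β by positivity), mul_assoc]
  gcongr
  linarith [hx.1]

theorem fracLegendre_at_zero (n : ℕ) {β : ℝ} (hβ : 0 ≤ β) :
    fracLegendre n β 0 = Real.sqrt Real.pi * 2 ^ (-β) *
      ((Real.Gamma ((β - n + 1) / 2))⁻¹ * (Real.Gamma ((n + β) / 2 + 1))⁻¹) := by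
  have hs : Real.sqrt Real.pi ≠ 0 := (Real.sqrt_pos.2 Real.pi_pos).ne'
  induction n using Nat.twoStepInduction with
  | zero =>
    have h := Real.Gamma_mul_Gamma_add_half ((β + 1) / 2)
    rw [show 2 * ((β + 1) / 2) = β + 1 by ring, show 1 - (β + 1) = -β by ring] at h
    simp only [fracLegendre, fracLegendreCoeff]
    simp only [zero_add, Finset.range_one, Finset.sum_singleton, Nat.cast_zero, sub_zero,
      Real.one_rpow, Nat.choose_self, Nat.factorial_zero]
    rw [← mul_inv, show β / 2 + 1 = (β + 1) / 2 + 1 / 2 by ring, h]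
    have := (Real.Gamma_pos_of_pos (show 0 < β + 1 by positivity)).ne'
    have h2 : (2 : ℝ) ^ (-β) ≠ 0 := by positivity
    field_simp
    simp
  | one =>
    have h := Real.Gamma_mul_Gamma_add_half ((β + 2) / 2)
    have h1 := fracLegendre_up 0 β (show (0 : ℝ) < 1 by norm_num)
    have h3 : fracLegendre 0 (β - 1) 0 = (Real.Gamma β)⁻¹ := by
      simp [fracLegendre, fracLegendreCoeff]
    rw [h3] at h1
    have e1 := inv_Gamma_eq_mul_inv_Gamma_add_one β
    have e2 := inv_Gamma_eq_mul_inv_Gamma_add_one (β + 1)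
    have e3 := inv_Gamma_eq_mul_inv_Gamma_add_one (β / 2)
    rw [show β + 1 + 1 = β + 2 by ring] at e2
    push_cast at h1 ⊢
    rw [show 2 * ((β + 2) / 2) = β + 2 by ring, show 1 - (β + 2) = -β - 1 by ring,
      Real.rpow_sub_one (by norm_num)] at h
    rw [show (β - 1 + 1) / 2 = β / 2 by ring, e3, mul_assoc (β / 2), ← mul_inv,
      show β / 2 + 1 = (β + 2) / 2 by ring, show (1 + β) / 2 + 1 = (β + 2) / 2 + 1 / 2 by ring, h]
    have g := (Real.Gamma_pos_of_pos (show 0 < β + 2 by positivity)).ne'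
    have h2 : (2 : ℝ) ^ (-β) ≠ 0 := by positivity
    have h4 : (1 + β) ≠ 0 := by positivity
    rw [e1, e2] at h1
    have h5 : (1 + β) * fracLegendre 1 β 0 = (1 + β) * (β * (Real.Gamma (β + 2))⁻¹) := by
      linear_combination h1
    rw [mul_left_cancel₀ h4 h5]
    field_simp
  | more n ih _ =>
    have h1 := fracLegendre_up (n + 1) β (show (0 : ℝ) < 1 by norm_num)
    have h2 := fracLegendre_down n β (show (0 : ℝ) < 1 by norm_num)
    have e1 := inv_Gamma_eq_mul_inv_Gamma_add_one ((β - n - 1) / 2)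
    have e2 := inv_Gamma_eq_mul_inv_Gamma_add_one ((n + β) / 2 + 1)
    push_cast at h1 h2 ⊢
    rw [show (β - (n + 2) + 1) / 2 = (β - n - 1) / 2 by ring,
      show ((n : ℝ) + 2 + β) / 2 + 1 = (n + β) / 2 + 1 + 1 by ring, e1,
      show (β - (n : ℝ) - 1) / 2 + 1 = (β - n + 1) / 2 by ring]
    rw [e2] at ih
    have h4 : (n + 1 + 1 + β) ≠ 0 := by positivity
    apply mul_left_cancel₀ h4
    linear_combination h1 - h2 - (n + 1 - β) * ih

theorem inv_Gamma_eq_mul_sin {s : ℝ} (hs : s < 1) :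
    (Real.Gamma s)⁻¹ = Real.Gamma (1 - s) * Real.sin (Real.pi * s) / Real.pi := by
  have h := Real.Gamma_mul_Gamma_one_sub s
  have g := (Real.Gamma_pos_of_pos (show 0 < 1 - s by linarith))
  have hp := Real.pi_pos
  rcases eq_or_ne (Real.sin (Real.pi * s)) 0 with h0 | h0
  · rw [h0, div_zero] at h
    rcases mul_eq_zero.1 h with h1 | h1
    · rw [h0, h1]; simp
    · exact absurd h1 g.ne'
  · have g2 : Real.Gamma s ≠ 0 := by
      intro h1
      rw [h1, zero_mul] at h
      exact (div_ne_zero hp.ne' h0) h.symm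
    rw [eq_div_iff h0] at h
    field_simp
    rw [mul_comm s]
    linear_combination -h

theorem betaKernel_intervalIntegrable_and_integral {s b : ℝ} (hs : 0 < s) (hb : 0 < b) :
    IntervalIntegrable (fun v : ℝ => v ^ (s - 1) * (1 - v) ^ (b - 1)) volume 0 1 ∧
    ∫ v in (0 : ℝ)..1, v ^ (s - 1) * (1 - v) ^ (b - 1) =
      Real.Gamma s * Real.Gamma b / Real.Gamma (s + b) := by
  have hc := Complex.betaIntegral_convergent (u := s) (v := b) (by simpa) (by simpa)
  have heq : ∀ v ∈ uIoc (0 : ℝ) 1, (v : ℂ) ^ ((s : ℂ) - 1) * (1 - (v : ℂ)) ^ ((b : ℂ) - 1) =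
      ((v ^ (s - 1) * (1 - v) ^ (b - 1) : ℝ) : ℂ) := by
    intro v hv
    rw [uIoc_of_le zero_le_one] at hv
    have h1 : (0 : ℝ) ≤ 1 - v := by linarith [hv.2]
    rw [Complex.ofReal_mul, Complex.ofReal_cpow hv.1.le, Complex.ofReal_cpow h1]
    push_cast
    rfl
  have hc2 := hc.congr heq
  constructor
  · exact ⟨by simpa [IntegrableOn] using hc2.1.re, by simp⟩
  · have h := ProbabilityTheory.beta_eq_betaIntegralReal s b hs hb
    rw [Complex.betaIntegral, intervalIntegral.integral_congr_ae (ae_of_all _ heq),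
      intervalIntegral.integral_ofReal, Complex.ofReal_re, ProbabilityTheory.beta] at h
    exact h.symm

theorem rpow_kernel_intervalIntegrable_and_integral {s b t : ℝ} (hs : 0 < s) (hb : 0 < b)
    (ht : t < 1) :
    IntervalIntegrable (fun x : ℝ => (x - t) ^ (s - 1) * (1 - x) ^ (b - 1)) volume t 1 ∧
    ∫ x in t..1, (x - t) ^ (s - 1) * (1 - x) ^ (b - 1) =
      Real.Gamma s * Real.Gamma b / Real.Gamma (s + b) * (1 - t) ^ (s + b - 1) := by
  obtain ⟨h1, h2⟩ := betaKernel_intervalIntegrable_and_integral hs hb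
  have ha : 0 < 1 - t := by linarith
  set g : ℝ → ℝ := fun v => v ^ (s - 1) * (1 - v) ^ (b - 1) with hg
  have key : ∀ x ∈ uIoc t 1, (1 - t) ^ (s + b - 2) * g ((x - t) / (1 - t)) =
      (x - t) ^ (s - 1) * (1 - x) ^ (b - 1) := by
    intro x hx
    rw [uIoc_of_le ht.le] at hx
    have e1 : 1 - (x - t) / (1 - t) = (1 - x) / (1 - t) := by field_simp; ring
    simp only [hg]
    rw [e1, Real.div_rpow (by linarith [hx.1]) ha.le, Real.div_rpow (by linarith [hx.2]) ha.le,
      show s + b - 2 = (s - 1) + (b - 1) by ring, Real.rpow_add ha]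
    have r1 : 0 < (1 - t) ^ (s - 1) := by positivity
    have r2 : 0 < (1 - t) ^ (b - 1) := by positivity
    field_simp
  have h3 : IntervalIntegrable (fun x => g ((x - t) / (1 - t))) volume t 1 := by
    have := (h1.comp_mul_right (c := (1 - t)⁻¹)).comp_sub_right t
    simpa [div_eq_mul_inv] using this
  constructor
  · exact (h3.const_mul _).congr key
  · rw [← intervalIntegral.integral_congr_ae (ae_of_all _ key), intervalIntegral.integral_const_mul]
    have := intervalIntegral.integral_comp_sub_right (fun x => g (x / (1 - t))) t (a := t) (b := 1)
    rw [this, intervalIntegral.integral_comp_div _ ha.ne', sub_self, zero_div, div_self ha.ne', h2,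
      show s + b - 1 = s + b - 2 + 1 by ring, Real.rpow_add_one ha.ne', smul_eq_mul]
    ring

theorem fracLegendre_intervalIntegrable_and_integral (n : ℕ) {s b t : ℝ} (hs : 0 < s) (hb : 0 < b)
    (ht : t < 1) :
    IntervalIntegrable (fun x : ℝ => (x - t) ^ (s - 1) * fracLegendre n (b - 1) x) volume t 1 ∧
    ∫ x in t..1, (x - t) ^ (s - 1) * fracLegendre n (b - 1) x =
      Real.Gamma s * fracLegendre n (s + b - 1) t := by
  have hk := fun j : ℕ => rpow_kernel_intervalIntegrable_and_integral (b := j + b) hs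
    (by positivity) ht
  have hfun : (fun x : ℝ => (x - t) ^ (s - 1) * fracLegendre n (b - 1) x) = fun x =>
      ∑ j ∈ Finset.range (n + 1), fracLegendreCoeff n (b - 1) j *
        ((x - t) ^ (s - 1) * (1 - x) ^ ((j : ℝ) + b - 1)) := by
    ext x
    rw [fracLegendre, Finset.mul_sum]
    refine Finset.sum_congr rfl fun j _ => ?_
    rw [show (j : ℝ) + (b - 1) = j + b - 1 by ring]
    ring
  rw [hfun]
  have hi : ∀ j ∈ Finset.range (n + 1), IntervalIntegrable (fun x : ℝ =>
      fracLegendreCoeff n (b - 1) j * ((x - t) ^ (s - 1) * (1 - x) ^ ((j : ℝ) + b - 1)))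
      volume t 1 := fun j _ => (hk j).1.const_mul _
  constructor
  · have := IntervalIntegrable.sum _ hi
    exact this.congr fun x _ => by simp
  · rw [intervalIntegral.integral_finsetSum hi, fracLegendre, Finset.mul_sum]
    refine Finset.sum_congr rfl fun j _ => ?_
    rw [intervalIntegral.integral_const_mul, (hk j).2, fracLegendreCoeff, fracLegendreCoeff,
      show (j : ℝ) + (b - 1) + 1 = j + b by ring, show s + (j + b) = j + (s + b - 1) + 1 by ring,
      show (j : ℝ) + (s + b - 1) + 1 - 1 = j + (s + b - 1) by ring]
    have g := (Real.Gamma_pos_of_pos (show 0 < (j : ℝ) + b by positivity)).ne'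
    field_simp

theorem prod_add_one_add_eq_Gamma_div {γ : ℝ} (hγ : -1 < γ) (n : ℕ) :
    ∏ j ∈ Finset.range n, ((j : ℝ) + 1 + γ) = Real.Gamma (n + 1 + γ) / Real.Gamma (1 + γ) := by
  have g := (Real.Gamma_pos_of_pos (show 0 < 1 + γ by linarith)).ne'
  induction n with
  | zero => simp [g]
  | succ n ih =>
    have h : (n : ℝ) + 1 + γ ≠ 0 := by
      have := (Nat.cast_nonneg n : (0 : ℝ) ≤ n)
      linarith
    rw [Finset.prod_range_succ, ih, show ((n + 1 : ℕ) : ℝ) + 1 + γ = n + 1 + γ + 1 by push_cast; ring,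
      Real.Gamma_add_one h]
    ring

theorem Gamma_eq_Gamma_half_mul (u : ℝ) :
    Real.Gamma (2 * u) =
      Real.Gamma u * Real.Gamma (u + 1 / 2) * 2 ^ (2 * u - 1) / Real.sqrt Real.pi := by
  have hs : Real.sqrt Real.pi ≠ 0 := (Real.sqrt_pos.2 Real.pi_pos).ne'
  rw [Real.Gamma_mul_Gamma_add_half, show 2 * u - 1 = -(1 - 2 * u) by ring,
    Real.rpow_neg (by norm_num)]
  have : (2 : ℝ) ^ (1 - 2 * u) ≠ 0 := by positivity
  field_simp

/-- The amplitude bounding the right-sided fractional integral of order `β` of the Legendre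
polynomial of degree `n`. -/
noncomputable def fracLegendreAmp (n : ℕ) (β : ℝ) : ℝ :=
  Real.Gamma ((n - β + 1) / 2) / (2 ^ β * Real.sqrt Real.pi * Real.Gamma ((n + β) / 2 + 1))

theorem fracLegendreAmp_pos {n : ℕ} {β : ℝ} (h0 : 0 ≤ β) (h : β < n + 1) :
    0 < fracLegendreAmp n β := by
  have g1 := Real.Gamma_pos_of_pos (show 0 < ((n : ℝ) - β + 1) / 2 by linarith)
  have g2 := Real.Gamma_pos_of_pos (show 0 < ((n : ℝ) + β) / 2 + 1 by positivity)
  have := Real.sqrt_pos.2 Real.pi_pos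
  unfold fracLegendreAmp
  positivity

theorem abs_fracLegendre_neg_one (n : ℕ) {β : ℝ} (h0 : 0 ≤ β) (h1 : β < 1) :
    |fracLegendre n β (-1)| = 2 ^ β / Real.Gamma (β + 1) *
      ∏ j ∈ Finset.range n, ((j + 1 - β) / (j + 1 + β)) := by
  have g := Real.Gamma_pos_of_pos (show 0 < β + 1 by linarith)
  rw [fracLegendre_neg_one n h0, abs_mul, abs_pow, abs_neg, abs_one, one_pow, one_mul, abs_of_nonneg]
  refine mul_nonneg (by positivity) (Finset.prod_nonneg fun j _ => ?_)
  have := (Nat.cast_nonneg j : (0 : ℝ) ≤ j)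
  exact div_nonneg (by linarith) (by linarith)

theorem abs_fracLegendre_neg_one_eq_mul_amp (n : ℕ) {β : ℝ} (h0 : 0 ≤ β) (h1 : β < 1) :
    |fracLegendre n β (-1)| = Real.sqrt Real.pi * Real.Gamma ((n - β) / 2 + 1) /
      (Real.Gamma (1 - β) * Real.Gamma ((n + 1 + β) / 2)) * fracLegendreAmp n β := by
  have hn := (Nat.cast_nonneg n : (0 : ℝ) ≤ n)
  have e1 := prod_add_one_add_eq_Gamma_div (show -1 < -β by linarith) n
  have e2 := prod_add_one_add_eq_Gamma_div (show -1 < β by linarith) n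
  simp only [← sub_eq_add_neg] at e1
  rw [abs_fracLegendre_neg_one n h0 h1, Finset.prod_div_distrib, e1, e2, fracLegendreAmp,
    show (n : ℝ) + 1 - β = 2 * ((n - β + 1) / 2) by ring, Gamma_eq_Gamma_half_mul,
    show (n : ℝ) + 1 + β = 2 * ((n + 1 + β) / 2) by ring, Gamma_eq_Gamma_half_mul ((n + 1 + β) / 2),
    show ((n : ℝ) - β + 1) / 2 + 1 / 2 = (n - β) / 2 + 1 by ring,
    show ((n : ℝ) + 1 + β) / 2 + 1 / 2 = (n + β) / 2 + 1 by ring,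
    show 2 * (((n : ℝ) + 1 + β) / 2) - 1 = (2 * ((n - β + 1) / 2) - 1) + β + β by ring,
    Real.rpow_add (by norm_num), Real.rpow_add (by norm_num), add_comm β 1,
    show 2 * (((n : ℝ) + 1 + β) / 2) / 2 = (n + 1 + β) / 2 by ring]
  have g1 := (Real.Gamma_pos_of_pos (show 0 < ((n : ℝ) + 1 + β) / 2 by positivity)).ne'
  have g2 := (Real.Gamma_pos_of_pos (show 0 < ((n : ℝ) + β) / 2 + 1 by positivity)).ne'
  have g3 := (Real.Gamma_pos_of_pos (show 0 < 1 + β by positivity)).ne'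
  have g4 := (Real.Gamma_pos_of_pos (show 0 < 1 - β by linarith)).ne'
  have hs : Real.sqrt Real.pi ≠ 0 := (Real.sqrt_pos.2 Real.pi_pos).ne'
  have r1 : (2 : ℝ) ^ β ≠ 0 := by positivity
  have r2 : (2 : ℝ) ^ (2 * (((n : ℝ) - β + 1) / 2) - 1) ≠ 0 := by positivity
  generalize (2 : ℝ) ^ (2 * (((n : ℝ) - β + 1) / 2) - 1) = T at *
  field_simp

theorem sum_log_ge (n : ℕ) {β : ℝ} (h0 : 0 ≤ β) (h1 : β ≤ 1 / 2) :
    -(2 * β * Real.log (2 * n + 1)) ≤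
      Real.log (∏ j ∈ Finset.range n, (((j : ℝ) + 1 - β) / (j + 1 + β))) := by
  induction n with
  | zero => simp
  | succ n ih =>
    have hn := (Nat.cast_nonneg n : (0 : ℝ) ≤ n)
    have hpos : ∀ j : ℕ, 0 < ((j : ℝ) + 1 - β) / (j + 1 + β) := fun j => by
      have := (Nat.cast_nonneg j : (0 : ℝ) ≤ j)
      exact div_pos (by linarith) (by linarith)
    rw [Finset.prod_range_succ, Real.log_mul (Finset.prod_pos fun j _ => hpos j).ne' (hpos n).ne']
    have h := log_add_div_sub_le (z := n + 1) (by linarith) h0 h1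
    rw [Real.log_div (by linarith) (by linarith), Real.log_div (by linarith) (by linarith)] at h
    rw [Real.log_div (by linarith) (by linarith)]
    have e1 : Real.log ((n : ℝ) + 1 + 1 / 2) = Real.log (2 * ((n + 1 : ℕ) : ℝ) + 1) - Real.log 2 := by
      rw [← Real.log_div (by positivity) (by norm_num)]
      push_cast
      ring_nf
    have e2 : Real.log ((n : ℝ) + 1 - 1 / 2) = Real.log (2 * n + 1) - Real.log 2 := by
      rw [← Real.log_div (by positivity) (by norm_num)]
      ring_nf
    rw [e1, e2] at h
    linarith

theorem log_Gamma_one_sub_le {β : ℝ} (h0 : 0 ≤ β) (h1 : β ≤ 1 / 2) :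
    Real.log (Real.Gamma (1 - β)) ≤ β * Real.log Real.pi := by
  have h := Real.convexOn_log_Gamma.2 (show (1 : ℝ) ∈ Ioi 0 by simp)
    (show (1 / 2 : ℝ) ∈ Ioi 0 by simp) (show 0 ≤ 1 - 2 * β by linarith)
    (show 0 ≤ 2 * β by linarith) (by ring)
  simp only [Function.comp_apply, smul_eq_mul, Real.Gamma_one, Real.log_one,
    Real.Gamma_one_half_eq, Real.log_sqrt Real.pi_pos.le] at h
  rw [show (1 - 2 * β) * 1 + 2 * β * (1 / 2) = 1 - β by ring] at h
  linarith

theorem log_amp_le_log_abs_fracLegendre_neg_one (n : ℕ) {β : ℝ} (h0 : 0 ≤ β) (h1 : β ≤ 1 / 2) :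
    4 * β * Real.log (fracLegendreAmp n β) - (1 - 2 * β) * Real.log (Real.Gamma (1 + β)) ≤
      (1 + 2 * β) * Real.log |fracLegendre n β (-1)| := by
  have hn := (Nat.cast_nonneg n : (0 : ℝ) ≤ n)
  have hA := fracLegendreAmp_pos (n := n) h0 (by linarith)
  have g1 := Real.Gamma_pos_of_pos (show 0 < ((n : ℝ) + 1 + β) / 2 by positivity)
  have g2 := Real.Gamma_pos_of_pos (show 0 < ((n : ℝ) - β) / 2 + 1 by linarith)
  have g3 := Real.Gamma_pos_of_pos (show 0 < 1 + β by positivity)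
  have g4 := Real.Gamma_pos_of_pos (show 0 < 1 - β by linarith)
  have hs := Real.sqrt_pos.2 Real.pi_pos
  have hc : (0 : ℝ) < (2 * n + 1) / 4 := by positivity
  have e1 : Real.log |fracLegendre n β (-1)| = Real.log Real.pi / 2 +
      Real.log (Real.Gamma ((n - β) / 2 + 1)) - Real.log (Real.Gamma (1 - β)) -
      Real.log (Real.Gamma ((n + 1 + β) / 2)) + Real.log (fracLegendreAmp n β) := by
    rw [abs_fracLegendre_neg_one_eq_mul_amp n h0 (by linarith),
      Real.log_mul (by positivity) hA.ne', Real.log_div (by positivity) (by positivity),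
      Real.log_mul hs.ne' g2.ne', Real.log_mul g4.ne' g1.ne', Real.log_sqrt Real.pi_pos.le]
    ring
  have hp : 0 < ∏ j ∈ Finset.range n, (((j : ℝ) + 1 - β) / (j + 1 + β)) :=
    Finset.prod_pos fun j _ => by
      have := (Nat.cast_nonneg j : (0 : ℝ) ≤ j)
      exact div_pos (by linarith) (by linarith)
  have e2 : Real.log |fracLegendre n β (-1)| = β * Real.log 2 - Real.log (Real.Gamma (1 + β)) +
      Real.log (∏ j ∈ Finset.range n, (((j : ℝ) + 1 - β) / (j + 1 + β))) := by
    rw [abs_fracLegendre_neg_one n h0 (by linarith), add_comm β 1,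
      Real.log_mul (by positivity) hp.ne', Real.log_div (by positivity) g3.ne',
      Real.log_rpow (by norm_num)]
  have h2 := sum_log_ge n h0 h1
  have h3 := log_Gamma_one_sub_le h0 h1
  have h4 := rpow_mul_Gamma_le hc (show 0 ≤ (1 / 2 - β) / 2 by linarith) (by linarith)
  rw [show (2 * (n : ℝ) + 1) / 4 + 1 / 2 - (1 / 2 - β) / 2 = (n + 1 + β) / 2 by ring,
    show (2 * (n : ℝ) + 1) / 4 + 1 / 2 + (1 / 2 - β) / 2 = (n - β) / 2 + 1 by ring] at h4
  have h5 := Real.log_le_log (by positivity) h4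
  rw [Real.log_mul (by positivity) g1.ne', Real.log_rpow hc,
    Real.log_div (by positivity) (by norm_num)] at h5
  have h6 : 0 ≤ 2 * Real.log Real.pi + Real.log 2 - 2 * Real.log 4 := by
    have : Real.log (4 ^ 2) ≤ Real.log (Real.pi ^ 2 * 2) :=
      Real.log_le_log (by norm_num) (by nlinarith [Real.pi_gt_three])
    rw [Real.log_mul (by positivity) (by norm_num), Real.log_pow, Real.log_pow] at this
    push_cast at this
    linarith
  have h7 : (1 - 2 * β) / 2 * (Real.log Real.pi + Real.log (2 * n + 1) - Real.log 4) ≤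
      Real.log |fracLegendre n β (-1)| - Real.log (fracLegendreAmp n β) := by linarith
  have h8 : β * Real.log 2 - 2 * β * Real.log (2 * n + 1) ≤
      Real.log |fracLegendre n β (-1)| + Real.log (Real.Gamma (1 + β)) := by linarith
  have h9 := mul_le_mul_of_nonneg_left h7 (show 0 ≤ 4 * β by linarith)
  have h10 := mul_le_mul_of_nonneg_left h8 (show 0 ≤ 1 - 2 * β by linarith)
  have h11 := mul_nonneg (mul_nonneg h0 (show 0 ≤ 1 - 2 * β by linarith)) h6
  nlinarith

theorem two_rpow_le_one_add {β : ℝ} (h0 : 0 ≤ β) (h1 : β ≤ 1) : (2 : ℝ) ^ β ≤ 1 + β := by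
  have h := rpow_one_add_le_one_add_mul_self (s := 1) (by norm_num) h0 h1
  norm_num at h
  exact h

theorem sqrt_pi_mul_Gamma_div_le (n : ℕ) {β : ℝ} (h0 : 0 < β) (h1 : β < 1) :
    Real.sqrt Real.pi * Real.Gamma ((n + 2 - β) / 2 + 1) /
      (Real.Gamma (1 - β) * Real.Gamma ((n + 3 + β) / 2)) ≤ (n + 4 - β) / (2 * (1 - β)) := by
  have hs := Real.sqrt_pos.2 Real.pi_pos
  have hb : 0 < 1 - β := by linarith
  have g4 := Real.Gamma_pos_of_pos hb
  have hd := Real.Gamma_mul_Gamma_add_half ((1 - β) / 2)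
  rw [show 2 * ((1 - β) / 2) = 1 - β by ring, show 1 - (1 - β) = β by ring,
    show (1 - β) / 2 + 1 / 2 = 1 - β / 2 by ring] at hd
  have g5 := Real.Gamma_pos_of_pos (show 0 < (1 - β) / 2 by linarith)
  have g6 := Real.Gamma_pos_of_pos (show 0 < 1 - β / 2 by linarith)
  have g7 := Real.Gamma_pos_of_pos (show 0 < (1 + β) / 2 by linarith)
  have g8 := Real.Gamma_pos_of_pos (show 0 < β / 2 by linarith)
  have h2 := two_rpow_le_one_add h0.le h1.le
  have r2 : (0 : ℝ) < 2 ^ β := by positivity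
  have hpi := Real.pi_pos
  have hpi2 := Real.pi_lt_d2
  induction n using Nat.twoStepInduction with
  | zero =>
    have hr := inv_Gamma_eq_mul_sin (show (1 + β) / 2 < 1 by linarith)
    rw [show 1 - (1 + β) / 2 = (1 - β) / 2 by ring] at hr
    have hsin := Real.sin_le_one (Real.pi * ((1 + β) / 2))
    push_cast
    rw [show ((0 : ℝ) + 2 - β) / 2 + 1 = 1 - β / 2 + 1 by ring, Real.Gamma_add_one (by linarith),
      show ((0 : ℝ) + 3 + β) / 2 = (1 + β) / 2 + 1 by ring, Real.Gamma_add_one (by positivity)]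
    generalize Real.sin (Real.pi * ((1 + β) / 2)) = S at *
    generalize Real.Gamma ((1 - β) / 2) = G5 at *
    generalize Real.Gamma (1 - β / 2) = G6 at *
    generalize Real.Gamma ((1 + β) / 2) = G7 at *
    generalize Real.Gamma (1 - β) = G4 at *
    have e : Real.sqrt Real.pi * ((1 - β / 2) * G6) / (G4 * ((1 + β) / 2 * G7)) =
        (2 - β) / (1 + β) * (2 ^ β * S) := by
      calc _ = Real.sqrt Real.pi * ((1 - β / 2) * G6) / (G4 * ((1 + β) / 2)) * G7⁻¹ := by
            field_simp
        _ = Real.sqrt Real.pi * (1 - β / 2) / (G4 * ((1 + β) / 2)) * (G5 * G6) * S / Real.pi := by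
            rw [hr]; ring
        _ = (Real.sqrt Real.pi * Real.sqrt Real.pi) * (1 - β / 2) / ((1 + β) / 2) * 2 ^ β * S /
            Real.pi := by rw [hd]; field_simp
        _ = _ := by rw [Real.mul_self_sqrt hpi.le]; field_simp
    rw [e]
    calc _ ≤ (2 - β) / (1 + β) * ((1 + β) * 1) := by
          have : 0 ≤ (2 - β) / (1 + β) := div_nonneg (by linarith) (by linarith)
          exact mul_le_mul_of_nonneg_left (by nlinarith) this
      _ = 2 - β := by field_simp
      _ ≤ _ := by
        rw [le_div_iff₀ (by positivity)]
        nlinarith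
  | one =>
    have hr := inv_Gamma_eq_mul_sin (show β / 2 < 1 by linarith)
    have hsin := Real.sin_le (show 0 ≤ Real.pi * (β / 2) by positivity)
    push_cast
    rw [show ((1 : ℝ) + 2 - β) / 2 + 1 = (1 - β) / 2 + 1 + 1 by ring,
      Real.Gamma_add_one (by linarith), Real.Gamma_add_one (by linarith),
      show ((1 : ℝ) + 3 + β) / 2 = β / 2 + 1 + 1 by ring, Real.Gamma_add_one (by positivity),
      Real.Gamma_add_one (by positivity)]
    generalize Real.sin (Real.pi * (β / 2)) = S at *
    generalize Real.Gamma ((1 - β) / 2) = G5 at *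
    generalize Real.Gamma (1 - β / 2) = G6 at *
    generalize Real.Gamma (β / 2) = G8 at *
    generalize Real.Gamma (1 - β) = G4 at *
    have e : Real.sqrt Real.pi * (((1 - β) / 2 + 1) * ((1 - β) / 2 * G5)) /
        (G4 * ((β / 2 + 1) * (β / 2 * G8))) =
        (3 - β) * (1 - β) / ((β + 2) * β) * (2 ^ β * S) := by
      calc _ = Real.sqrt Real.pi * (((1 - β) / 2 + 1) * ((1 - β) / 2 * G5)) /
            (G4 * ((β / 2 + 1) * (β / 2))) * G8⁻¹ := by field_simp
        _ = Real.sqrt Real.pi * (((1 - β) / 2 + 1) * ((1 - β) / 2)) /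
            (G4 * ((β / 2 + 1) * (β / 2))) * (G5 * G6) * S / Real.pi := by rw [hr]; ring
        _ = (Real.sqrt Real.pi * Real.sqrt Real.pi) * (((1 - β) / 2 + 1) * ((1 - β) / 2)) /
            ((β / 2 + 1) * (β / 2)) * 2 ^ β * S / Real.pi := by rw [hd]; field_simp
        _ = _ := by
          rw [Real.mul_self_sqrt hpi.le]
          field_simp
          ring
    rw [e]
    have hk : 0 ≤ (3 - β) * (1 - β) / ((β + 2) * β) :=
      div_nonneg (mul_nonneg (by linarith) (by linarith)) (by positivity)
    calc _ ≤ (3 - β) * (1 - β) / ((β + 2) * β) * ((1 + β) * (Real.pi * (β / 2))) := by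
          refine mul_le_mul_of_nonneg_left ?_ hk
          calc 2 ^ β * S ≤ 2 ^ β * (Real.pi * (β / 2)) := by gcongr
            _ ≤ _ := by gcongr
      _ = (3 - β) * (1 - β) * (1 + β) * Real.pi / (2 * (β + 2)) := by field_simp
      _ ≤ (3 - β) * (1 - β) * (1 + β) * 3.15 / (2 * (β + 2)) := by
        have : 0 ≤ (3 - β) * (1 - β) * (1 + β) :=
          mul_nonneg (mul_nonneg (by linarith) (by linarith)) (by linarith)
        gcongr
      _ ≤ _ := by
        rw [div_le_div_iff₀ (by positivity) (by positivity)]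
        have h3 : (3 - β) * (1 - β) * (1 + β) * (1 - β) ≤ 3 := by
          nlinarith [mul_nonneg h0.le hb.le, mul_nonneg (mul_nonneg h0.le hb.le) hb.le,
            mul_nonneg (mul_nonneg h0.le hb.le) h0.le, pow_pos h0 4]
        nlinarith [mul_nonneg h0.le hb.le]
  | more n ih _ =>
    have hn := (Nat.cast_nonneg n : (0 : ℝ) ≤ n)
    push_cast
    rw [show ((n : ℝ) + 2 + 2 - β) / 2 + 1 = (n + 2 - β) / 2 + 1 + 1 by ring,
      Real.Gamma_add_one (by linarith), show ((n : ℝ) + 2 + 3 + β) / 2 = (n + 3 + β) / 2 + 1 by ring,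
      Real.Gamma_add_one (s := (n + 3 + β) / 2) (by positivity)]
    have g9 := Real.Gamma_pos_of_pos (show 0 < ((n : ℝ) + 3 + β) / 2 by positivity)
    generalize Real.Gamma (((n : ℝ) + 2 - β) / 2 + 1) = G1 at *
    generalize Real.Gamma (((n : ℝ) + 3 + β) / 2) = G2 at *
    calc _ = (n + 4 - β) / (n + 3 + β) * (Real.sqrt Real.pi * G1 /
          (Real.Gamma (1 - β) * G2)) := by field_simp; ring
      _ ≤ (n + 4 - β) / (n + 3 + β) * ((n + 4 - β) / (2 * (1 - β))) := by
        refine mul_le_mul_of_nonneg_left ih (div_nonneg ?_ ?_) <;> linarith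
      _ ≤ _ := by
        rw [div_mul_div_comm, div_le_div_iff₀ (by positivity) (by positivity)]
        nlinarith [mul_nonneg hn h0.le, mul_pos h0 hb, mul_pos hb hb]

theorem fracLegendre_at_zero_sq_add_le {n : ℕ} {β κ x : ℝ} (h0 : 0 ≤ β) (hx : x = (n - β + 1) / 2)
    (hx0 : 0 < x) (hκ : 0 < κ)
    (h : 4 * (Real.Gamma (x + 1 / 2) * Real.Gamma (x + β + 1 / 2)) ^ 2 ≤
      κ * (Real.Gamma x * Real.Gamma (x + β)) ^ 2) :
    fracLegendre n β 0 ^ 2 + fracLegendre n (β - 1) 0 ^ 2 / κ ≤ fracLegendreAmp n β ^ 2 := by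
  have hpi := Real.pi_pos
  have hsp := Real.sqrt_pos.2 hpi
  have hsq := Real.mul_self_sqrt hpi.le
  have g1 := Real.Gamma_pos_of_pos hx0
  have g2 := Real.Gamma_pos_of_pos (show 0 < x + 1 / 2 by linarith)
  have g3 := Real.Gamma_pos_of_pos (show 0 < x + β by linarith)
  have g4 := Real.Gamma_pos_of_pos (show 0 < x + β + 1 / 2 by linarith)
  have h2 := Real.rpow_pos_of_pos (show (0 : ℝ) < 2 by norm_num) β
  have hA : fracLegendreAmp n β =
      Real.Gamma x / (2 ^ β * Real.sqrt Real.pi * Real.Gamma (x + β + 1 / 2)) := by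
    rw [fracLegendreAmp, hx]
    congr 3
    ring
  have hy : fracLegendre n β 0 = fracLegendreAmp n β * Real.sin (Real.pi * x) := by
    rw [fracLegendre_at_zero n h0, hA, show (β - n + 1) / 2 = 1 - x by rw [hx]; ring,
      inv_Gamma_eq_mul_sin (by linarith), show ((n : ℝ) + β) / 2 + 1 = x + β + 1 / 2 by rw [hx]; ring,
      Real.rpow_neg (by norm_num), show 1 - (1 - x) = x by ring,
      show Real.pi * (1 - x) = Real.pi - Real.pi * x by ring, Real.sin_pi_sub]
    generalize Real.Gamma x = a at *
    generalize Real.Gamma (x + β + 1 / 2) = b at *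
    generalize Real.sin (Real.pi * x) = S
    field_simp
    rw [sq, hsq]
    ring
  have hz : fracLegendre n (β - 1) 0 = 2 * Real.Gamma (x + 1 / 2) * Real.cos (Real.pi * x) /
      (2 ^ β * Real.sqrt Real.pi * Real.Gamma (x + β)) := by
    have e := fracLegendre_up n β (show (0 : ℝ) < 1 by norm_num)
    have e1 : fracLegendre n (β - 1) 0 = (n + 1 + β) * fracLegendre (n + 1) β 0 := by linarith
    rw [e1, fracLegendre_at_zero (n + 1) h0]
    push_cast
    rw [show (β - (n + 1) + 1) / 2 = 1 / 2 - x by rw [hx]; ring,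
      inv_Gamma_eq_mul_sin (by linarith),
      show ((n : ℝ) + 1 + β) / 2 + 1 = x + β + 1 by rw [hx]; ring,
      Real.Gamma_add_one (show x + β ≠ 0 by positivity), Real.rpow_neg (by norm_num),
      show 1 - (1 / 2 - x) = x + 1 / 2 by ring,
      show Real.pi * (1 / 2 - x) = Real.pi / 2 - Real.pi * x by ring, Real.sin_pi_div_two_sub,
      show (n : ℝ) + 1 + β = 2 * (x + β) by rw [hx]; ring]
    have hxb : 0 < x + β := by linarith
    generalize Real.Gamma (x + 1 / 2) = a at *
    generalize Real.Gamma (x + β) = b at *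
    generalize x + β = c at *
    generalize Real.cos (Real.pi * x) = S
    field_simp
    rw [sq, hsq]
    ring
  have hB : (2 * Real.Gamma (x + 1 / 2) / (2 ^ β * Real.sqrt Real.pi * Real.Gamma (x + β))) ^ 2 ≤
      κ * fracLegendreAmp n β ^ 2 := by
    rw [hA]
    generalize Real.Gamma (x + 1 / 2) = a at *
    generalize Real.Gamma (x + β) = b at *
    generalize Real.Gamma x = c at *
    generalize Real.Gamma (x + β + 1 / 2) = d at *
    rw [div_pow, div_pow, ← mul_div_assoc, div_le_div_iff₀ (by positivity) (by positivity)]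
    nlinarith [mul_le_mul_of_nonneg_left h (show 0 ≤ (2 ^ β * Real.sqrt Real.pi) ^ 2 by positivity)]
  rw [hy, hz]
  have hc := Real.sin_sq_add_cos_sq (Real.pi * x)
  calc _ = fracLegendreAmp n β ^ 2 * Real.sin (Real.pi * x) ^ 2 +
      (2 * Real.Gamma (x + 1 / 2) / (2 ^ β * Real.sqrt Real.pi * Real.Gamma (x + β))) ^ 2 / κ *
        Real.cos (Real.pi * x) ^ 2 := by ring
    _ ≤ fracLegendreAmp n β ^ 2 * Real.sin (Real.pi * x) ^ 2 +
      fracLegendreAmp n β ^ 2 * Real.cos (Real.pi * x) ^ 2 := by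
      gcongr
      rw [div_le_iff₀ hκ]
      linarith
    _ = _ := by rw [← mul_add, hc, mul_one]

theorem four_mul_Gamma_half_shift_le_of_half_le {β x : ℝ} (hβ : 1 / 2 ≤ β) (hx : 0 < x) :
    4 * (Real.Gamma (x + 1 / 2) * Real.Gamma (x + β + 1 / 2)) ^ 2 ≤
      4 * (x ^ 2 + (β - 1 / 2) * x) * (Real.Gamma x * Real.Gamma (x + β)) ^ 2 := by
  have := Gamma_half_shift_le (x := x) (b := β) (p := β - 1 / 2) (q := 0) hx (by linarith)
    (fun z hz => by
      have hz0 : 0 < z := by linarith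
      have e : (z + 1 / 2) ^ 2 * (z + β + 1 / 2) ^ 2 * (z ^ 2 + (β - 1 / 2) * z + 0) -
        z ^ 2 * (z + β) ^ 2 * ((z + 1) ^ 2 + (β - 1 / 2) * (z + 1) + 0) =
        z * (z + β + 1 / 2) * ((β - 1 / 2) * (2 * z + β + 1 / 2)) / 4 := by ring
      have : 0 ≤ z * (z + β + 1 / 2) * ((β - 1 / 2) * (2 * z + β + 1 / 2)) / 4 := by
        have : 0 ≤ β - 1 / 2 := by linarith
        positivity
      linarith)
  linarith

theorem four_mul_Gamma_half_shift_le_of_le_half {β x : ℝ} (hβ0 : 0 ≤ β) (hβ : β ≤ 1 / 2)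
    (hx : 0 < x) :
    4 * (Real.Gamma (x + 1 / 2) * Real.Gamma (x + β + 1 / 2)) ^ 2 ≤
      4 * (x ^ 2 - (1 / 2 - β) * x + (1 / 2 - β) / 4) * (Real.Gamma x * Real.Gamma (x + β)) ^ 2 := by
  have := Gamma_half_shift_le (x := x) (b := β) (p := -(1 / 2 - β)) (q := (1 / 2 - β) / 4) hx
    hβ0 (fun z hz => by
      have hz0 : 0 < z := by linarith
      have e : (z + 1 / 2) ^ 2 * (z + β + 1 / 2) ^ 2 *
          (z ^ 2 + (-(1 / 2 - β)) * z + (1 / 2 - β) / 4) -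
        z ^ 2 * (z + β) ^ 2 * ((z + 1) ^ 2 + (-(1 / 2 - β)) * (z + 1) + (1 / 2 - β) / 4) =
        (z + (1 / 2 + β) / 2) * ((1 / 2 - β) * (1 / 2 + β)) / 8 := by ring
      have : 0 ≤ (z + (1 / 2 + β) / 2) * ((1 / 2 - β) * (1 / 2 + β)) / 8 := by
        have : 0 ≤ 1 / 2 - β := by linarith
        positivity
      linarith)
  linarith

theorem hasDerivAt_fracLegendre_energy (n : ℕ) {β μ t : ℝ} (hμ : μ = (n + β) * (n - β + 1))
    (h0 : μ ≠ 0) (ht : t < 1) :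
    HasDerivAt (fun t => fracLegendre n β t ^ 2 + (1 - t ^ 2) * fracLegendre n (β - 1) t ^ 2 / μ)
      (2 * (1 - 2 * β) / μ * t * fracLegendre n (β - 1) t ^ 2) t := by
  have hy := hasDerivAt_fracLegendre n β ht
  have hz := hasDerivAt_fracLegendre n (β - 1) ht
  rw [show β - 1 - 1 = β - 2 by ring] at hz
  have ho := fracLegendre_ode n β ht
  rw [← hμ] at ho
  refine ((hy.pow 2).add (((((hasDerivAt_id t).pow 2).const_sub 1).mul (hz.pow 2)).div_const μ)
    ).congr_deriv ?_
  simp only [id_eq, Pi.pow_apply]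
  push_cast
  have hw : (1 - t ^ 2) * fracLegendre n (β - 2) t =
      2 * (β - 1) * t * fracLegendre n (β - 1) t - μ * fracLegendre n β t := by linarith
  generalize fracLegendre n β t = y at *
  generalize fracLegendre n (β - 1) t = z at *
  generalize fracLegendre n (β - 2) t = w at *
  field_simp
  linear_combination (-z) * hw

theorem abs_fracLegendre_le_abs_neg_one {n : ℕ} {β t : ℝ} (hn : 1 ≤ n) (h0 : 0 ≤ β)
    (h1 : β ≤ 1 / 2) (ht : t ∈ Icc (-1 : ℝ) 0) :
    |fracLegendre n β t| ≤ |fracLegendre n β (-1)| := by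
  have hn' : (1 : ℝ) ≤ n := by exact_mod_cast hn
  have hμ : 0 < ((n : ℝ) + β) * (n - β + 1) := mul_pos (by linarith) (by linarith)
  have hd := fun (x : ℝ) (hx : x < 1) => hasDerivAt_fracLegendre_energy n (β := β) rfl hμ.ne' hx
  have hanti : AntitoneOn (fun t => fracLegendre n β t ^ 2 +
      (1 - t ^ 2) * fracLegendre n (β - 1) t ^ 2 / ((n + β) * (n - β + 1))) (Icc (-1 : ℝ) 0) := by
    refine antitoneOn_of_deriv_nonpos (convex_Icc _ _)
      (fun x hx => (hd x (by linarith [hx.2])).continuousAt.continuousWithinAt) ?_ ?_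
    · rw [interior_Icc]
      exact fun x hx => (hd x (by linarith [hx.2])).differentiableAt.differentiableWithinAt
    · rw [interior_Icc]
      intro x hx
      rw [(hd x (by linarith [hx.2])).deriv]
      have h3 : 0 ≤ 2 * (1 - 2 * β) / (((n : ℝ) + β) * (n - β + 1)) :=
        div_nonneg (by linarith) hμ.le
      exact mul_nonpos_of_nonpos_of_nonneg
        (mul_nonpos_of_nonneg_of_nonpos h3 hx.2.le) (sq_nonneg _)
  have := hanti (left_mem_Icc.2 (by norm_num)) ht ht.1
  simp only at this
  norm_num at this
  refine sq_le_sq.1 (le_trans ?_ this)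
  refine le_add_of_nonneg_right (div_nonneg (mul_nonneg ?_ (sq_nonneg _)) hμ.le)
  nlinarith [ht.1, ht.2]

theorem abs_legendre_le_one {n : ℕ} (hn : 1 ≤ n) {t : ℝ} (ht : t ∈ Icc (-1 : ℝ) 1) :
    |legendre n t| ≤ 1 := by
  have h : ∀ t ∈ Icc (-1 : ℝ) 0, |legendre n t| ≤ 1 := fun t ht => by
    have := abs_fracLegendre_le_abs_neg_one hn le_rfl (by norm_num) ht
    rw [fracLegendre_neg_one n le_rfl, fracLegendre_zero] at this
    refine this.trans ?_
    rw [abs_mul, abs_pow, abs_neg, abs_one, one_pow, one_mul]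
    rw [Finset.prod_eq_one fun j _ => by rw [sub_zero, add_zero, div_self (by positivity)]]
    norm_num
  rcases le_total t 0 with h0 | h0
  · exact h t ⟨ht.1, h0⟩
  · have := h (-t) ⟨by linarith [ht.2], by linarith⟩
    rwa [legendre_neg, abs_mul, abs_pow, abs_neg, abs_one, one_pow, one_mul] at this

theorem abs_fracLegendre_le_amp {n : ℕ} {β t : ℝ} (h1 : 1 / 2 ≤ β) (h2 : β < n + 1)
    (ht : t ∈ Icc (-1 : ℝ) 1) : |fracLegendre n β t| ≤ fracLegendreAmp n β := by
  have hA := fracLegendreAmp_pos (n := n) (by linarith) h2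
  rcases ht.2.eq_or_lt with rfl | ht1
  · rw [fracLegendre_one n (by linarith), abs_zero]
    exact hA.le
  have hn' : (0 : ℝ) ≤ n := n.cast_nonneg
  have hμ : 0 < ((n : ℝ) + β) * (n - β + 1) := mul_pos (by linarith) (by linarith)
  have hd := fun (x : ℝ) (hx : x < 1) => hasDerivAt_fracLegendre_energy n (β := β) rfl hμ.ne' hx
  have hs : 2 * (1 - 2 * β) / (((n : ℝ) + β) * (n - β + 1)) ≤ 0 :=
    div_nonpos_of_nonpos_of_nonneg (by linarith) hμ.le
  set E : ℝ → ℝ := fun t => fracLegendre n β t ^ 2 +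
      (1 - t ^ 2) * fracLegendre n (β - 1) t ^ 2 / ((n + β) * (n - β + 1)) with hE
  have hanti : AntitoneOn E (Ico 0 1) := by
    refine antitoneOn_of_deriv_nonpos (convex_Ico _ _)
      (fun x hx => (hd x hx.2).continuousAt.continuousWithinAt) ?_ ?_
    · rw [interior_Ico]
      exact fun x hx => (hd x hx.2).differentiableAt.differentiableWithinAt
    · rw [interior_Ico]
      intro x hx
      rw [(hd x hx.2).deriv]
      exact mul_nonpos_of_nonpos_of_nonneg
        (mul_nonpos_of_nonpos_of_nonneg hs hx.1.le) (sq_nonneg _)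
  have hmono : MonotoneOn E (Icc (-1) 0) := by
    refine monotoneOn_of_deriv_nonneg (convex_Icc _ _)
      (fun x hx => (hd x (by linarith [hx.2])).continuousAt.continuousWithinAt) ?_ ?_
    · rw [interior_Icc]
      exact fun x hx => (hd x (by linarith [hx.2])).differentiableAt.differentiableWithinAt
    · rw [interior_Icc]
      intro x hx
      rw [(hd x (by linarith [hx.2])).deriv]
      exact mul_nonneg (mul_nonneg_of_nonpos_of_nonpos hs hx.2.le) (sq_nonneg _)
  have h0 : E t ≤ E 0 := by
    rcases le_total t 0 with h | h
    · exact hmono ⟨ht.1, h⟩ (right_mem_Icc.2 (by norm_num)) h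
    · exact hanti (left_mem_Ico.2 (by norm_num)) ⟨h, ht1⟩ h
  have hE0 : E 0 ≤ fracLegendreAmp n β ^ 2 := by
    have hx : 0 < ((n : ℝ) - β + 1) / 2 := by linarith
    have := four_mul_Gamma_half_shift_le_of_half_le h1 hx
    rw [show 4 * ((((n : ℝ) - β + 1) / 2) ^ 2 + (β - 1 / 2) * (((n : ℝ) - β + 1) / 2)) =
      ((n : ℝ) + β) * (n - β + 1) by ring] at this
    have := fracLegendre_at_zero_sq_add_le (by linarith) rfl hx hμ this
    simpa [hE] using this
  refine abs_le_of_sq_le_sq (le_trans ?_ (h0.trans hE0)) hA.le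
  refine le_add_of_nonneg_right (div_nonneg (mul_nonneg ?_ (sq_nonneg _)) hμ.le)
  nlinarith [ht.1, ht.2]

theorem hasDerivAt_fracLegendre_sonin (n : ℕ) {β e t : ℝ} (he : e = 1 / 2 - β)
    (he0 : 0 ≤ e) (he1 : e ≤ 1) (ht0 : -1 < t) (ht : t < 1) :
    HasDerivAt (fun t => (1 - t ^ 2) ^ e * (fracLegendre n β t ^ 2 +
        (-((1 - t ^ 2) * fracLegendre n (β - 1) t) - e * t * fracLegendre n β t) ^ 2 /
          (((n : ℝ) + 1 / 2) ^ 2 * (1 - t ^ 2) + e * (1 - e))))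
      ((1 - t ^ 2) ^ e * (-(2 * e * (1 - e) * t) *
        (-((1 - t ^ 2) * fracLegendre n (β - 1) t) - e * t * fracLegendre n β t) ^ 2 /
          ((((n : ℝ) + 1 / 2) ^ 2 * (1 - t ^ 2) + e * (1 - e)) ^ 2 * (1 - t ^ 2)))) t := by
  have hu : 0 < 1 - t ^ 2 := by nlinarith
  have hψ : 0 < ((n : ℝ) + 1 / 2) ^ 2 * (1 - t ^ 2) + e * (1 - e) :=
    add_pos_of_pos_of_nonneg (by positivity) (mul_nonneg he0 (by linarith))
  have hy := hasDerivAt_fracLegendre n β ht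
  have hz := hasDerivAt_fracLegendre n (β - 1) ht
  rw [show β - 1 - 1 = β - 2 by ring] at hz
  have ho := fracLegendre_ode n β ht
  have hu' : HasDerivAt (fun t : ℝ => 1 - t ^ 2) (-(2 * t)) t := by
    simpa using ((hasDerivAt_id t).pow 2).const_sub 1
  have hq := (hu'.mul hz).neg.sub (((hasDerivAt_id t).const_mul e).mul hy)
  have hψ' := (hu'.const_mul (((n : ℝ) + 1 / 2) ^ 2)).add_const (e * (1 - e))
  refine ((hu'.rpow_const (p := e) (Or.inl hu.ne')).mul
    ((hy.pow 2).add ((hq.pow 2).div hψ' hψ.ne'))).congr_deriv ?_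
  simp only [id_eq, Pi.pow_apply, Pi.add_apply, Pi.sub_apply, Pi.mul_apply, Pi.neg_apply,
    Pi.div_apply]
  push_cast
  rw [Real.rpow_sub_one hu.ne']
  have hw : fracLegendre n (β - 2) t =
      (2 * (β - 1) * t * fracLegendre n (β - 1) t -
        ((n + β) * (n - β + 1)) * fracLegendre n β t) / (1 - t ^ 2) := by
    rw [eq_div_iff hu.ne']
    linarith
  rw [hw, show β = 1 / 2 - e by linarith]
  generalize fracLegendre n (1 / 2 - e) t = y at *
  generalize fracLegendre n (1 / 2 - e - 1) t = z at *
  generalize (1 - t ^ 2) ^ e = R at *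
  obtain ⟨ψ, hψe⟩ : ∃ ψ, ψ = ((n : ℝ) + 1 / 2) ^ 2 * (1 - t ^ 2) + e * (1 - e) := ⟨_, rfl⟩
  rw [← hψe] at hψ ⊢
  obtain ⟨u, hue⟩ : ∃ u, u = 1 - t ^ 2 := ⟨_, rfl⟩
  rw [← hue] at hu ⊢ hψe
  field_simp
  subst hψe
  subst hue
  ring

theorem abs_fracLegendre_le_rpow {n : ℕ} (hn : 1 ≤ n) {β t : ℝ} (h0 : 0 < β)
    (ht : t ∈ Ico (-1 : ℝ) 1) :
    |fracLegendre n β t| ≤ (1 - t) ^ β / Real.Gamma (1 + β) := by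
  obtain ⟨-, h⟩ := fracLegendre_intervalIntegrable_and_integral n h0 one_pos ht.2
  rw [sub_self, show β + 1 - 1 = β by ring] at h
  have hi : IntervalIntegrable (fun x => (x - t) ^ (β - 1)) volume t 1 := by
    have := (intervalIntegral.intervalIntegrable_rpow' (a := t - t) (b := 1 - t)
      (show -1 < β - 1 by linarith)).comp_sub_right t
    simpa using this
  have hint : ∫ x in t..1, (x - t) ^ (β - 1) = (1 - t) ^ β / β := by
    rw [intervalIntegral.integral_comp_sub_right (fun x => x ^ (β - 1)),
      integral_rpow (Or.inl (by linarith)), sub_self, sub_add_cancel, Real.zero_rpow h0.ne', sub_zero]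
  have hle : |Real.Gamma β * fracLegendre n β t| ≤ (1 - t) ^ β / β := by
    rw [← h, ← hint, ← Real.norm_eq_abs]
    refine intervalIntegral.norm_integral_le_of_norm_le ht.2.le (ae_of_all _ fun x hx => ?_) hi
    rw [fracLegendre_zero, Real.norm_eq_abs, abs_mul,
      abs_of_nonneg (Real.rpow_nonneg (by linarith [hx.1]) _)]
    exact mul_le_of_le_one_right (Real.rpow_nonneg (by linarith [hx.1]) _)
      (abs_legendre_le_one hn ⟨by linarith [hx.1, ht.1], hx.2⟩)
  have hG := Real.Gamma_pos_of_pos h0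
  rw [abs_mul, abs_of_pos hG] at hle
  rw [add_comm, Real.Gamma_add_one h0.ne', le_div_iff₀ (by positivity)]
  rw [le_div_iff₀ h0] at hle
  linarith

theorem rpow_mul_fracLegendre_sq_le {n : ℕ} {β t : ℝ} (h0 : 0 ≤ β) (h1 : β ≤ 1 / 2)
    (ht : t ∈ Ico (0 : ℝ) 1) :
    (1 - t) ^ (1 / 2 - β) * fracLegendre n β t ^ 2 ≤ fracLegendreAmp n β ^ 2 := by
  set e := 1 / 2 - β with he
  have he0 : 0 ≤ e := by linarith
  have he1 : e ≤ 1 := by linarith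
  have hn' : (0 : ℝ) ≤ n := n.cast_nonneg
  have hd := fun (x : ℝ) (hx : x ∈ Ico (0 : ℝ) 1) =>
    hasDerivAt_fracLegendre_sonin n he he0 he1 (show -1 < x by linarith [hx.1]) hx.2
  set S : ℝ → ℝ := fun t => (1 - t ^ 2) ^ e * (fracLegendre n β t ^ 2 +
        (-((1 - t ^ 2) * fracLegendre n (β - 1) t) - e * t * fracLegendre n β t) ^ 2 /
          (((n : ℝ) + 1 / 2) ^ 2 * (1 - t ^ 2) + e * (1 - e))) with hS
  have hanti : AntitoneOn S (Ico 0 1) := by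
    refine antitoneOn_of_deriv_nonpos (convex_Ico _ _)
      (fun x hx => (hd x hx).continuousAt.continuousWithinAt) ?_ ?_
    · rw [interior_Ico]
      exact fun x hx => (hd x ⟨hx.1.le, hx.2⟩).differentiableAt.differentiableWithinAt
    · rw [interior_Ico]
      intro x hx
      rw [(hd x ⟨hx.1.le, hx.2⟩).deriv]
      have hu : 0 < 1 - x ^ 2 := by nlinarith [hx.1, hx.2]
      refine mul_nonpos_of_nonneg_of_nonpos (Real.rpow_nonneg hu.le _)
        (div_nonpos_of_nonpos_of_nonneg (mul_nonpos_of_nonpos_of_nonneg ?_ (sq_nonneg _))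
          (by positivity))
      rw [neg_nonpos]
      exact mul_nonneg (mul_nonneg (by linarith) (by linarith)) hx.1.le
  have hS0 : S 0 ≤ fracLegendreAmp n β ^ 2 := by
    have hx : 0 < ((n : ℝ) - β + 1) / 2 := by linarith
    have hκ : 0 < ((n : ℝ) + 1 / 2) ^ 2 + e * (1 - e) :=
      add_pos_of_pos_of_nonneg (by positivity) (mul_nonneg he0 (by linarith))
    have := four_mul_Gamma_half_shift_le_of_le_half h0 h1 hx
    rw [show 4 * ((((n : ℝ) - β + 1) / 2) ^ 2 - (1 / 2 - β) * (((n : ℝ) - β + 1) / 2) +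
      (1 / 2 - β) / 4) = ((n : ℝ) + 1 / 2) ^ 2 + e * (1 - e) by rw [he]; ring] at this
    have := fracLegendre_at_zero_sq_add_le h0 rfl hx hκ this
    simpa [hS] using this
  have hle := (hanti (left_mem_Ico.2 one_pos) ht ht.1).trans hS0
  have hu : 0 ≤ 1 - t ^ 2 := by nlinarith [ht.1, ht.2]
  refine le_trans ?_ hle
  refine mul_le_mul (Real.rpow_le_rpow (by linarith [ht.2]) (by nlinarith [ht.1, ht.2]) he0)
    (le_add_of_nonneg_right (div_nonneg (sq_nonneg _) ?_)) (sq_nonneg _) (Real.rpow_nonneg hu _)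
  exact add_nonneg (by positivity) (mul_nonneg he0 (by linarith))

theorem abs_fracLegendre_le_abs_neg_one_of_le_half {n : ℕ} {β t : ℝ} (hn : 1 ≤ n) (h0 : 0 < β)
    (h1 : β ≤ 1 / 2) (ht : t ∈ Icc (-1 : ℝ) 1) :
    |fracLegendre n β t| ≤ |fracLegendre n β (-1)| := by
  rcases le_total t 0 with h | h
  · exact abs_fracLegendre_le_abs_neg_one hn h0.le h1 ⟨ht.1, h⟩
  rcases ht.2.eq_or_lt with rfl | ht1
  · rw [fracLegendre_one n h0, abs_zero]
    exact abs_nonneg _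
  rcases eq_or_ne (fracLegendre n β t) 0 with hy | hy
  · rw [hy, abs_zero]
    exact abs_nonneg _
  have hn' : (0 : ℝ) ≤ n := n.cast_nonneg
  have hY : 0 < |fracLegendre n β (-1)| := by
    rw [abs_fracLegendre_neg_one n h0.le (by linarith)]
    have := Real.Gamma_pos_of_pos (show 0 < β + 1 by linarith)
    refine mul_pos (div_pos (by positivity) this) (Finset.prod_pos fun j _ => div_pos ?_ ?_) <;>
      linarith [(j.cast_nonneg : (0 : ℝ) ≤ j)]
  have hA := fracLegendreAmp_pos (n := n) h0.le (by linarith)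
  have hG := Real.Gamma_pos_of_pos (show 0 < 1 + β by linarith)
  have ht2 : 0 < 1 - t := by linarith
  have hy' := abs_pos.2 hy
  have l1 := Real.log_le_log hy' (abs_fracLegendre_le_rpow hn h0 ⟨by linarith, ht1⟩)
  rw [Real.log_div (by positivity) hG.ne', Real.log_rpow ht2] at l1
  have l2 := Real.log_le_log (by positivity) (rpow_mul_fracLegendre_sq_le (n := n) h0.le h1 ⟨h, ht1⟩)
  rw [← sq_abs (fracLegendre n β t), Real.log_mul (by positivity) (by positivity),
    Real.log_rpow ht2, Real.log_pow, Real.log_pow] at l2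
  push_cast at l2
  have l3 := log_amp_le_log_abs_fracLegendre_neg_one n h0.le h1
  refine (Real.log_le_log_iff hy' hY).1 ?_
  have l1' := mul_le_mul_of_nonneg_left l1 (show 0 ≤ 1 - 2 * β by linarith)
  have l2' := mul_le_mul_of_nonneg_left l2 (show 0 ≤ 2 * β by linarith)
  have : (1 + 2 * β) * Real.log |fracLegendre n β t| ≤
      (1 + 2 * β) * Real.log |fracLegendre n β (-1)| := by linarith
  exact le_of_mul_le_mul_left this (by linarith)

theorem prod_add_one_sub_mul_pi {α : ℝ} (hα : ∀ j : ℤ, α ≠ j) (n : ℕ) :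
    (∏ j ∈ Finset.range n, ((j : ℝ) + 1 - α)) * Real.pi =
      Real.Gamma (n - α + 1) * Real.Gamma α * Real.sin (α * Real.pi) := by
  induction n with
  | zero =>
    have hs : Real.sin (Real.pi * α) ≠ 0 := by
      rw [Ne, Real.sin_eq_zero_iff]
      rintro ⟨j, hj⟩
      exact hα j (mul_left_cancel₀ Real.pi_ne_zero (by linarith))
    have h := Real.Gamma_mul_Gamma_one_sub α
    rw [eq_div_iff hs] at h
    rw [Finset.prod_range_zero, Nat.cast_zero, show (0 : ℝ) - α + 1 = 1 - α by ring,
      mul_comm α, one_mul]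
    linarith
  | succ n ih =>
    have h0 : (n : ℝ) - α + 1 ≠ 0 := fun h => hα (n + 1) (by push_cast; linarith)
    rw [Finset.prod_range_succ, mul_right_comm, ih]
    push_cast
    rw [show (n : ℝ) + 1 - α + 1 = n - α + 1 + 1 by ring, Real.Gamma_add_one h0]
    ring

theorem abs_fracLegendre_neg_one_eq {α : ℝ} (h0 : 0 < α) (hα : ∀ j : ℤ, α ≠ j) {n : ℕ}
    (hn : α < n) :
    |fracLegendre n α (-1)| = 2 ^ α * Real.Gamma α * |Real.sin (α * Real.pi)| *
      Real.Gamma (n - α + 1) / (Real.pi * Real.Gamma (n + α + 1)) := by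
  have hpi := Real.pi_pos
  have g1 := Real.Gamma_pos_of_pos (show 0 < 1 + α by linarith)
  have g2 := Real.Gamma_pos_of_pos h0
  have g3 := Real.Gamma_pos_of_pos (show 0 < (n : ℝ) - α + 1 by linarith)
  have g4 := Real.Gamma_pos_of_pos (show 0 < (n : ℝ) + α + 1 by positivity)
  have hp : |∏ j ∈ Finset.range n, ((j : ℝ) + 1 - α)| =
      Real.Gamma (n - α + 1) * Real.Gamma α * |Real.sin (α * Real.pi)| / Real.pi := by
    rw [eq_div_iff hpi.ne']
    have := congrArg abs (prod_add_one_sub_mul_pi hα n)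
    rwa [abs_mul, abs_of_pos hpi, abs_mul, abs_of_pos (mul_pos g3 g2)] at this
  rw [fracLegendre_neg_one n h0.le, abs_mul, abs_pow, abs_neg, abs_one, one_pow, one_mul, abs_mul,
    Finset.prod_div_distrib, abs_div (∏ j ∈ Finset.range n, ((j : ℝ) + 1 - α)), hp, prod_add_one_add_eq_Gamma_div (by linarith), add_comm α,
    show (n : ℝ) + 1 + α = n + α + 1 by ring, abs_of_pos (div_pos g4 g1),
    abs_of_pos (div_pos (by positivity) g1)]
  field_simp

theorem abs_fracLegendre_add_one_neg_one_le {n : ℕ} {β : ℝ} (h0 : 0 ≤ β) (h : β + 1 ≤ n) :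
    |fracLegendre n (β + 1) (-1)| ≤ |fracLegendre n β (-1)| := by
  have e := fracLegendre_ode n (β + 1) (show (-1 : ℝ) < 1 by norm_num)
  rw [show β + 1 - 1 = β by ring] at e
  have e1 : ((n + β + 1) * (n - β)) * fracLegendre n (β + 1) (-1) =
      2 * β * -fracLegendre n β (-1) := by linarith
  have hμ : 2 * β + 1 ≤ ((n : ℝ) + β + 1) * (n - β) := by nlinarith
  have e2 := congrArg abs e1
  rw [abs_mul, abs_mul _ (-_), abs_neg, abs_of_pos (by linarith : 0 < ((n : ℝ) + β + 1) * (n - β)),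
    abs_of_nonneg (by linarith : 0 ≤ 2 * β)] at e2
  have := abs_nonneg (fracLegendre n β (-1))
  have := abs_nonneg (fracLegendre n (β + 1) (-1))
  nlinarith

theorem abs_fracLegendre_add_natCast_neg_one_le {n : ℕ} {β : ℝ} (h0 : 0 ≤ β) (i : ℕ)
    (h : β + i ≤ n) : |fracLegendre n (β + i) (-1)| ≤ |fracLegendre n β (-1)| := by
  induction i with
  | zero => simp
  | succ i ih =>
    push_cast at h ⊢
    rw [← add_assoc] at h ⊢
    exact (abs_fracLegendre_add_one_neg_one_le (by positivity) h).trans (ih (by linarith))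

theorem abs_fracLegendre_neg_one_le_amp_add {n : ℕ} (hn : 2 ≤ n) {β : ℝ} (h0 : 0 < β)
    (h1 : β < 1) :
    |fracLegendre n β (-1)| ≤ fracLegendreAmp n β +
      (n + β) / (n - β + 2) * |fracLegendre n β (-1)| := by
  obtain ⟨n, rfl⟩ := Nat.exists_eq_add_of_le' hn
  have hA := fracLegendreAmp_pos (n := n + 2) h0.le (by push_cast; linarith [(n.cast_nonneg : (0:ℝ) ≤ n)])
  have h := mul_le_mul_of_nonneg_right (sqrt_pi_mul_Gamma_div_le n h0 h1) hA.le
  have e := abs_fracLegendre_neg_one_eq_mul_amp (n + 2) h0.le h1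
  push_cast at e ⊢
  rw [show (n : ℝ) + 2 + 1 + β = n + 3 + β by ring] at e
  rw [← e] at h
  have hn' : (0 : ℝ) ≤ n := n.cast_nonneg
  have hd : 0 < (n : ℝ) + 2 - β + 2 := by linarith
  rw [div_mul_eq_mul_div, le_div_iff₀ (by linarith)] at h
  generalize |fracLegendre (n + 2) β (-1)| = Y at *
  have : Y - (n + 2 + β) / (n + 2 - β + 2) * Y =
      Y * (2 * (1 - β)) / (n + 2 - β + 2) := by field_simp; ring
  have : Y * (2 * (1 - β)) / (n + 2 - β + 2) ≤ fracLegendreAmp (n + 2) β := by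
    rw [div_le_iff₀ hd]
    linarith
  linarith

theorem abs_fracLegendre_le_of_one_le {n m : ℕ} (hm : 1 ≤ m) {α : ℝ} (h0 : 0 < α)
    (hn : α + m < n) {t : ℝ} (ht : t ∈ Icc (-1 : ℝ) 1) :
    |fracLegendre n (α + m - 1) t| ≤ fracLegendreAmp n (α + m - 1) +
      (n + α + m - 1) / (n - α - m + 3) * |fracLegendre n α (-1)| := by
  have hm' : (1 : ℝ) ≤ m := by exact_mod_cast hm
  have hρ : 0 ≤ (n + α + m - 1) / (n - α - m + 3) * |fracLegendre n α (-1)| :=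
    mul_nonneg (div_nonneg (by linarith) (by linarith)) (abs_nonneg _)
  rcases le_total (1 / 2) (α + m - 1) with h | h
  · exact (abs_fracLegendre_le_amp h (by linarith) ht).trans (le_add_of_nonneg_right hρ)
  · obtain rfl : m = 1 := by
      have : (m : ℝ) < 2 := by linarith
      have : m < 2 := by exact_mod_cast this
      omega
    have h2 : 2 ≤ n := by
      have : ((1 : ℕ) : ℝ) < n := by push_cast at hn ⊢; linarith
      exact Nat.succ_le_of_lt (by exact_mod_cast this)
    push_cast at h ⊢
    rw [show α + 1 - 1 = α by ring] at h ⊢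
    refine (abs_fracLegendre_le_abs_neg_one_of_le_half (by omega) h0 h ht).trans ?_
    have := abs_fracLegendre_neg_one_le_amp_add h2 h0 (by linarith)
    rwa [show (n : ℝ) + α + 1 - 1 = n + α by ring, show (n : ℝ) - α - 1 + 3 = n - α + 2 by ring]

theorem abs_fracLegendre_neg_one_le_of_lt {n m i : ℕ} (hi : i < m) {α : ℝ} (h0 : 0 < α)
    (hn : α + m < n) :
    |fracLegendre n (α + i) (-1)| ≤ fracLegendreAmp n (α + m - 1) +
      (n + α + m - 1) / (n - α - m + 3) * |fracLegendre n α (-1)| := by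
  have hi' : (i : ℝ) + 1 ≤ m := by exact_mod_cast hi
  have hi0 : (0 : ℝ) ≤ i := i.cast_nonneg
  refine (abs_fracLegendre_add_natCast_neg_one_le h0.le i (by linarith)).trans ?_
  rcases le_or_gt 2 (α + m) with h | h
  · have hA := fracLegendreAmp_pos (n := n) (β := α + m - 1) (by linarith) (by linarith)
    have : 1 ≤ (n + α + m - 1) / (n - α - m + 3) := by
      rw [le_div_iff₀ (by linarith)]
      linarith
    have := le_mul_of_one_le_left (abs_nonneg (fracLegendre n α (-1))) this
    linarith
  · obtain rfl : m = 1 := by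
      have : (m : ℝ) < 2 := by linarith
      have : m < 2 := by exact_mod_cast this
      omega
    have h2 : 2 ≤ n := by
      have : ((1 : ℕ) : ℝ) < n := by push_cast at hn ⊢; linarith
      exact Nat.succ_le_of_lt (by exact_mod_cast this)
    push_cast at h ⊢
    rw [show α + 1 - 1 = α by ring]
    have := abs_fracLegendre_neg_one_le_amp_add h2 h0 (by linarith)
    rwa [show (n : ℝ) + α + 1 - 1 = n + α by ring, show (n : ℝ) - α - 1 + 3 = n - α + 2 by ring]

theorem exists_continuousOn_eqOn_Ioo {f f' : ℝ → ℝ} {a b : ℝ} (hab : a < b)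
    (hf : ∀ x ∈ Ioo a b, HasDerivAt f (f' x) x) (hf' : IntervalIntegrable f' volume a b) :
    ∃ F, ContinuousOn F (Icc a b) ∧ EqOn F f (Ioo a b) := by
  obtain ⟨c, hc⟩ := nonempty_Ioo.2 hab
  have hcm : c ∈ uIcc a b := by
    rw [uIcc_of_le hab.le]
    exact Ioo_subset_Icc_self hc
  refine ⟨fun x => f c + ∫ y in c..x, f' y, ?_, fun x hx => ?_⟩
  · rw [← uIcc_of_le hab.le]
    exact continuousOn_const.add (intervalIntegral.continuousOn_primitive_interval' hf' hcm)
  · have hsub : uIcc c x ⊆ Ioo a b := ordConnected_Ioo.uIcc_subset hc hx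
    have := intervalIntegral.integral_eq_sub_of_hasDerivAt (fun y hy => hf y (hsub hy))
      (hf'.mono_set (hsub.trans (by rw [uIcc_of_le hab.le]; exact Ioo_subset_Icc_self)))
    simp only [this]
    ring

theorem exists_tendsto_nhdsGT_of_hasDerivAt {f f' : ℝ → ℝ} {a b : ℝ} (hab : a < b)
    (hf : ∀ x ∈ Ioo a b, HasDerivAt f (f' x) x) (hf' : IntervalIntegrable f' volume a b) :
    ∃ l, Tendsto f (nhdsWithin a (Ioi a)) (nhds l) := by
  obtain ⟨F, hF, hFf⟩ := exists_continuousOn_eqOn_Ioo hab hf hf'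
  refine ⟨F a, ?_⟩
  have h := (hF a (left_mem_Icc.2 hab.le)).mono_left (nhdsWithin_mono a Ioo_subset_Icc_self)
  rw [nhdsWithin_Ioo_eq_nhdsGT hab] at h
  refine h.congr' ?_
  filter_upwards [Ioo_mem_nhdsGT hab] with x hx using hFf hx

theorem integral_mul_eq_of_hasDerivAt_neg {f f' g g' : ℝ → ℝ} {a b l : ℝ} (hab : a < b)
    (hf : ∀ x ∈ Ioo a b, HasDerivAt f (f' x) x) (hf' : IntervalIntegrable f' volume a b)
    (hl : Tendsto f (nhdsWithin a (Ioi a)) (nhds l)) (hg : ContinuousOn g (Icc a b))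
    (hgd : ∀ x ∈ Ioo a b, HasDerivAt g (-g' x) x) (hg' : IntervalIntegrable g' volume a b)
    (hgb : g b = 0) :
    ∫ x in a..b, f x * g' x = l * g a + ∫ x in a..b, f' x * g x := by
  obtain ⟨F, hF, hFf⟩ := exists_continuousOn_eqOn_Ioo hab hf hf'
  have hFa : F a = l := by
    have h := (hF a (left_mem_Icc.2 hab.le)).mono_left (nhdsWithin_mono a Ioo_subset_Icc_self)
    rw [nhdsWithin_Ioo_eq_nhdsGT hab] at h
    refine tendsto_nhds_unique (h.congr' ?_) hl
    filter_upwards [Ioo_mem_nhdsGT hab] with x hx using hFf hx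
  have hFd : ∀ x ∈ Ioo a b, HasDerivAt F (f' x) x := fun x hx =>
    (hf x hx).congr_of_eventuallyEq (hFf.eventuallyEq_of_mem (isOpen_Ioo.mem_nhds hx))
  have h := intervalIntegral.integral_mul_deriv_eq_deriv_mul_of_hasDerivAt
    (u := F) (v := g) (u' := f') (v' := fun x => -g' x)
    (by rwa [uIcc_of_le hab.le]) (by rwa [uIcc_of_le hab.le])
    (by rwa [min_eq_left hab.le, max_eq_right hab.le])
    (by rwa [min_eq_left hab.le, max_eq_right hab.le]) hf' hg'.neg
  have e : ∫ x in a..b, f x * g' x = -∫ x in a..b, F x * -g' x := by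
    rw [← intervalIntegral.integral_neg, intervalIntegral.integral_of_le hab.le,
      intervalIntegral.integral_of_le hab.le, integral_Ioc_eq_integral_Ioo,
      integral_Ioc_eq_integral_Ioo]
    exact setIntegral_congr_fun measurableSet_Ioo fun x hx => by simp only [hFf hx]; ring
  rw [e, h, hgb, hFa]
  ring

theorem integral_mul_fracLegendre_eq_sum_add (n : ℕ) {D : ℕ → ℝ → ℝ} {l : ℕ → ℝ} {γ : ℝ}
    (hγ : -1 < γ) (m : ℕ) (hD : ∀ i < m, ∀ x ∈ Ioo (-1 : ℝ) 1, HasDerivAt (D i) (D (i + 1) x) x)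
    (hi : ∀ i ≤ m, IntervalIntegrable (D i) volume (-1) 1)
    (hl : ∀ i < m, Tendsto (D i) (nhdsWithin (-1) (Ioi (-1))) (nhds (l i))) :
    ∫ x in (-1 : ℝ)..1, D 0 x * fracLegendre n γ x =
      (∑ i ∈ Finset.range m, l i * fracLegendre n (γ + 1 + i) (-1)) +
        ∫ x in (-1 : ℝ)..1, D m x * fracLegendre n (γ + m) x := by
  induction m with
  | zero => simp
  | succ m ih =>
    have hm : (0 : ℝ) ≤ m := m.cast_nonneg
    rw [ih (fun i h => hD i (by omega)) (fun i h => hi i (by omega)) (fun i h => hl i (by omega)),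
      Finset.sum_range_succ, add_assoc]
    congr 1
    push_cast
    rw [show γ + 1 + m = γ + (m + 1) by ring]
    refine integral_mul_eq_of_hasDerivAt_neg (by norm_num) (hD m m.lt_succ_self) (hi _ le_rfl)
      (hl m m.lt_succ_self) (continuous_fracLegendre n (by linarith)).continuousOn
      (fun x hx => ?_) (intervalIntegrable_fracLegendre n (by linarith) _ _)
      (fracLegendre_one n (by linarith))
    have := hasDerivAt_fracLegendre n (γ + (m + 1)) hx.2
    rwa [show γ + ((m : ℝ) + 1) - 1 = γ + m by ring] at this

theorem integral_mul_legendre_eq {n k : ℕ} (hk : 1 ≤ k) (hkn : k ≤ n) {D : ℕ → ℝ → ℝ}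
    (hD : ∀ i < k, 1 ≤ i → ∀ x ∈ Ioo (-1 : ℝ) 1, HasDerivAt (D i) (D (i + 1) x) x)
    (hi : ∀ i ≤ k, IntervalIntegrable (D i) volume (-1) 1) :
    ∫ x in (-1 : ℝ)..1, D 1 x * legendre n x =
      ∫ x in (-1 : ℝ)..1, D k x * fracLegendre n (k - 1) x := by
  obtain ⟨k, rfl⟩ := Nat.exists_eq_add_of_le' hk
  have hex : ∀ i, ∃ l, i < k → Tendsto (D (i + 1)) (nhdsWithin (-1) (Ioi (-1))) (nhds l) := by
    intro i
    by_cases h : i < k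
    · obtain ⟨l, hl⟩ := exists_tendsto_nhdsGT_of_hasDerivAt (by norm_num)
        (hD (i + 1) (by omega) (by omega)) (hi (i + 2) (by omega))
      exact ⟨l, fun _ => hl⟩
    · exact ⟨0, fun h' => absurd h' h⟩
  choose l hl using hex
  have := integral_mul_fracLegendre_eq_sum_add n (D := fun i => D (i + 1)) (γ := 0) (by norm_num) k
    (fun i h => hD (i + 1) (by omega) (by omega)) (fun i h => hi (i + 1) (by omega)) hl
  simp only [fracLegendre_zero, zero_add] at this
  push_cast
  rw [this, Finset.sum_eq_zero, zero_add, add_sub_cancel_right]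
  intro i h
  rw [Finset.mem_range] at h
  have := fracLegendre_natCast_neg_one (n := n) (j := 1 + i) (by omega) (by omega)
  push_cast at this
  rw [this, mul_zero]

theorem integral_mul_integral_rpow_swap {w P : ℝ → ℝ} {s b C : ℝ} (hs : 0 < s) (hb : 0 < b)
    (hsb : 1 ≤ s + b) (hw : IntervalIntegrable w volume (-1) 1) (hP : Measurable P) (hC0 : 0 ≤ C)
    (hC : ∀ x ∈ Ico (-1 : ℝ) 1, |P x| ≤ C * (1 - x) ^ (b - 1)) :
    ∫ t in (-1 : ℝ)..1, w t * ∫ x in t..1, (x - t) ^ (s - 1) * P x =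
      ∫ x in (-1 : ℝ)..1, (∫ t in (-1)..x, (x - t) ^ (s - 1) * w t) * P x := by
  set μ : Measure ℝ := volume.restrict (Ioo (-1) 1) with hμ
  have hw' : Integrable w μ := (intervalIntegrable_iff_integrableOn_Ioo_of_le (by norm_num)).1 hw
  set K : ℝ → ℝ → ℝ := fun t x =>
    {p : ℝ × ℝ | p.1 < p.2}.indicator (fun p => w p.1 * ((p.2 - p.1) ^ (s - 1) * P p.2)) (t, x)
    with hK
  have hKl : ∀ t, K t = (Ioi t).indicator (fun x => w t * ((x - t) ^ (s - 1) * P x)) := fun t => by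
    ext x
    simp [hK, indicator]
  have hKr : ∀ x, (fun t => K t x) =
      (Iio x).indicator (fun t => w t * ((x - t) ^ (s - 1) * P x)) := fun x => by
    ext t
    simp [hK, indicator]
  have hIoi : ∀ t ∈ Ioo (-1 : ℝ) 1, μ.restrict (Ioi t) = volume.restrict (Ioo t 1) := by
    intro t ht
    rw [hμ, Measure.restrict_restrict measurableSet_Ioi]
    congr 1
    ext x
    simp only [mem_inter_iff, mem_Ioi, mem_Ioo]
    exact ⟨fun h => ⟨h.1, h.2.2⟩, fun h => ⟨h.1, ht.1.trans h.1, h.2⟩⟩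
  have hIio : ∀ x ∈ Ioo (-1 : ℝ) 1, μ.restrict (Iio x) = volume.restrict (Ioo (-1) x) := by
    intro t ht
    rw [hμ, Measure.restrict_restrict measurableSet_Iio]
    congr 1
    ext x
    simp only [mem_inter_iff, mem_Iio, mem_Ioo]
    exact ⟨fun h => ⟨h.2.1, h.1⟩, fun h => ⟨h.2, h.1, h.2.trans ht.2⟩⟩
  have hker : ∀ t ∈ Ioo (-1 : ℝ) 1, IntegrableOn
      (fun x => C * ((x - t) ^ (s - 1) * (1 - x) ^ (b - 1))) (Ioo t 1) := fun t ht =>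
    (intervalIntegrable_iff_integrableOn_Ioo_of_le ht.2.le).1
      ((rpow_kernel_intervalIntegrable_and_integral hs hb ht.2).1.const_mul C)
  have hbd : ∀ t ∈ Ioo (-1 : ℝ) 1, ∀ x ∈ Ioo t 1, ‖(x - t) ^ (s - 1) * P x‖ ≤
      C * ((x - t) ^ (s - 1) * (1 - x) ^ (b - 1)) := by
    intro t ht x hx
    have h0 : 0 ≤ (x - t) ^ (s - 1) := Real.rpow_nonneg (by linarith [hx.1]) _
    rw [norm_mul, Real.norm_eq_abs, Real.norm_eq_abs, abs_of_nonneg h0, mul_left_comm]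
    exact mul_le_mul_of_nonneg_left (hC x ⟨by linarith [hx.1, ht.1], hx.2⟩) h0
  have hint : ∀ t ∈ Ioo (-1 : ℝ) 1, IntegrableOn (fun x => (x - t) ^ (s - 1) * P x) (Ioo t 1) := by
    intro t ht
    refine (hker t ht).mono' (by fun_prop) ?_
    exact (ae_restrict_iff' measurableSet_Ioo).2 (ae_of_all _ (hbd t ht))
  have hmeas : AEStronglyMeasurable (Function.uncurry K) (μ.prod μ) := by
    refine AEStronglyMeasurable.indicator ?_ (measurableSet_lt measurable_fst measurable_snd)
    refine hw'.aestronglyMeasurable.comp_fst.mul ?_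
    exact Measurable.aestronglyMeasurable (by fun_prop)
  have hKint : Integrable (Function.uncurry K) (μ.prod μ) := by
    rw [integrable_prod_iff hmeas]
    constructor
    · refine (ae_restrict_iff' measurableSet_Ioo).2 (ae_of_all _ fun t ht => ?_)
      change Integrable (K t) μ
      rw [hKl, integrable_indicator_iff measurableSet_Ioi, IntegrableOn, hIoi t ht]
      exact (hint t ht).const_mul _
    · refine ((hw'.norm.mul_const
        (C * (Real.Gamma s * Real.Gamma b / Real.Gamma (s + b) * 2 ^ (s + b - 1))))).mono'
        hmeas.norm.integral_prod_right' ?_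
      refine (ae_restrict_iff' measurableSet_Ioo).2 (ae_of_all _ fun t ht => ?_)
      have e : (fun x => ‖Function.uncurry K (t, x)‖) =
          (Ioi t).indicator (fun x => ‖w t‖ * ‖(x - t) ^ (s - 1) * P x‖) := by
        ext x
        change ‖K t x‖ = _
        rw [hKl, norm_indicator_eq_indicator_norm]
        simp only [norm_mul]
      rw [e, integral_indicator measurableSet_Ioi, hIoi t ht, integral_const_mul, norm_mul, norm_norm]
      refine mul_le_mul_of_nonneg_left ?_ (norm_nonneg _)
      rw [Real.norm_of_nonneg (integral_nonneg fun _ => norm_nonneg _)]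
      have h1 : 0 < 1 - t := by linarith [ht.2]
      have g1 := Real.Gamma_pos_of_pos hs
      have g2 := Real.Gamma_pos_of_pos hb
      have g3 := Real.Gamma_pos_of_pos (add_pos hs hb)
      calc ∫ x in Ioo t 1, ‖(x - t) ^ (s - 1) * P x‖
          ≤ ∫ x in Ioo t 1, C * ((x - t) ^ (s - 1) * (1 - x) ^ (b - 1)) :=
            setIntegral_mono_on (hint t ht).norm (hker t ht) measurableSet_Ioo (hbd t ht)
        _ = C * (Real.Gamma s * Real.Gamma b / Real.Gamma (s + b) * (1 - t) ^ (s + b - 1)) := by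
            rw [integral_const_mul, ← integral_Ioc_eq_integral_Ioo,
              ← intervalIntegral.integral_of_le ht.2.le,
              (rpow_kernel_intervalIntegrable_and_integral hs hb ht.2).2]
        _ ≤ _ := by
            gcongr
            linarith [ht.1]
  have hswap := integral_integral_swap hKint
  rw [intervalIntegral.integral_of_le (by norm_num), intervalIntegral.integral_of_le (by norm_num),
    integral_Ioc_eq_integral_Ioo, integral_Ioc_eq_integral_Ioo]
  refine Eq.trans ?_ (hswap.trans ?_)
  · refine setIntegral_congr_fun measurableSet_Ioo fun t ht => ?_
    rw [hKl, integral_indicator measurableSet_Ioi, hIoi t ht, integral_const_mul,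
      intervalIntegral.integral_of_le ht.2.le, integral_Ioc_eq_integral_Ioo]
  · refine setIntegral_congr_fun measurableSet_Ioo fun x hx => ?_
    rw [hKr, integral_indicator measurableSet_Iio, hIio x hx,
      intervalIntegral.integral_of_le hx.1.le, integral_Ioc_eq_integral_Ioo, ← integral_mul_const]
    refine integral_congr_ae (ae_of_all _ fun t => ?_)
    beta_reduce
    ring

theorem measurable_fracLegendre (n : ℕ) (β : ℝ) : Measurable (fracLegendre n β) := by
  unfold fracLegendre
  fun_prop

theorem integral_iteratedDeriv_mul_fracLegendre (n k : ℕ) {α : ℝ} (h0 : 0 < α) (hk : 1 ≤ k)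
    (hα : α < k) {ω : ℝ → ℝ} (hω : IntervalIntegrable (iteratedDeriv k ω) volume (-1) 1) :
    ∫ x in (-1 : ℝ)..1, iteratedDeriv k ω x * fracLegendre n (k - 1) x =
      ∫ x in (-1 : ℝ)..1, caputoL k α (-1) ω x * fracLegendre n (α - 1) x := by
  have hs : 0 < (k : ℝ) - α := by linarith
  have hk' : (1 : ℝ) ≤ k := by exact_mod_cast hk
  have hG := Real.Gamma_pos_of_pos hs
  obtain ⟨C, hC0, hC⟩ := exists_abs_fracLegendre_le n (α - 1)
  have h := integral_mul_integral_rpow_swap hs h0 (by linarith) hω (measurable_fracLegendre n _) hC0 hC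
  have e : ∫ t in (-1 : ℝ)..1, iteratedDeriv k ω t *
      ∫ x in t..1, (x - t) ^ ((k : ℝ) - α - 1) * fracLegendre n (α - 1) x =
      Real.Gamma (k - α) * ∫ x in (-1 : ℝ)..1, iteratedDeriv k ω x * fracLegendre n (k - 1) x := by
    rw [← intervalIntegral.integral_const_mul, intervalIntegral.integral_of_le (by norm_num),
      intervalIntegral.integral_of_le (by norm_num), integral_Ioc_eq_integral_Ioo,
      integral_Ioc_eq_integral_Ioo]
    refine setIntegral_congr_fun measurableSet_Ioo fun t ht => ?_
    rw [(fracLegendre_intervalIntegrable_and_integral n hs h0 ht.2).2,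
      show (k : ℝ) - α + α - 1 = k - 1 by ring]
    ring
  rw [e] at h
  simp only [caputoL, mul_assoc, intervalIntegral.integral_const_mul]
  rw [← h, ← mul_assoc, one_div, inv_mul_cancel₀ hG.ne', one_mul]

theorem integral_deriv_mul_legendre_eq {k m n : ℕ} (hk : 1 ≤ k) (hkn : k ≤ n) {α : ℝ} (h0 : 0 < α)
    (hα : α < k) {ω : ℝ → ℝ} {L : ℕ → ℝ} (hω : MemUL k m α ω L) :
    ∫ x in (-1 : ℝ)..1, deriv ω x * legendre n x =
      (∑ i ∈ Finset.range m, L i * fracLegendre n (α + i) (-1)) +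
        ∫ x in (-1 : ℝ)..1, iteratedDeriv m (caputoL k α (-1) ω) x *
          fracLegendre n (α + m - 1) x := by
  obtain ⟨-, hd, hi, hvd, hvi, hL⟩ := hω
  rw [← iteratedDeriv_one, integral_mul_legendre_eq (D := fun i => iteratedDeriv i ω) hk hkn
    (fun i h _ => hd i h) hi,
    integral_iteratedDeriv_mul_fracLegendre n k h0 hk hα (hi k le_rfl)]
  have := integral_mul_fracLegendre_eq_sum_add n (γ := α - 1) (by linarith) m hvd hvi hL
  simp only [iteratedDeriv_zero, sub_add_cancel] at this
  rw [this, show α - 1 + m = α + m - 1 by ring]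

theorem abs_integral_deriv_mul_legendre_le {k m n : ℕ} (hk : 1 ≤ k) (hkn : k ≤ n) {α M : ℝ}
    (h0 : 0 < α) (hα : α < k) {ω : ℝ → ℝ} {L : ℕ → ℝ} (hω : MemUL k m α ω L)
    (hM : ∀ t ∈ Icc (-1 : ℝ) 1, |fracLegendre n (α + m - 1) t| ≤ M)
    (hM' : ∀ i < m, |fracLegendre n (α + i) (-1)| ≤ M) :
    |∫ x in (-1 : ℝ)..1, deriv ω x * legendre n x| ≤ M * UsemiL k m α ω L := by
  rw [integral_deriv_mul_legendre_eq hk hkn h0 hα hω, UsemiL, mul_add, add_comm (M * _)]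
  refine (abs_add_le _ _).trans (add_le_add ?_ ?_)
  · rw [Finset.mul_sum]
    refine (Finset.abs_sum_le_sum_abs _ _).trans (Finset.sum_le_sum fun i hi => ?_)
    rw [abs_mul, mul_comm]
    exact mul_le_mul_of_nonneg_right (hM' i (Finset.mem_range.1 hi)) (abs_nonneg _)
  · rw [← intervalIntegral.integral_const_mul, ← Real.norm_eq_abs]
    refine intervalIntegral.norm_integral_le_of_norm_le (by norm_num) (ae_of_all _ fun x hx => ?_)
      ((hω.2.2.2.2.1 m le_rfl).abs.const_mul M)
    rw [Real.norm_eq_abs, abs_mul, mul_comm]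
    exact mul_le_mul_of_nonneg_right (hM x ⟨hx.1.le, hx.2⟩) (abs_nonneg _)

/-- bound on the `n`-th Legendre coefficient of the derivative `ω′`
for `ω ∈ 𝒰^{α,m}_{−1+}((−1,1))` and `n > α + m`. -/
theorem stmt_7 (k m : ℕ) (hk : 1 ≤ k) (hm : 1 ≤ m) (α : ℝ)
    (hα1 : (k : ℝ) - 1 < α) (hα2 : α < (k : ℝ)) (hαint : ∀ j : ℤ, α ≠ (j : ℝ))
    (ω : ℝ → ℝ) (L : ℕ → ℝ) (hω : MemUL k m α ω L)
    (n : ℕ) (hn : α + (m : ℝ) < (n : ℝ)) :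
    |legCoeff (deriv ω) n| ≤
      ((2 * (n : ℝ) + 1) * Real.Gamma (((n : ℝ) - α - (m : ℝ)) / 2 + 1) /
          ((2 : ℝ) ^ (α + (m : ℝ)) * Real.sqrt Real.pi *
            Real.Gamma (((n : ℝ) + α + (m : ℝ) + 1) / 2)) +
        |Real.sin (α * Real.pi)| *
          (((n : ℝ) + α + (m : ℝ) - 1) / ((n : ℝ) - α - (m : ℝ) + 3)) *
          ((2 : ℝ) ^ (α - 1) * Real.Gamma α * ((2 * (n : ℝ) + 1) / Real.pi) *
            (Real.Gamma ((n : ℝ) - α + 1) / Real.Gamma ((n : ℝ) + α + 1)))) *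
      UsemiL k m α ω L := by
  have hk' : (1 : ℝ) ≤ k := by exact_mod_cast hk
  have hm' : (1 : ℝ) ≤ m := by exact_mod_cast hm
  have h0 : 0 < α := by linarith
  have hkn : k ≤ n := by exact_mod_cast (show (k : ℝ) ≤ n by linarith)
  have h := abs_integral_deriv_mul_legendre_le hk hkn h0 hα2 hω
    (fun t ht => abs_fracLegendre_le_of_one_le hm h0 hn ht)
    (fun i hi => abs_fracLegendre_neg_one_le_of_lt hi h0 hn)
  rw [legCoeff, abs_mul, abs_of_pos (show 0 < (2 * (n : ℝ) + 1) / 2 by positivity)]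
  refine (mul_le_mul_of_nonneg_left h (by positivity)).trans_eq ?_
  rw [← mul_assoc, abs_fracLegendre_neg_one_eq h0 hαint (by linarith), fracLegendreAmp,
    show ((n : ℝ) - (α + m - 1) + 1) / 2 = (n - α - m) / 2 + 1 by ring,
    show ((n : ℝ) + (α + m - 1)) / 2 + 1 = (n + α + m + 1) / 2 by ring,
    Real.rpow_sub_one two_ne_zero, Real.rpow_sub_one two_ne_zero]
  congr 1
  have hsp := Real.sqrt_pos.2 Real.pi_pos
  have g1 := Real.Gamma_pos_of_pos (show 0 < ((n : ℝ) + α + m + 1) / 2 by positivity)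
  have g2 := Real.Gamma_pos_of_pos (show 0 < (n : ℝ) + α + 1 by positivity)
  have h3 : 0 < (n : ℝ) - α - m + 3 := by linarith
  field_simp
end
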